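/- Let n ≥ 1 be an integer, γ ∈ (1,(n+2)/n), κ > 0 and τ > 0. Let f₀ : ℝⁿ×ℝⁿ → [0,∞) be measurable with ∬_{ℝ²ⁿ}(1+|v|²) f₀(x,v) dx dv < ∞ and ∬_{ℝ²ⁿ} f₀(x,v)^{1+2/d} dx dv < ∞. Then there exists a measurable f : [0,∞)×ℝⁿ×ℝⁿ → [0,∞) with sup_{t≥0} ∬_{ℝ²ⁿ}(1+|v|²) f(t,x,v) dx dv < ∞ and sup_{t≥0} ∬_{ℝ²ⁿ} f(t,x,v)^{1+2/d} dx dv < ∞ such that: (i) for every t ≥ 0 and almost every (x,v) ∈ ℝ²ⁿ, f(t,x,v) = e^{-t/τ} f₀(x−vt,v) + (1/τ)∫₀^t e^{−(t−s)/τ} M[f(s,x−v(t−s),·)](v) ds, where M[f(s,y,·)] denotes the Maxwellian of the velocity profile v ↦ f(s,y,v); and (ii) for every t ≥ 0 the kinetic entropy inequality holds: ∬_{ℝ²ⁿ} H(f(t,x,v),v) dx dv + (1/τ)∫₀^t ∬_{ℝ²ⁿ} [H(f(s,x,v),v) − H(M[f(s,x,·)](v),v)] dx dv ds ≤ ∬_{ℝ²ⁿ}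 H(f₀(x,v),v) dx dv. -/

import Mathlib

open MeasureTheory Real

noncomputable section

abbrev En (n : ℕ) := EuclideanSpace ℝ (Fin n)

/-- degree of freedom `d = 2/(γ-1) - n`. -/
def dof (n : ℕ) (γ : ℝ) : ℝ := 2 / (γ - 1) - n

/-- the constant `c₁ = 2γκ/(γ-1)`. -/
def cc1 (γ κ : ℝ) : ℝ := 2 * γ * κ / (γ - 1)

/-- the constant `c₂ = (2γκ/(γ-1))^{-1/(γ-1)} Γ(γ/(γ-1)) / (π^{n/2} Γ(d/2+1))`. -/
def cc2 (n : ℕ) (γ κ : ℝ) : ℝ :=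
  (2 * γ * κ / (γ - 1)) ^ (-(1 / (γ - 1))) * Real.Gamma (γ / (γ - 1)) /
    (Real.pi ^ ((n : ℝ) / 2) * Real.Gamma (dof n γ / 2 + 1))

/-- the Maxwellian `M[ρ,u](v) = c₂ (c₁ ρ^{γ-1} - |v-u|²)₊^{d/2}` (case `γ < (n+2)/n`). -/
def Maxw (n : ℕ) (γ κ ρ : ℝ) (u v : En n) : ℝ :=
  cc2 n γ κ * (max (cc1 γ κ * ρ ^ (γ - 1) - ‖v - u‖ ^ 2) 0) ^ (dof n γ / 2)

/-- macroscopic density `ρ_f = ∫ f dv`. -/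
def densF (n : ℕ) (f : En n → ℝ) : ℝ := ∫ v, f v

/-- bulk velocity `u_f = ρ_f⁻¹ ∫ v f dv` if `ρ_f ≠ 0`, else `0`. -/
def bulkF (n : ℕ) (f : En n → ℝ) : En n :=
  if densF n f = 0 then 0 else (densF n f)⁻¹ • ∫ v, f v • v

/-- the Maxwellian `M[f] = M[ρ_f, u_f]` of a velocity profile `f`. -/
def MaxwOf (n : ℕ) (γ κ : ℝ) (f : En n → ℝ) (v : En n) : ℝ :=
  Maxw n γ κ (densF n f) (bulkF n f) v

/-- kinetic entropy `H(y,v) = |v|² y/2 + (1/(2 c₂^{2/d})) y^{1+2/d}/(1+2/d)`. -/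
def kinEnt (n : ℕ) (γ κ y : ℝ) (v : En n) : ℝ :=
  ‖v‖ ^ 2 * y / 2 +
    (1 / (2 * cc2 n γ κ ^ (2 / dof n γ))) * y ^ (1 + 2 / dof n γ) / (1 + 2 / dof n γ)

/-! ### The Maxwellian profile -/

lemma dof_pos {n : ℕ} {γ : ℝ} (hn : 1 ≤ n) (hγ1 : 1 < γ) (hγ2 : γ < ((n : ℝ) + 2) / n) :
    0 < dof n γ := by
  have hn' : (0 : ℝ) < n := by exact_mod_cast hn
  have h : 0 < γ - 1 := by linarith
  rw [lt_div_iff₀ hn'] at hγ2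
  rw [dof, sub_pos, lt_div_iff₀ h]
  nlinarith

lemma integral_beta_profile {a b : ℝ} (ha : 0 < a) (hb : 0 < b) :
    ∫ x in Set.Ioi (0 : ℝ), x ^ (a - 1) * (max (1 - x) 0) ^ b =
      ProbabilityTheory.beta a (b + 1) := by
  have hB := ProbabilityTheory.beta_pos ha (by linarith : 0 < b + 1)
  have h1 : ∫ x, ProbabilityTheory.betaPDFReal a (b + 1) x = 1 := by
    rw [integral_eq_lintegral_of_nonneg_ae]
    · have := ProbabilityTheory.lintegral_betaPDF_eq_one ha (by linarith : 0 < b + 1)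
      unfold ProbabilityTheory.betaPDF at this
      rw [this]; simp
    · refine Filter.Eventually.of_forall fun x => ?_
      by_cases hx : 0 < x ∧ x < 1
      · exact (ProbabilityTheory.betaPDFReal_pos hx.1 hx.2 ha (by linarith)).le
      · simp [ProbabilityTheory.betaPDFReal, hx]
    · exact (ProbabilityTheory.measurable_betaPDFReal _ _).aestronglyMeasurable
  rw [← integral_indicator measurableSet_Ioi]
  have h2 : (Set.Ioi (0 : ℝ)).indicator (fun x => x ^ (a - 1) * (max (1 - x) 0) ^ b) =
      fun x => ProbabilityTheory.beta a (b + 1) * ProbabilityTheory.betaPDFReal a (b + 1) x := by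
    funext x
    by_cases hx : 0 < x
    · by_cases hx1 : x < 1
      · rw [Set.indicator_of_mem (by exact hx), ProbabilityTheory.betaPDFReal,
          if_pos ⟨hx, hx1⟩, max_eq_left (by linarith)]
        field_simp
        ring_nf
      · rw [Set.indicator_of_mem (by exact hx), ProbabilityTheory.betaPDFReal,
          if_neg (by tauto), max_eq_right (by linarith), Real.zero_rpow hb.ne']
        simp
    · rw [Set.indicator_of_notMem (by exact hx), ProbabilityTheory.betaPDFReal,
          if_neg (by tauto)]
      simp
  rw [h2, integral_const_mul, h1, mul_one]

lemma integral_profile {n : ℕ} (hn : 1 ≤ n) {b : ℝ} (hb : 0 < b) :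
    ∫ v : En n, (max (1 - ‖v‖ ^ 2) 0) ^ b =
      Real.pi ^ ((n : ℝ) / 2) * Real.Gamma (b + 1) / Real.Gamma ((n : ℝ) / 2 + b + 1) := by
  have hn' : (0 : ℝ) < n := by exact_mod_cast hn
  have : Nonempty (Fin n) := ⟨⟨0, hn⟩⟩
  have : Nontrivial (En n) := inferInstance
  rw [integral_fun_norm_addHaar volume (fun r => (max (1 - r ^ 2) 0) ^ b)]
  have h1 : ∫ y in Set.Ioi (0 : ℝ), y ^ (Module.finrank ℝ (En n) - 1) • (max (1 - y ^ 2) 0) ^ b =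
      ProbabilityTheory.beta ((n : ℝ) / 2) (b + 1) / 2 := by
    rw [← integral_beta_profile (by positivity) hb, ← integral_comp_rpow_Ioi_of_pos
      (g := fun x => x ^ ((n : ℝ) / 2 - 1) * (max (1 - x) 0) ^ b) (zero_lt_two), ← integral_div]
    refine setIntegral_congr_fun measurableSet_Ioi fun y hy => ?_
    have hy : 0 < y := hy
    simp only [finrank_euclideanSpace, Fintype.card_fin, smul_eq_mul]
    rw [← Real.rpow_mul hy.le, Real.rpow_two]
    have : y ^ (n - 1) = y ^ ((2 : ℝ) - 1) * y ^ (2 * ((n : ℝ) / 2 - 1)) := by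
      rw [← Real.rpow_add hy, ← Real.rpow_natCast, Nat.cast_sub hn]
      congr 1
      push_cast
      ring
    rw [this]
    ring
  rw [h1, Measure.real, EuclideanSpace.volume_ball]
  simp only [finrank_euclideanSpace, Fintype.card_fin, smul_eq_mul, nsmul_eq_mul,
    ENNReal.ofReal_one, one_pow, one_mul]
  have hG : 0 < Real.Gamma ((n : ℝ) / 2) := Real.Gamma_pos_of_pos (by positivity)
  have hG2 : 0 < Real.Gamma ((n : ℝ) / 2 + b + 1) := Real.Gamma_pos_of_pos (by positivity)
  rw [Real.Gamma_add_one (by positivity), ENNReal.toReal_ofReal (by positivity),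
    ProbabilityTheory.beta, Real.sqrt_eq_rpow, ← Real.rpow_natCast, ← Real.rpow_mul pi_pos.le,
    ← add_assoc]
  have : 1 / 2 * (n : ℝ) = (n : ℝ) / 2 := by ring
  rw [this]
  field_simp

lemma cc1_pos {γ κ : ℝ} (hγ1 : 1 < γ) (hκ : 0 < κ) : 0 < cc1 γ κ := by
  have : 0 < γ - 1 := by linarith
  have : 0 < γ := by linarith
  unfold cc1; positivity

lemma cc2_pos {n : ℕ} {γ κ : ℝ} (hn : 1 ≤ n) (hγ1 : 1 < γ) (hγ2 : γ < ((n : ℝ) + 2) / n)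
    (hκ : 0 < κ) : 0 < cc2 n γ κ := by
  have h1 : 0 < γ - 1 := by linarith
  have h2 : 0 < γ := by linarith
  have h3 := dof_pos hn hγ1 hγ2
  have h4 : 0 < Real.Gamma (γ / (γ - 1)) := Real.Gamma_pos_of_pos (by positivity)
  have h5 : 0 < Real.Gamma (dof n γ / 2 + 1) := Real.Gamma_pos_of_pos (by positivity)
  have := pi_pos
  unfold cc2; positivity

/-- The rescaled profile `c₂ (1 - |v|²)₊^{d/2}` of all Maxwellians. -/
def maxwProfile (n : ℕ) (γ κ : ℝ) (v : En n) : ℝ :=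
  cc2 n γ κ * (max (1 - ‖v‖ ^ 2) 0) ^ (dof n γ / 2)

/-- The radius of the support of the Maxwellian of density `ρ`. -/
def maxwRadius (γ κ ρ : ℝ) : ℝ := (cc1 γ κ * ρ ^ (γ - 1)) ^ ((1 : ℝ) / 2)

section

variable {n : ℕ} {γ κ : ℝ}

lemma maxwRadius_pos (hγ1 : 1 < γ) (hκ : 0 < κ) {ρ : ℝ} (hρ : 0 < ρ) :
    0 < maxwRadius γ κ ρ := by
  have := cc1_pos hγ1 hκ
  unfold maxwRadius; positivity

lemma maxwRadius_sq (hγ1 : 1 < γ) (hκ : 0 < κ) {ρ : ℝ} (hρ : 0 < ρ) :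
    maxwRadius γ κ ρ ^ 2 = cc1 γ κ * ρ ^ (γ - 1) := by
  have := cc1_pos hγ1 hκ
  rw [maxwRadius, ← Real.rpow_natCast, ← Real.rpow_mul (by positivity)]
  norm_num

lemma maxwRadius_mono (hγ1 : 1 < γ) (hκ : 0 < κ) {ρ ρ' : ℝ} (hρ : 0 < ρ) (h : ρ ≤ ρ') :
    maxwRadius γ κ ρ ≤ maxwRadius γ κ ρ' := by
  have := cc1_pos hγ1 hκ
  have h1 : 0 ≤ γ - 1 := by linarith
  unfold maxwRadius
  gcongr

lemma Maxw_eq_profile (hγ1 : 1 < γ) (hκ : 0 < κ) {ρ : ℝ} (hρ : 0 < ρ) (u v : En n) :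
    Maxw n γ κ ρ u v = maxwRadius γ κ ρ ^ dof n γ *
      maxwProfile n γ κ ((maxwRadius γ κ ρ)⁻¹ • (v - u)) := by
  have hR := maxwRadius_pos hγ1 hκ hρ
  have h : max (cc1 γ κ * ρ ^ (γ - 1) - ‖v - u‖ ^ 2) 0 = maxwRadius γ κ ρ ^ 2 *
      max (1 - ‖(maxwRadius γ κ ρ)⁻¹ • (v - u)‖ ^ 2) 0 := by
    rw [mul_max_of_nonneg _ _ (by positivity), ← maxwRadius_sq hγ1 hκ hρ, norm_smul, norm_inv,
      Real.norm_of_nonneg hR.le]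
    congr 1
    · field_simp
    · simp
  rw [Maxw, maxwProfile, h, Real.mul_rpow (by positivity) (by positivity),
    ← Real.rpow_natCast (maxwRadius γ κ ρ) 2, ← Real.rpow_mul hR.le]
  have : ((2 : ℕ) : ℝ) * (dof n γ / 2) = dof n γ := by push_cast; ring
  rw [this]
  ring

lemma maxwRadius_rpow_mul_integral (hn : 1 ≤ n) (hγ1 : 1 < γ) (hγ2 : γ < ((n : ℝ) + 2) / n)
    (hκ : 0 < κ) {ρ : ℝ} (hρ : 0 < ρ) :
    maxwRadius γ κ ρ ^ dof n γ * (maxwRadius γ κ ρ ^ n * ∫ v, maxwProfile n γ κ v) = ρ := by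
  have hd := dof_pos hn hγ1 hγ2
  have h1 : 0 < γ - 1 := by linarith
  have hR := maxwRadius_pos hγ1 hκ hρ
  have hc := cc1_pos hγ1 hκ
  have e1 : maxwRadius γ κ ρ ^ dof n γ * maxwRadius γ κ ρ ^ n = cc1 γ κ ^ (1 / (γ - 1)) * ρ := by
    rw [← Real.rpow_natCast, ← Real.rpow_add hR]
    have : dof n γ + n = 2 * (1 / (γ - 1)) := by rw [dof]; ring
    rw [this, Real.rpow_mul hR.le, Real.rpow_two, maxwRadius_sq hγ1 hκ hρ,
      Real.mul_rpow hc.le (by positivity), ← Real.rpow_mul hρ.le]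
    have : (γ - 1) * (1 / (γ - 1)) = 1 := by field_simp
    rw [this, Real.rpow_one]
  rw [← mul_assoc, e1]
  unfold maxwProfile
  rw [integral_const_mul, integral_profile hn (half_pos hd), cc2]
  have e2 : (n : ℝ) / 2 + dof n γ / 2 + 1 = γ / (γ - 1) := by
    rw [dof]; field_simp; ring
  have hG : 0 < Real.Gamma (γ / (γ - 1)) := Real.Gamma_pos_of_pos (by positivity)
  have hG2 : 0 < Real.Gamma (dof n γ / 2 + 1) := Real.Gamma_pos_of_pos (by positivity)
  have hp : 0 < Real.pi ^ ((n : ℝ) / 2) := by have := pi_pos; positivity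
  have hcp : 0 < cc1 γ κ ^ (1 / (γ - 1)) := by positivity
  have e3 : (2 * γ * κ / (γ - 1)) ^ (-(1 / (γ - 1))) = (cc1 γ κ ^ (1 / (γ - 1)))⁻¹ := by
    rw [Real.rpow_neg (by exact hc.le)]; rfl
  rw [e2, e3]
  field_simp

lemma continuous_maxwProfile (hn : 1 ≤ n) (hγ1 : 1 < γ) (hγ2 : γ < ((n : ℝ) + 2) / n) :
    Continuous (maxwProfile n γ κ) := by
  have hd := dof_pos hn hγ1 hγ2
  unfold maxwProfile
  refine continuous_const.mul (Continuous.rpow_const (by fun_prop) fun v => Or.inr (by positivity))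

lemma maxwProfile_eq_zero (hn : 1 ≤ n) (hγ1 : 1 < γ) (hγ2 : γ < ((n : ℝ) + 2) / n) {v : En n}
    (hv : 1 ≤ ‖v‖) : maxwProfile n γ κ v = 0 := by
  have hd := dof_pos hn hγ1 hγ2
  rw [maxwProfile, max_eq_right (by nlinarith), Real.zero_rpow (by positivity), mul_zero]

lemma hasCompactSupport_maxwProfile (hn : 1 ≤ n) (hγ1 : 1 < γ) (hγ2 : γ < ((n : ℝ) + 2) / n) :
    HasCompactSupport (maxwProfile n γ κ) := by
  refine HasCompactSupport.intro (isCompact_closedBall (0 : En n) 1) fun v hv => ?_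
  refine maxwProfile_eq_zero hn hγ1 hγ2 ?_
  simp at hv
  exact hv.le

lemma Maxw_nonneg (hn : 1 ≤ n) (hγ1 : 1 < γ) (hγ2 : γ < ((n : ℝ) + 2) / n) (hκ : 0 < κ)
    (ρ : ℝ) (u v : En n) : 0 ≤ Maxw n γ κ ρ u v := by
  have := cc2_pos hn hγ1 hγ2 hκ
  unfold Maxw; positivity

lemma Maxw_zero (hn : 1 ≤ n) (hγ1 : 1 < γ) (hγ2 : γ < ((n : ℝ) + 2) / n) (u v : En n) :
    Maxw n γ κ 0 u v = 0 := by
  have hd := dof_pos hn hγ1 hγ2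
  rw [Maxw, Real.zero_rpow (by linarith), max_eq_right (by nlinarith [norm_nonneg (v - u)]),
    Real.zero_rpow (by positivity), mul_zero]

lemma integral_Maxw (hn : 1 ≤ n) (hγ1 : 1 < γ) (hγ2 : γ < ((n : ℝ) + 2) / n) (hκ : 0 < κ)
    {ρ : ℝ} (hρ : 0 ≤ ρ) (u : En n) : ∫ v, Maxw n γ κ ρ u v = ρ := by
  rcases hρ.eq_or_lt with rfl | hρ
  · simp [Maxw_zero hn hγ1 hγ2]
  have hR := maxwRadius_pos hγ1 hκ hρ
  simp_rw [Maxw_eq_profile hγ1 hκ hρ]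
  rw [integral_const_mul,
    integral_sub_right_eq_self (fun v => maxwProfile n γ κ ((maxwRadius γ κ ρ)⁻¹ • v)) u,
    Measure.integral_comp_inv_smul_of_nonneg _ _ hR.le, finrank_euclideanSpace, Fintype.card_fin,
    smul_eq_mul, maxwRadius_rpow_mul_integral hn hγ1 hγ2 hκ hρ]

lemma continuous_Maxw (hn : 1 ≤ n) (hγ1 : 1 < γ) (hγ2 : γ < ((n : ℝ) + 2) / n) (ρ : ℝ)
    (u : En n) : Continuous (Maxw n γ κ ρ u) := by
  have hd := dof_pos hn hγ1 hγ2
  unfold Maxw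
  refine continuous_const.mul (Continuous.rpow_const (by fun_prop) fun v => Or.inr (by positivity))

lemma hasCompactSupport_Maxw (hn : 1 ≤ n) (hγ1 : 1 < γ) (hγ2 : γ < ((n : ℝ) + 2) / n)
    (hκ : 0 < κ) {ρ : ℝ} (hρ : 0 ≤ ρ) (u : En n) : HasCompactSupport (Maxw n γ κ ρ u) := by
  have hd := dof_pos hn hγ1 hγ2
  rcases hρ.eq_or_lt with rfl | hρ
  · have : Maxw n γ κ 0 u = 0 := by funext v; simp [Maxw_zero hn hγ1 hγ2]
    rw [this]; exact HasCompactSupport.zero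
  refine HasCompactSupport.intro (isCompact_closedBall u (maxwRadius γ κ ρ)) fun v hv => ?_
  have hR := maxwRadius_pos hγ1 hκ hρ
  rw [Maxw_eq_profile hγ1 hκ hρ, maxwProfile_eq_zero hn hγ1 hγ2, mul_zero]
  rw [norm_smul, norm_inv, Real.norm_of_nonneg hR.le, ← div_eq_inv_mul, one_le_div hR]
  rw [Metric.mem_closedBall, dist_eq_norm, not_le] at hv
  exact hv.le

lemma integrable_Maxw (hn : 1 ≤ n) (hγ1 : 1 < γ) (hγ2 : γ < ((n : ℝ) + 2) / n) (hκ : 0 < κ)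
    {ρ : ℝ} (hρ : 0 ≤ ρ) (u : En n) : Integrable (Maxw n γ κ ρ u) :=
  (continuous_Maxw hn hγ1 hγ2 ρ u).integrable_of_hasCompactSupport
    (hasCompactSupport_Maxw hn hγ1 hγ2 hκ hρ u)

lemma integrable_Maxw_smul (hn : 1 ≤ n) (hγ1 : 1 < γ) (hγ2 : γ < ((n : ℝ) + 2) / n) (hκ : 0 < κ)
    {ρ : ℝ} (hρ : 0 ≤ ρ) (u : En n) : Integrable (fun v => Maxw n γ κ ρ u v • v) :=
  ((continuous_Maxw hn hγ1 hγ2 ρ u).smul continuous_id).integrable_of_hasCompactSupport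
    (hasCompactSupport_Maxw hn hγ1 hγ2 hκ hρ u).smul_right

lemma integral_Maxw_smul (hn : 1 ≤ n) (hγ1 : 1 < γ) (hγ2 : γ < ((n : ℝ) + 2) / n) (hκ : 0 < κ)
    {ρ : ℝ} (hρ : 0 ≤ ρ) (u : En n) : ∫ v, Maxw n γ κ ρ u v • v = ρ • u := by
  have h1 : ∫ v, Maxw n γ κ ρ u v • (v - u) = 0 := by
    have e : ∀ v : En n, Maxw n γ κ ρ u v = Maxw n γ κ ρ 0 (v - u) := by
      intro v; simp [Maxw]
    simp_rw [e]
    rw [integral_sub_right_eq_self (fun v => Maxw n γ κ ρ 0 v • v) u]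
    have h2 := integral_neg_eq_self (fun v => Maxw n γ κ ρ 0 v • v) volume
    have h3 : ∀ v : En n, Maxw n γ κ ρ 0 (-v) • (-v) = -(Maxw n γ κ ρ 0 v • v) := by
      intro v; simp [Maxw]
    simp_rw [h3] at h2
    rw [integral_neg] at h2
    have h4 : (2 : ℝ) • ∫ v, Maxw n γ κ ρ 0 v • v = 0 := by
      rw [two_smul]
      nth_rewrite 1 [← h2]
      exact neg_add_cancel _
    simpa using h4
  simp_rw [smul_sub] at h1
  rw [integral_sub (integrable_Maxw_smul hn hγ1 hγ2 hκ hρ u)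
    ((integrable_Maxw hn hγ1 hγ2 hκ hρ u).smul_const u), integral_smul_const,
    integral_Maxw hn hγ1 hγ2 hκ hρ] at h1
  exact sub_eq_zero.mp h1

end

section

variable {n : ℕ} {γ κ : ℝ}

/-! ### Minimality of the entropy of Maxwellians -/

lemma kinEnt_zero (hn : 1 ≤ n) (hγ1 : 1 < γ) (hγ2 : γ < ((n : ℝ) + 2) / n) (v : En n) :
    kinEnt n γ κ 0 v = 0 := by
  have hd := dof_pos hn hγ1 hγ2
  rw [kinEnt, Real.zero_rpow (by positivity)]
  simp

lemma kinEnt_nonneg (hn : 1 ≤ n) (hγ1 : 1 < γ) (hγ2 : γ < ((n : ℝ) + 2) / n) (hκ : 0 < κ)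
    {y : ℝ} (hy : 0 ≤ y) (v : En n) : 0 ≤ kinEnt n γ κ y v := by
  have hd := dof_pos hn hγ1 hγ2
  have := cc2_pos hn hγ1 hγ2 hκ
  unfold kinEnt; positivity

lemma continuous_kinEnt (hn : 1 ≤ n) (hγ1 : 1 < γ) (hγ2 : γ < ((n : ℝ) + 2) / n) :
    Continuous (fun q : ℝ × En n => kinEnt n γ κ q.1 q.2) := by
  have hd := dof_pos hn hγ1 hγ2
  have : Continuous fun q : ℝ × En n => q.1 ^ (1 + 2 / dof n γ) :=
    Continuous.rpow_const (by fun_prop) fun v => Or.inr (by positivity)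
  unfold kinEnt
  fun_prop

@[fun_prop]
lemma measurable_kinEnt : Measurable (fun q : ℝ × En n => kinEnt n γ κ q.1 q.2) := by
  unfold kinEnt
  fun_prop

/-- Young's inequality as a tangent-line inequality for `y ↦ y ^ p / p`. -/
lemma rpow_tangent_le {p : ℝ} (hp : 1 < p) {y m : ℝ} (hy : 0 ≤ y) (hm : 0 ≤ m) :
    m ^ p / p + m ^ (p - 1) * (y - m) ≤ y ^ p / p := by
  have hpq : p.HolderConjugate (p / (p - 1)) := Real.HolderConjugate.conjExponent hp
  have h := Real.young_inequality_of_nonneg hy (Real.rpow_nonneg hm (p - 1)) hpq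
  have hp1 : 0 < p - 1 := by linarith
  rw [← Real.rpow_mul hm] at h
  have e1 : (p - 1) * (p / (p - 1)) = p := by field_simp
  rw [e1] at h
  have e2 : m ^ (p - 1) * m = m ^ p := by
    rcases hm.eq_or_lt with rfl | hm
    · rw [mul_zero, Real.zero_rpow (by linarith)]
    · rw [← Real.rpow_add_one hm.ne', sub_add_cancel]
  have e3 : m ^ p / (p / (p - 1)) = m ^ p - m ^ p / p := by field_simp
  rw [e3] at h
  nlinarith

lemma kinEnt_Maxw_tangent_le (hn : 1 ≤ n) (hγ1 : 1 < γ) (hγ2 : γ < ((n : ℝ) + 2) / n)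
    (hκ : 0 < κ) (ρ : ℝ) (u v : En n) {y : ℝ} (hy : 0 ≤ y) :
    kinEnt n γ κ (Maxw n γ κ ρ u v) v +
      ((cc1 γ κ * ρ ^ (γ - 1) - ‖u‖ ^ 2) / 2 + inner ℝ u v) * (y - Maxw n γ κ ρ u v) ≤
      kinEnt n γ κ y v := by
  have hd := dof_pos hn hγ1 hγ2
  have hc := cc2_pos hn hγ1 hγ2 hκ
  set M := Maxw n γ κ ρ u v with hM
  set s := max (cc1 γ κ * ρ ^ (γ - 1) - ‖v - u‖ ^ 2) 0 with hs
  have hM0 : 0 ≤ M := Maxw_nonneg hn hγ1 hγ2 hκ ρ u v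
  have hs0 : 0 ≤ s := le_max_right _ _
  have hMs : M = cc2 n γ κ * s ^ (dof n γ / 2) := rfl
  have hp : 1 < 1 + 2 / dof n γ := by have : 0 < 2 / dof n γ := by positivity
                                      linarith
  have ht := rpow_tangent_le hp hy hM0
  have hA : 0 < cc2 n γ κ ^ (2 / dof n γ) := by positivity
  have e1 : M ^ (1 + 2 / dof n γ - 1) = cc2 n γ κ ^ (2 / dof n γ) * s := by
    rw [add_sub_cancel_left, hMs, Real.mul_rpow hc.le (by positivity), ← Real.rpow_mul hs0]
    have : dof n γ / 2 * (2 / dof n γ) = 1 := by field_simp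
    rw [this, Real.rpow_one]
  rw [e1] at ht
  have ht2 := mul_le_mul_of_nonneg_left ht
    (by positivity : 0 ≤ 1 / (2 * cc2 n γ κ ^ (2 / dof n γ)))
  have e2 : 1 / (2 * cc2 n γ κ ^ (2 / dof n γ)) * (M ^ (1 + 2 / dof n γ) / (1 + 2 / dof n γ) +
      cc2 n γ κ ^ (2 / dof n γ) * s * (y - M)) =
      1 / (2 * cc2 n γ κ ^ (2 / dof n γ)) * M ^ (1 + 2 / dof n γ) / (1 + 2 / dof n γ) +
      s / 2 * (y - M) := by
    field_simp
  rw [e2, ← mul_div_assoc] at ht2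
  have hn2 : ‖v - u‖ ^ 2 = ‖v‖ ^ 2 - 2 * inner ℝ u v + ‖u‖ ^ 2 := by
    rw [norm_sub_sq_real, real_inner_comm]
  have h3 : 0 ≤ (‖v‖ ^ 2 / 2 + s / 2 -
      ((cc1 γ κ * ρ ^ (γ - 1) - ‖u‖ ^ 2) / 2 + inner ℝ u v)) * (y - M) := by
    rcases le_total (cc1 γ κ * ρ ^ (γ - 1) - ‖v - u‖ ^ 2) 0 with h | h
    · have hs1 : s = 0 := max_eq_right h
      have hM1 : M = 0 := by rw [hMs, hs1, Real.zero_rpow (by positivity), mul_zero]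
      rw [hM1, hs1, sub_zero]
      refine mul_nonneg ?_ hy
      linarith
    · have hs1 : s = cc1 γ κ * ρ ^ (γ - 1) - ‖v - u‖ ^ 2 := max_eq_left h
      rw [hs1, hn2]
      ring_nf
      exact le_rfl
  unfold kinEnt
  nlinarith

/-- A bound of a nonnegative density by its entropy density. -/
lemma exists_le_kinEnt (hn : 1 ≤ n) (hγ1 : 1 < γ) (hγ2 : γ < ((n : ℝ) + 2) / n)
    (hκ : 0 < κ) : ∃ K : ℝ, 0 < K ∧ ∀ (y : ℝ) (v : En n), 0 ≤ y →
      y ^ (1 + 2 / dof n γ) ≤ K * kinEnt n γ κ y v ∧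
      ‖v‖ ^ 2 * y ≤ K * kinEnt n γ κ y v := by
  have hd := dof_pos hn hγ1 hγ2
  have hc := cc2_pos hn hγ1 hγ2 hκ
  set B := 1 / (2 * cc2 n γ κ ^ (2 / dof n γ)) / (1 + 2 / dof n γ) with hB
  have hB0 : 0 < B := by positivity
  refine ⟨2 + 1 / B, by positivity, fun y v hy => ?_⟩
  have hk : kinEnt n γ κ y v = ‖v‖ ^ 2 * y / 2 + B * y ^ (1 + 2 / dof n γ) := by
    rw [kinEnt, hB]; ring
  have h1 : 0 ≤ ‖v‖ ^ 2 * y := by positivity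
  have h2 : 0 ≤ y ^ (1 + 2 / dof n γ) := by positivity
  rw [hk]
  have e : (2 + 1 / B) * (‖v‖ ^ 2 * y / 2 + B * y ^ (1 + 2 / dof n γ)) =
    ‖v‖ ^ 2 * y + 2 * B * y ^ (1 + 2 / dof n γ) + (1 / B) * (‖v‖ ^ 2 * y) / 2 +
      y ^ (1 + 2 / dof n γ) := by field_simp; ring
  rw [e]
  have h3 : 0 ≤ (1 / B) * (‖v‖ ^ 2 * y) / 2 := by positivity
  have h4 : 0 ≤ 2 * B * y ^ (1 + 2 / dof n γ) := by positivity
  constructor <;> linarith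

/-- A velocity profile of finite entropy has finite mass and momentum. -/
lemma integrable_of_kinEnt (hn : 1 ≤ n) (hγ1 : 1 < γ) (hγ2 : γ < ((n : ℝ) + 2) / n)
    (hκ : 0 < κ) {f : En n → ℝ} (hf : Measurable f) (hf0 : ∀ v, 0 ≤ f v)
    (hki : Integrable fun v => kinEnt n γ κ (f v) v) :
    Integrable f ∧ Integrable fun v => f v • v := by
  have hd := dof_pos hn hγ1 hγ2
  obtain ⟨K, hK0, hK⟩ := exists_le_kinEnt hn hγ1 hγ2 hκ
  have hi2 : Integrable fun v : En n => ‖v‖ ^ 2 * f v := by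
    refine Integrable.mono' (hki.const_mul K) (by fun_prop) (Filter.Eventually.of_forall fun v => ?_)
    rw [Real.norm_of_nonneg (by have := hf0 v; positivity)]
    exact (hK (f v) v (hf0 v)).2
  have hip : Integrable fun v : En n => f v ^ (1 + 2 / dof n γ) := by
    refine Integrable.mono' (hki.const_mul K) (by fun_prop : Measurable _).aestronglyMeasurable
      (Filter.Eventually.of_forall fun v => ?_)
    rw [Real.norm_of_nonneg (by have := hf0 v; positivity)]
    exact (hK (f v) v (hf0 v)).1
  have hif : Integrable f := by
    have h1 : Integrable ((Metric.closedBall (0 : En n) 1).indicator fun _ => (1 : ℝ)) :=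
      (integrable_indicator_iff measurableSet_closedBall).2
        (integrableOn_const measure_closedBall_lt_top.ne)
    refine Integrable.mono' ((h1.add hip).add hi2) hf.aestronglyMeasurable
      (Filter.Eventually.of_forall fun v => ?_)
    rw [Real.norm_of_nonneg (hf0 v)]
    have hfv := hf0 v
    have hp0 : 0 ≤ f v ^ (1 + 2 / dof n γ) := by positivity
    have hv0 : 0 ≤ ‖v‖ ^ 2 * f v := by positivity
    by_cases hv : ‖v‖ ≤ 1
    · simp only [Pi.add_apply]
      rw [Set.indicator_of_mem (by simpa using hv)]
      rcases le_total (f v) 1 with h | h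
      · linarith
      · have := Real.self_le_rpow_of_one_le h (by have : 0 < 2 / dof n γ := by positivity
                                                  linarith : 1 ≤ 1 + 2 / dof n γ)
        linarith
    · simp only [Pi.add_apply]
      rw [Set.indicator_of_notMem (by simpa using hv)]
      push Not at hv
      nlinarith [mul_nonneg (by nlinarith : 0 ≤ ‖v‖ ^ 2 - 1) hfv]
  have hi1 : Integrable fun v => f v • v := by
    refine Integrable.mono' (hif.add hi2) (by fun_prop) (Filter.Eventually.of_forall fun v => ?_)
    rw [norm_smul, Real.norm_of_nonneg (hf0 v)]
    simp only [Pi.add_apply]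
    nlinarith [mul_nonneg (sq_nonneg (‖v‖ - 1)) (hf0 v), hf0 v, norm_nonneg v,
      mul_nonneg (norm_nonneg v) (hf0 v)]
  exact ⟨hif, hi1⟩

lemma integrable_kinEnt_Maxw (hn : 1 ≤ n) (hγ1 : 1 < γ) (hγ2 : γ < ((n : ℝ) + 2) / n)
    (hκ : 0 < κ) {ρ : ℝ} (hρ : 0 ≤ ρ) (u : En n) :
    Integrable fun v => kinEnt n γ κ (Maxw n γ κ ρ u v) v := by
  refine Continuous.integrable_of_hasCompactSupport ?_ ?_
  · exact (continuous_kinEnt hn hγ1 hγ2).comp (f := fun v => (Maxw n γ κ ρ u v, v))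
      ((continuous_Maxw hn hγ1 hγ2 ρ u).prodMk continuous_id)
  · refine (hasCompactSupport_Maxw hn hγ1 hγ2 hκ hρ u).mono fun v hv => ?_
    rw [Function.mem_support] at hv ⊢
    intro h
    rw [h, kinEnt_zero hn hγ1 hγ2] at hv
    exact hv rfl

/-- Among velocity profiles of given mass and momentum, the Maxwellian has the least entropy. -/
lemma integral_kinEnt_Maxw_le (hn : 1 ≤ n) (hγ1 : 1 < γ) (hγ2 : γ < ((n : ℝ) + 2) / n)
    (hκ : 0 < κ) {f : En n → ℝ} (hf0 : ∀ v, 0 ≤ f v) {ρ : ℝ} (hρpos : 0 ≤ ρ) (u : En n)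
    (hki : Integrable fun v => kinEnt n γ κ (f v) v)
    (hif : Integrable f) (hi1 : Integrable fun v => f v • v)
    (hρ : ∫ v, f v = ρ) (hmom : ∫ v, f v • v = ρ • u) :
    ∫ v, kinEnt n γ κ (Maxw n γ κ ρ u v) v ≤ ∫ v, kinEnt n γ κ (f v) v := by
  have hMi := integrable_Maxw hn hγ1 hγ2 hκ hρpos u
  have hMi1 := integrable_Maxw_smul hn hγ1 hγ2 hκ hρpos u
  have hMk := integrable_kinEnt_Maxw hn hγ1 hγ2 hκ hρpos u
  have htan := fun v => kinEnt_Maxw_tangent_le hn hγ1 hγ2 hκ ρ u v (hf0 v)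
  generalize (cc1 γ κ * ρ ^ (γ - 1) - ‖u‖ ^ 2) / 2 = l at htan
  have hin : Integrable fun v => inner ℝ u (f v • v - Maxw n γ κ ρ u v • v) :=
    (hi1.sub hMi1).const_inner u
  have hlin : ∫ v, (l + inner ℝ u v) * (f v - Maxw n γ κ ρ u v) = 0 := by
    have e : ∀ v, (l + inner ℝ u v) * (f v - Maxw n γ κ ρ u v) =
        l * (f v - Maxw n γ κ ρ u v) + inner ℝ u (f v • v - Maxw n γ κ ρ u v • v) := by
      intro v
      rw [inner_sub_right, inner_smul_right, inner_smul_right]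
      ring
    simp_rw [e]
    have hs : Integrable fun v => l * (f v - Maxw n γ κ ρ u v) := (hif.sub hMi).const_mul l
    have hin0 : ∫ v, inner ℝ u (f v • v - Maxw n γ κ ρ u v • v) =
        inner ℝ u (∫ v, f v • v - Maxw n γ κ ρ u v • v) := integral_inner (hi1.sub hMi1) u
    rw [integral_add hs hin, integral_const_mul,
      integral_sub hif hMi, hin0, integral_sub hi1 hMi1,
      integral_Maxw hn hγ1 hγ2 hκ hρpos, integral_Maxw_smul hn hγ1 hγ2 hκ hρpos, hmom]
    simp [hρ]
  have hlini : Integrable fun v => (l + inner ℝ u v) * (f v - Maxw n γ κ ρ u v) := by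
    have e : ∀ v, (l + inner ℝ u v) * (f v - Maxw n γ κ ρ u v) =
        l * (f v - Maxw n γ κ ρ u v) + inner ℝ u (f v • v - Maxw n γ κ ρ u v • v) := by
      intro v
      rw [inner_sub_right, inner_smul_right, inner_smul_right]
      ring
    simp_rw [e]
    exact ((hif.sub hMi).const_mul l).add hin
  have := integral_mono (hMk.add hlini) hki htan
  rw [integral_add' hMk hlini, hlin, add_zero] at this
  exact this

lemma lintegral_kinEnt_MaxwOf_le (hn : 1 ≤ n) (hγ1 : 1 < γ) (hγ2 : γ < ((n : ℝ) + 2) / n)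
    (hκ : 0 < κ) {f : En n → ℝ} (hf : Measurable f) (hf0 : ∀ v, 0 ≤ f v) :
    ∫⁻ v, ENNReal.ofReal (kinEnt n γ κ (MaxwOf n γ κ f v) v) ≤
      ∫⁻ v, ENNReal.ofReal (kinEnt n γ κ (f v) v) := by
  have hd := dof_pos hn hγ1 hγ2
  by_cases hρ0 : densF n f = 0
  · simp [MaxwOf, hρ0, Maxw_zero hn hγ1 hγ2, kinEnt_zero hn hγ1 hγ2]
  by_cases hfin : ∫⁻ v, ENNReal.ofReal (kinEnt n γ κ (f v) v) = ⊤
  · rw [hfin]; exact le_top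
  have hk0 : ∀ v, 0 ≤ kinEnt n γ κ (f v) v := fun v => kinEnt_nonneg hn hγ1 hγ2 hκ (hf0 v) v
  have hkm : Measurable fun v => kinEnt n γ κ (f v) v :=
    measurable_kinEnt.comp (f := fun v => (f v, v)) (hf.prodMk measurable_id)
  have hki : Integrable fun v => kinEnt n γ κ (f v) v := by
    rw [← lintegral_ofReal_ne_top_iff_integrable hkm.aestronglyMeasurable
      (Filter.Eventually.of_forall hk0)]
    exact hfin
  obtain ⟨hif, hi1⟩ := integrable_of_kinEnt hn hγ1 hγ2 hκ hf hf0 hki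
  have hρpos : 0 ≤ densF n f := integral_nonneg hf0
  have hmom : ∫ v, f v • v = densF n f • bulkF n f := by
    rw [bulkF, if_neg hρ0, smul_smul, mul_inv_cancel₀ hρ0, one_smul]
  have hMk := integrable_kinEnt_Maxw hn hγ1 hγ2 hκ hρpos (bulkF n f)
  have hle := integral_kinEnt_Maxw_le hn hγ1 hγ2 hκ hf0 hρpos (bulkF n f) hki hif hi1 rfl hmom
  rw [← ofReal_integral_eq_lintegral_ofReal hki (Filter.Eventually.of_forall hk0)]
  refine le_trans (le_of_eq ?_) (ENNReal.ofReal_le_ofReal hle)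
  rw [ofReal_integral_eq_lintegral_ofReal hMk (Filter.Eventually.of_forall fun v =>
    kinEnt_nonneg hn hγ1 hγ2 hκ (Maxw_nonneg hn hγ1 hγ2 hκ _ _ v) v)]
  simp only [MaxwOf]

/-! ### Maxwellians as functions of the moments -/

/-- The Maxwellian with density `z.1` and momentum `z.2`. -/
def maxwMom (n : ℕ) (γ κ : ℝ) (z : ℝ × En n) (v : En n) : ℝ :=
  Maxw n γ κ z.1 (z.1⁻¹ • z.2) v

lemma MaxwOf_eq_maxwMom (f : En n → ℝ) (v : En n) :
    MaxwOf n γ κ f v = maxwMom n γ κ (∫ w, f w, ∫ w, f w • w) v := by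
  have : bulkF n f = (densF n f)⁻¹ • ∫ w, f w • w := by
    rw [bulkF]; split_ifs with h
    · rw [h, inv_zero, zero_smul]
    · rfl
  rw [MaxwOf, this]; rfl

lemma maxwMom_nonneg (hn : 1 ≤ n) (hγ1 : 1 < γ) (hγ2 : γ < ((n : ℝ) + 2) / n) (hκ : 0 < κ)
    (z : ℝ × En n) (v : En n) : 0 ≤ maxwMom n γ κ z v := Maxw_nonneg hn hγ1 hγ2 hκ _ _ _

@[fun_prop]
lemma measurable_maxwMom : Measurable (fun q : (ℝ × En n) × En n => maxwMom n γ κ q.1 q.2) := by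
  unfold maxwMom Maxw
  fun_prop

lemma tendsto_maxwMom (hn : 1 ≤ n) (hγ1 : 1 < γ) (hγ2 : γ < ((n : ℝ) + 2) / n) (hκ : 0 < κ)
    {ι : Type*} {l : Filter ι} {z : ι → ℝ × En n} {z₀ : ℝ × En n} (hz : ∀ i, 0 ≤ (z i).1)
    (h : Filter.Tendsto z l (nhds z₀)) (hz₀ : 0 ≤ z₀.1) (v : En n) :
    Filter.Tendsto (fun i => maxwMom n γ κ (z i) v) l (nhds (maxwMom n γ κ z₀ v)) := by
  have hd := dof_pos hn hγ1 hγ2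
  have hc := cc2_pos hn hγ1 hγ2 hκ
  have hc1 := cc1_pos hγ1 hκ
  have hγ0 : 0 < γ - 1 := by linarith
  have h1 := (continuous_fst.tendsto z₀).comp h
  have h2 := (continuous_snd.tendsto z₀).comp h
  have hr : Filter.Tendsto (fun i => (z i).1 ^ (γ - 1)) l (nhds (z₀.1 ^ (γ - 1))) :=
    h1.rpow_const (Or.inr hγ0.le)
  rcases hz₀.eq_or_lt with h0 | h0
  · have hz0 : maxwMom n γ κ z₀ v = 0 := by
      rw [maxwMom, ← h0, Maxw_zero hn hγ1 hγ2]
    rw [hz0]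
    have hb : Filter.Tendsto (fun i => cc2 n γ κ * (cc1 γ κ * (z i).1 ^ (γ - 1)) ^ (dof n γ / 2))
        l (nhds 0) := by
      have := ((hr.const_mul (cc1 γ κ)).rpow_const
        (p := dof n γ / 2) (Or.inr (by positivity))).const_mul (cc2 n γ κ)
      rw [← h0, Real.zero_rpow hγ0.ne', mul_zero, Real.zero_rpow (by positivity), mul_zero] at this
      exact this
    refine squeeze_zero (fun i => maxwMom_nonneg hn hγ1 hγ2 hκ _ _) (fun i => ?_) hb
    have hzi := hz i
    unfold maxwMom Maxw
    gcongr
    refine max_le ?_ (by positivity)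
    nlinarith [norm_nonneg (v - (z i).1⁻¹ • (z i).2)]
  · unfold maxwMom Maxw
    have hu : Filter.Tendsto (fun i => (z i).1⁻¹ • (z i).2) l (nhds (z₀.1⁻¹ • z₀.2)) :=
      (h1.inv₀ h0.ne').smul h2
    refine Filter.Tendsto.const_mul _ (Filter.Tendsto.rpow_const ?_ (Or.inr (by positivity)))
    exact ((hr.const_mul _).sub ((tendsto_const_nhds.sub hu).norm.pow 2)).max tendsto_const_nhds

lemma lintegral_maxwMom (hn : 1 ≤ n) (hγ1 : 1 < γ) (hγ2 : γ < ((n : ℝ) + 2) / n) (hκ : 0 < κ)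
    {z : ℝ × En n} (hz : 0 ≤ z.1) :
    ∫⁻ v, ENNReal.ofReal (maxwMom n γ κ z v) = ENNReal.ofReal z.1 := by
  unfold maxwMom
  rw [← ofReal_integral_eq_lintegral_ofReal (integrable_Maxw hn hγ1 hγ2 hκ hz _)
    (Filter.Eventually.of_forall fun v => Maxw_nonneg hn hγ1 hγ2 hκ _ _ _),
    integral_Maxw hn hγ1 hγ2 hκ hz]

lemma lintegral_MaxwOf_le (hn : 1 ≤ n) (hγ1 : 1 < γ) (hγ2 : γ < ((n : ℝ) + 2) / n)
    (hκ : 0 < κ) {f : En n → ℝ} (hf0 : ∀ v, 0 ≤ f v) :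
    ∫⁻ v, ENNReal.ofReal (MaxwOf n γ κ f v) ≤ ∫⁻ v, ENNReal.ofReal (f v) := by
  simp_rw [MaxwOf_eq_maxwMom]
  rw [lintegral_maxwMom hn hγ1 hγ2 hκ (integral_nonneg hf0)]
  rw [← Real.enorm_of_nonneg (integral_nonneg hf0)]
  refine (enorm_integral_le_lintegral_enorm f).trans (le_of_eq ?_)
  exact lintegral_congr fun v => Real.enorm_of_nonneg (hf0 v)

/-! ### Equicontinuity of Maxwellians under velocity translations -/

lemma tendsto_lintegral_profile_translate (hn : 1 ≤ n) (hγ1 : 1 < γ)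
    (hγ2 : γ < ((n : ℝ) + 2) / n) {ε : ℝ} (hε : 0 < ε) :
    ∃ η > 0, ∀ w : En n, ‖w‖ ≤ η →
      ∫⁻ v, ‖maxwProfile n γ κ (v - w) - maxwProfile n γ κ v‖ₑ ≤ ENNReal.ofReal ε := by
  have huc := (hasCompactSupport_maxwProfile (κ := κ) hn hγ1 hγ2).uniformContinuous_of_continuous
    (continuous_maxwProfile hn hγ1 hγ2)
  set V := (volume (Metric.closedBall (0 : En n) 2)).toReal with hV
  have hV0 : 0 ≤ V := ENNReal.toReal_nonneg
  obtain ⟨δ, hδ, hu⟩ := Metric.uniformContinuous_iff.1 huc (ε / (V + 1)) (by positivity)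
  refine ⟨min (δ / 2) 1, by positivity, fun w hw => ?_⟩
  have hw1 : ‖w‖ ≤ 1 := hw.trans (min_le_right _ _)
  have hw2 : ‖w‖ < δ := (hw.trans (min_le_left _ _)).trans_lt (by linarith)
  calc ∫⁻ v, ‖maxwProfile n γ κ (v - w) - maxwProfile n γ κ v‖ₑ
      ≤ ∫⁻ v, (Metric.closedBall (0 : En n) 2).indicator
          (fun _ => ENNReal.ofReal (ε / (V + 1))) v := by
        refine lintegral_mono fun v => ?_
        by_cases hv : v ∈ Metric.closedBall (0 : En n) 2
        · rw [Set.indicator_of_mem hv, ← ofReal_norm]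
          refine ENNReal.ofReal_le_ofReal ?_
          rw [← dist_eq_norm]
          refine (hu ?_).le
          simpa [dist_eq_norm] using hw2
        · rw [Set.indicator_of_notMem hv]
          simp only [Metric.mem_closedBall, dist_zero_right, not_le] at hv
          have hvw := norm_sub_norm_le v w
          rw [maxwProfile_eq_zero hn hγ1 hγ2 (by linarith : 1 ≤ ‖v‖),
            maxwProfile_eq_zero hn hγ1 hγ2 (by linarith : 1 ≤ ‖v - w‖)]
          simp
    _ = ENNReal.ofReal (ε / (V + 1)) * ENNReal.ofReal V := by
        rw [lintegral_indicator_const measurableSet_closedBall, hV,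
          ENNReal.ofReal_toReal measure_closedBall_lt_top.ne]
    _ ≤ ENNReal.ofReal ε := by
        rw [← ENNReal.ofReal_mul (by positivity)]
        refine ENNReal.ofReal_le_ofReal ?_
        rw [div_mul_eq_mul_div, div_le_iff₀ (by positivity)]
        nlinarith

lemma exists_lintegral_Maxw_translate_le (hn : 1 ≤ n) (hγ1 : 1 < γ)
    (hγ2 : γ < ((n : ℝ) + 2) / n) (hκ : 0 < κ) {a ε : ℝ} (ha : 0 < a) (hε : 0 < ε) :
    ∃ η > 0, ∀ (ρ : ℝ) (u w : En n), 0 ≤ ρ → ‖w‖ ≤ η →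
      ∫⁻ v, ‖Maxw n γ κ ρ u (v - w) - Maxw n γ κ ρ u v‖ₑ ≤ ENNReal.ofReal (a + ε * ρ) := by
  set I := ∫ v, maxwProfile n γ κ v with hI
  have hR1 := maxwRadius_pos hγ1 hκ one_pos
  have hI0 : 0 < I := by
    have h1 := maxwRadius_rpow_mul_integral hn hγ1 hγ2 hκ one_pos
    have h2 : 0 ≤ I := integral_nonneg fun v => by
      have := cc2_pos hn hγ1 hγ2 hκ
      unfold maxwProfile; positivity
    rcases h2.eq_or_lt with h | h
    · rw [← hI, ← h] at h1; simp at h1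
    · exact h
  obtain ⟨η, hη, h⟩ := tendsto_lintegral_profile_translate (κ := κ) hn hγ1 hγ2
    (mul_pos hε hI0)
  have hRa := maxwRadius_pos hγ1 hκ (half_pos ha)
  refine ⟨η * maxwRadius γ κ (a / 2), by positivity, fun ρ u w hρ hw => ?_⟩
  rcases lt_or_ge ρ (a / 2) with hlt | hge
  · have hm := integrable_Maxw hn hγ1 hγ2 hκ hρ u
    have hle : ∫⁻ v, ENNReal.ofReal (Maxw n γ κ ρ u v) = ENNReal.ofReal ρ := by
      rw [← ofReal_integral_eq_lintegral_ofReal hm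
        (Filter.Eventually.of_forall fun v => Maxw_nonneg hn hγ1 hγ2 hκ _ _ _),
        integral_Maxw hn hγ1 hγ2 hκ hρ]
    calc ∫⁻ v, ‖Maxw n γ κ ρ u (v - w) - Maxw n γ κ ρ u v‖ₑ
        ≤ ∫⁻ v, (ENNReal.ofReal (Maxw n γ κ ρ u (v - w)) + ENNReal.ofReal (Maxw n γ κ ρ u v)) := by
          refine lintegral_mono fun v => ?_
          refine (enorm_sub_le).trans ?_
          rw [Real.enorm_of_nonneg (Maxw_nonneg hn hγ1 hγ2 hκ _ _ _),
            Real.enorm_of_nonneg (Maxw_nonneg hn hγ1 hγ2 hκ _ _ _)]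
      _ = ENNReal.ofReal ρ + ENNReal.ofReal ρ := by
          rw [lintegral_add_right _ (continuous_Maxw hn hγ1 hγ2 ρ u).measurable.ennreal_ofReal,
            lintegral_sub_right_eq_self (fun v => ENNReal.ofReal (Maxw n γ κ ρ u v)) w, hle]
      _ ≤ ENNReal.ofReal (a + ε * ρ) := by
          rw [← ENNReal.ofReal_add hρ hρ]
          refine ENNReal.ofReal_le_ofReal ?_
          have : 0 ≤ ε * ρ := by positivity
          linarith
  · have hρ0 : 0 < ρ := by linarith
    have hR := maxwRadius_pos hγ1 hκ hρ0
    have hmono := maxwRadius_mono hγ1 hκ (half_pos ha) hge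
    set R := maxwRadius γ κ ρ with hRdef
    have hkey := maxwRadius_rpow_mul_integral hn hγ1 hγ2 hκ hρ0
    rw [← hI, ← hRdef] at hkey
    set F : En n → ENNReal := fun v =>
      ‖maxwProfile n γ κ (v - R⁻¹ • w) - maxwProfile n γ κ v‖ₑ with hF
    have hFm : Measurable F := by
      have := (continuous_maxwProfile (κ := κ) hn hγ1 hγ2).measurable
      fun_prop
    have e1 : ∀ v, ‖Maxw n γ κ ρ u (v - w) - Maxw n γ κ ρ u v‖ₑ =
        ENNReal.ofReal (R ^ dof n γ) * F (R⁻¹ • (v - u)) := by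
      intro v
      rw [Maxw_eq_profile hγ1 hκ hρ0, Maxw_eq_profile hγ1 hκ hρ0, ← mul_sub, enorm_mul,
        Real.enorm_of_nonneg (by positivity), hF]
      simp only [← smul_sub]
      congr 5
      abel
    simp_rw [e1]
    have hFm2 : Measurable fun v => F (R⁻¹ • (v - u)) := by fun_prop
    rw [lintegral_const_mul _ hFm2, lintegral_sub_right_eq_self (fun v => F (R⁻¹ • v)) u]
    have e2 : ∫⁻ v, F (R⁻¹ • v) = ENNReal.ofReal (R ^ n) * ∫⁻ v, F v := by
      have := Measure.map_addHaar_smul (volume : Measure (En n)) (inv_ne_zero hR.ne')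
      rw [← lintegral_map hFm (measurable_const_smul R⁻¹), this, lintegral_smul_measure,
        finrank_euclideanSpace, Fintype.card_fin, smul_eq_mul]
      congr 2
      rw [inv_pow, inv_inv, abs_of_nonneg (by positivity)]
    rw [e2]
    have hw2 : ‖R⁻¹ • w‖ ≤ η := by
      rw [norm_smul, norm_inv, Real.norm_of_nonneg hR.le, ← div_eq_inv_mul, div_le_iff₀ hR]
      exact hw.trans (by gcongr)
    calc _ ≤ ENNReal.ofReal (R ^ dof n γ) * (ENNReal.ofReal (R ^ n) * ENNReal.ofReal (ε * I)) := by
          gcongr; exact h _ hw2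
      _ = ENNReal.ofReal (ε * ρ) := by
          rw [← ENNReal.ofReal_mul (by positivity), ← ENNReal.ofReal_mul (by positivity)]
          congr 1
          rw [← hkey]; ring
      _ ≤ _ := ENNReal.ofReal_le_ofReal (by linarith)

end

section

variable {n : ℕ} {γ κ τ δ : ℝ}

/-! ### Convex functionals along the mild formulation -/

/-- Velocity dependent convex functions `Θ` vanishing at `0`. -/
structure IsConvexDensity (Θ : ℝ → En n → ℝ) : Prop where
  measurable : Measurable fun q : ℝ × En n => Θ q.1 q.2
  continuous : ∀ v, Continuous fun y => Θ y v
  zero : ∀ v, Θ 0 v = 0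
  nonneg : ∀ y v, 0 ≤ y → 0 ≤ Θ y v
  tangent : ∀ v m, 0 ≤ m → ∃ c, ∀ y, 0 ≤ y → Θ m v + c * (y - m) ≤ Θ y v

lemma isConvexDensity_mass : IsConvexDensity (fun (y : ℝ) (_ : En n) => y) where
  measurable := by fun_prop
  continuous _ := continuous_id
  zero _ := rfl
  nonneg _ _ h := h
  tangent _ m _ := ⟨1, fun y _ => by linarith⟩

lemma isConvexDensity_kinEnt (hn : 1 ≤ n) (hγ1 : 1 < γ) (hγ2 : γ < ((n : ℝ) + 2) / n)
    (hκ : 0 < κ) : IsConvexDensity (kinEnt n γ κ) where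
  measurable := measurable_kinEnt
  continuous v := (continuous_kinEnt hn hγ1 hγ2).comp (f := fun y => (y, v)) (by fun_prop)
  zero := kinEnt_zero hn hγ1 hγ2
  nonneg _ v h := kinEnt_nonneg hn hγ1 hγ2 hκ h v
  tangent v m hm := by
    have hd := dof_pos hn hγ1 hγ2
    have hc := cc2_pos hn hγ1 hγ2 hκ
    have hp : 1 < 1 + 2 / dof n γ := by
      have : 0 < 2 / dof n γ := by positivity
      linarith
    set B := 1 / (2 * cc2 n γ κ ^ (2 / dof n γ)) with hB
    have hB0 : 0 < B := by positivity
    refine ⟨‖v‖ ^ 2 / 2 + B * m ^ (1 + 2 / dof n γ - 1), fun y hy => ?_⟩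
    have := mul_le_mul_of_nonneg_left (rpow_tangent_le hp hy hm) hB0.le
    rw [kinEnt, kinEnt, ← hB, mul_div_assoc B (m ^ _), mul_div_assoc B (y ^ _)]
    linarith

lemma integral_exp_weight {t : ℝ} (ht : 0 ≤ t) :
    ∫ s in Set.Ioc 0 t, 1 / τ * exp (-(t - s) / τ) = 1 - exp (-t / τ) := by
  rw [← intervalIntegral.integral_of_le ht,
    intervalIntegral.integral_eq_sub_of_hasDerivAt (f := fun s => exp (-(t - s) / τ))]
  · simp
  · intro s _
    have h : HasDerivAt (fun s : ℝ => -(t - s) / τ) (1 / τ) s := by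
      have := (((hasDerivAt_id s).const_sub t).neg).div_const τ
      simpa using this
    rw [mul_comm]
    exact h.exp
  · exact (Continuous.intervalIntegrable (by fun_prop) _ _)

lemma IsConvexDensity.jensen {Θ : ℝ → En n → ℝ} (hΘ : IsConvexDensity Θ) (v : En n)
    (hτ : 0 < τ) {t : ℝ} (ht : 0 ≤ t) {a : ℝ} (ha : 0 ≤ a) {b : ℝ → ℝ}
    (hb : Measurable b) (hb0 : ∀ s, 0 ≤ b s) :
    ENNReal.ofReal (Θ (exp (-t / τ) * a + 1 / τ * ∫ s in Set.Ioc 0 t,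
      exp (-(t - s) / τ) * b s) v) ≤
    ENNReal.ofReal (exp (-t / τ)) * ENNReal.ofReal (Θ a v) + ∫⁻ s in Set.Ioc 0 t,
      ENNReal.ofReal (1 / τ * exp (-(t - s) / τ)) * ENNReal.ofReal (Θ (b s) v) := by
  by_cases hbi : IntegrableOn (fun s => exp (-(t - s) / τ) * b s) (Set.Ioc 0 t)
  swap
  · rw [integral_undef hbi]
    obtain ⟨c, hc⟩ := hΘ.tangent v (exp (-t / τ) * a) (by positivity)
    have h1 := hc a ha
    have h2 := hc 0 le_rfl
    rw [hΘ.zero] at h2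
    have he : exp (-t / τ) ≤ 1 := by
      rw [exp_le_one_iff]
      exact div_nonpos_of_nonpos_of_nonneg (by linarith) hτ.le
    have he0 := exp_pos (-t / τ)
    refine le_trans ?_ le_self_add
    rw [mul_zero, add_zero, ← ENNReal.ofReal_mul he0.le]
    refine ENNReal.ofReal_le_ofReal ?_
    nlinarith [mul_le_mul_of_nonneg_left h1 he0.le,
      mul_le_mul_of_nonneg_left h2 (by linarith : 0 ≤ 1 - exp (-t / τ))]
  have hΘb : Measurable fun s => Θ (b s) v :=
    hΘ.measurable.comp (f := fun s => (b s, v)) (by fun_prop)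
  have hw0 : ∀ s, 0 ≤ 1 / τ * exp (-(t - s) / τ) := fun s => by positivity
  simp_rw [fun s => (ENNReal.ofReal_mul (q := Θ (b s) v) (hw0 s)).symm]
  by_cases hi : IntegrableOn (fun s => 1 / τ * exp (-(t - s) / τ) * Θ (b s) v) (Set.Ioc 0 t)
  swap
  · have := (lintegral_ofReal_ne_top_iff_integrable (μ := volume.restrict (Set.Ioc 0 t))
      (f := fun s => 1 / τ * exp (-(t - s) / τ) * Θ (b s) v)
      (Measurable.mul (by fun_prop) hΘb).aestronglyMeasurable (Filter.Eventually.of_forall fun s =>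
        mul_nonneg (hw0 s) (hΘ.nonneg _ _ (hb0 s)))).not.2 hi
    rw [not_not] at this
    rw [this, add_top]
    exact le_top
  set m := exp (-t / τ) * a + 1 / τ * ∫ s in Set.Ioc 0 t, exp (-(t - s) / τ) * b s with hm
  have hm0 : 0 ≤ m := by
    have : 0 ≤ ∫ s in Set.Ioc 0 t, exp (-(t - s) / τ) * b s :=
      integral_nonneg fun s => mul_nonneg (exp_pos _).le (hb0 s)
    positivity
  obtain ⟨c, hc⟩ := hΘ.tangent v m hm0
  rw [← ofReal_integral_eq_lintegral_ofReal hi (Filter.Eventually.of_forall fun s =>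
        mul_nonneg (hw0 s) (hΘ.nonneg _ _ (hb0 s))), ← ENNReal.ofReal_mul (exp_pos _).le,
      ← ENNReal.ofReal_add (mul_nonneg (exp_pos _).le (hΘ.nonneg _ _ ha))
        (integral_nonneg fun s => mul_nonneg (hw0 s) (hΘ.nonneg _ _ (hb0 s)))]
  refine ENNReal.ofReal_le_ofReal ?_
  have hwi : IntegrableOn (fun s => 1 / τ * exp (-(t - s) / τ)) (Set.Ioc 0 t) :=
    (Continuous.integrableOn_Icc (by fun_prop)).mono_set Set.Ioc_subset_Icc_self
  have h1 : ∫ s in Set.Ioc 0 t, ((Θ m v - c * m) * (1 / τ * exp (-(t - s) / τ)) +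
      c / τ * (exp (-(t - s) / τ) * b s)) ≤
      ∫ s in Set.Ioc 0 t, 1 / τ * exp (-(t - s) / τ) * Θ (b s) v := by
    refine integral_mono ((hwi.const_mul _).add (hbi.const_mul _)) hi fun s => ?_
    have := mul_le_mul_of_nonneg_left (hc (b s) (hb0 s)) (hw0 s)
    refine le_trans (le_of_eq ?_) this
    ring
  rw [integral_add (hwi.const_mul _) (hbi.const_mul _), integral_const_mul (Θ m v - c * m),
    integral_const_mul (c / τ), integral_exp_weight ht] at h1
  have h2 := mul_le_mul_of_nonneg_left (hc a ha) (exp_pos (-t / τ)).le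
  have h3 : c / τ * (∫ s in Set.Ioc 0 t, exp (-(t - s) / τ) * b s) =
      c * (m - exp (-t / τ) * a) := by rw [hm]; ring
  rw [h3] at h1
  linarith

/-- The mild solution operator with source `g`, frozen after time `t - δ`. -/
def mildMap (τ δ : ℝ) (f₀ : En n × En n → ℝ) (g : ℝ → En n × En n → ℝ) (t : ℝ)
    (p : En n × En n) : ℝ :=
  exp (-t / τ) * f₀ (p.1 - t • p.2, p.2) + 1 / τ * ∫ s in Set.Ioc 0 (t - δ),
    exp (-(t - s) / τ) * g s (p.1 - (t - s) • p.2, p.2)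

lemma mildMap_nonneg (hτ : 0 < τ) {f₀ : En n × En n → ℝ} {g : ℝ → En n × En n → ℝ}
    (hf₀ : ∀ p, 0 ≤ f₀ p) (hg : ∀ s p, 0 ≤ g s p) (t : ℝ) (p : En n × En n) :
    0 ≤ mildMap τ δ f₀ g t p := by
  have h1 : 0 ≤ ∫ s in Set.Ioc 0 (t - δ),
    exp (-(t - s) / τ) * g s (p.1 - (t - s) • p.2, p.2) :=
    integral_nonneg fun s => mul_nonneg (exp_pos _).le (hg _ _)
  have := hf₀ (p.1 - t • p.2, p.2)
  unfold mildMap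
  positivity

lemma measurable_mildMap {f₀ : En n × En n → ℝ} {g : ℝ → En n × En n → ℝ}
    (hf₀ : Measurable f₀) (hg : Measurable (Function.uncurry g)) :
    Measurable (Function.uncurry (mildMap τ δ f₀ g)) := by
  have hg' : Measurable fun q : (ℝ × En n × En n) × ℝ => (Set.Ioc 0 (q.1.1 - δ)).indicator
      (fun s => exp (-(q.1.1 - s) / τ) * g s (q.1.2.1 - (q.1.1 - s) • q.1.2.2, q.1.2.2)) q.2 := by
    have hS : MeasurableSet {q : (ℝ × En n × En n) × ℝ | q.2 ∈ Set.Ioc 0 (q.1.1 - δ)} :=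
      (measurableSet_lt measurable_const measurable_snd).inter
        (measurableSet_le measurable_snd (by fun_prop))
    have hG : Measurable fun q : (ℝ × En n × En n) × ℝ =>
        g q.2 (q.1.2.1 - (q.1.1 - q.2) • q.1.2.2, q.1.2.2) :=
      hg.comp (f := fun q : (ℝ × En n × En n) × ℝ =>
        (q.2, (q.1.2.1 - (q.1.1 - q.2) • q.1.2.2, q.1.2.2))) (by fun_prop)
    have hind : Measurable ({q : (ℝ × En n × En n) × ℝ | q.2 ∈ Set.Ioc 0 (q.1.1 - δ)}.indicator
      fun q => exp (-(q.1.1 - q.2) / τ) * g q.2 (q.1.2.1 - (q.1.1 - q.2) • q.1.2.2, q.1.2.2)) := Measurable.indicator (by fun_prop) hS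
    refine (congrArg Measurable ?_).mp hind
    ext q
    simp [Set.indicator]
  have := hg'.stronglyMeasurable.integral_prod_right' (ν := (volume : Measure ℝ))
  have h2 : Function.uncurry (mildMap τ δ f₀ g) = fun q => exp (-q.1 / τ) *
      f₀ (q.2.1 - q.1 • q.2.2, q.2.2) + 1 / τ * ∫ s, (Set.Ioc 0 (q.1 - δ)).indicator
      (fun s => exp (-(q.1 - s) / τ) * g s (q.2.1 - (q.1 - s) • q.2.2, q.2.2)) s := by
    funext q
    rw [integral_indicator measurableSet_Ioc]
    rfl
  rw [h2]
  have := this.measurable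
  fun_prop

lemma lintegral_shear (σ : ℝ) {F : En n × En n → ENNReal} (hF : Measurable F) :
    ∫⁻ p : En n × En n, F (p.1 - σ • p.2, p.2) = ∫⁻ p, F p := by
  rw [Measure.volume_eq_prod, lintegral_prod_symm _ (by fun_prop),
    lintegral_prod_symm _ hF.aemeasurable]
  refine lintegral_congr fun v => ?_
  exact lintegral_sub_right_eq_self (fun x => F (x, v)) (σ • v)

/-- The functional `∬ Θ(f,v) dx dv`. -/
def functional (Θ : ℝ → En n → ℝ) (f : En n × En n → ℝ) : ENNReal :=
  ∫⁻ p, ENNReal.ofReal (Θ (f p) p.2)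

lemma IsConvexDensity.functional_mildMap_le {Θ : ℝ → En n → ℝ} (hΘ : IsConvexDensity Θ)
    (hτ : 0 < τ) (hδ : 0 ≤ δ) {f₀ : En n × En n → ℝ} {g : ℝ → En n × En n → ℝ}
    (hf₀m : Measurable f₀) (hf₀ : ∀ p, 0 ≤ f₀ p)
    (hgm : Measurable (Function.uncurry g)) (hg : ∀ s p, 0 ≤ g s p) {t : ℝ} (ht : 0 ≤ t) :
    functional Θ (mildMap τ δ f₀ g t) ≤ ENNReal.ofReal (exp (-t / τ)) * functional Θ f₀ +
      ∫⁻ s in Set.Ioc 0 t, ENNReal.ofReal (1 / τ * exp (-(t - s) / τ)) * functional Θ (g s) := by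
  have hΘm := hΘ.measurable
  have hcomp : ∀ {α : Type} [MeasurableSpace α] {a : α → ℝ} {c : α → En n},
      Measurable a → Measurable c → Measurable fun x => ENNReal.ofReal (Θ (a x) (c x)) :=
    fun ha hc => (hΘm.comp (ha.prodMk hc)).ennreal_ofReal
  have hgm' : ∀ p : En n × En n, Measurable fun s => g s (p.1 - (t - s) • p.2, p.2) :=
    fun p => hgm.comp (f := fun s => (s, (p.1 - (t - s) • p.2, p.2))) (by fun_prop)
  have hpt : ∀ p : En n × En n, ENNReal.ofReal (Θ (mildMap τ δ f₀ g t p) p.2) ≤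
      ENNReal.ofReal (exp (-t / τ)) * ENNReal.ofReal (Θ (f₀ (p.1 - t • p.2, p.2)) p.2) +
      ∫⁻ s in Set.Ioc 0 t, ENNReal.ofReal (1 / τ * exp (-(t - s) / τ)) *
        ENNReal.ofReal (Θ (g s (p.1 - (t - s) • p.2, p.2)) p.2) := by
    intro p
    have hJ := hΘ.jensen p.2 hτ ht (hf₀ (p.1 - t • p.2, p.2))
      (b := (Set.Iic (t - δ)).indicator fun s => g s (p.1 - (t - s) • p.2, p.2))
      ((hgm' p).indicator measurableSet_Iic) (fun s => Set.indicator_nonneg (fun s _ => hg _ _) s)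
    have e : ∫ s in Set.Ioc 0 t, exp (-(t - s) / τ) *
        (Set.Iic (t - δ)).indicator (fun s => g s (p.1 - (t - s) • p.2, p.2)) s =
        ∫ s in Set.Ioc 0 (t - δ), exp (-(t - s) / τ) * g s (p.1 - (t - s) • p.2, p.2) := by
      have e' : ∀ s, exp (-(t - s) / τ) *
          (Set.Iic (t - δ)).indicator (fun s => g s (p.1 - (t - s) • p.2, p.2)) s =
          (Set.Iic (t - δ)).indicator
            (fun s => exp (-(t - s) / τ) * g s (p.1 - (t - s) • p.2, p.2)) s := fun s => by
        simp [Set.indicator]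
      simp_rw [e']
      rw [setIntegral_indicator measurableSet_Iic]
      congr 2
      ext s
      simp only [Set.mem_inter_iff, Set.mem_Ioc, Set.mem_Iic]
      constructor
      · rintro ⟨⟨h1, _⟩, h2⟩; exact ⟨h1, h2⟩
      · rintro ⟨h1, h2⟩; exact ⟨⟨h1, by linarith⟩, h2⟩
    rw [e] at hJ
    refine hJ.trans ?_
    gcongr with s
    by_cases hs : s ∈ Set.Iic (t - δ)
    · rw [Set.indicator_of_mem hs]
    · rw [Set.indicator_of_notMem hs, hΘ.zero]
      exact hΘ.nonneg _ _ (hg _ _)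
  have hm1 : Measurable fun p : En n × En n => ENNReal.ofReal (Θ (f₀ p) p.2) :=
    hcomp hf₀m measurable_snd
  have hm1' : Measurable fun p : En n × En n =>
      ENNReal.ofReal (Θ (f₀ (p.1 - t • p.2, p.2)) p.2) :=
    hm1.comp (f := fun p : En n × En n => (p.1 - t • p.2, p.2)) (by fun_prop)
  have hm2 : Measurable fun q : (En n × En n) × ℝ =>
      ENNReal.ofReal (1 / τ * exp (-(t - q.2) / τ)) *
        ENNReal.ofReal (Θ (g q.2 (q.1.1 - (t - q.2) • q.1.2, q.1.2)) q.1.2) := by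
    refine Measurable.mul (by fun_prop) (hcomp ?_ (by fun_prop))
    exact hgm.comp (f := fun q : (En n × En n) × ℝ =>
      (q.2, (q.1.1 - (t - q.2) • q.1.2, q.1.2))) (by fun_prop)
  refine (lintegral_mono hpt).trans (le_of_eq ?_)
  rw [lintegral_add_left (hm1'.const_mul _), lintegral_const_mul _ hm1',
    lintegral_shear t hm1, lintegral_lintegral_swap hm2.aemeasurable]
  congr 1
  refine lintegral_congr fun s => ?_
  have hms : Measurable fun p : En n × En n => ENNReal.ofReal (Θ (g s p) p.2) :=
    hcomp (hgm.comp (f := fun p => (s, p)) (by fun_prop)) measurable_snd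
  have hms' : Measurable fun p : En n × En n =>
      ENNReal.ofReal (Θ (g s (p.1 - (t - s) • p.2, p.2)) p.2) :=
    hms.comp (f := fun p : En n × En n => (p.1 - (t - s) • p.2, p.2)) (by fun_prop)
  rw [lintegral_const_mul _ hms', lintegral_shear (t - s) hms]
  rfl

lemma lintegral_exp_weight (hτ : 0 < τ) {t : ℝ} (ht : 0 ≤ t) :
    ENNReal.ofReal (exp (-t / τ)) +
      ∫⁻ s in Set.Ioc 0 t, ENNReal.ofReal (1 / τ * exp (-(t - s) / τ)) = 1 := by
  have hwi : IntegrableOn (fun s => 1 / τ * exp (-(t - s) / τ)) (Set.Ioc 0 t) :=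
    (Continuous.integrableOn_Icc (by fun_prop)).mono_set Set.Ioc_subset_Icc_self
  have he : exp (-t / τ) ≤ 1 := by
    rw [exp_le_one_iff]
    exact div_nonpos_of_nonpos_of_nonneg (by linarith) hτ.le
  rw [← ofReal_integral_eq_lintegral_ofReal hwi (Filter.Eventually.of_forall fun s => by positivity),
    integral_exp_weight ht, ← ENNReal.ofReal_add (exp_pos _).le (by linarith)]
  simp

/-- If the source is controlled by the initial datum, so is the solution. -/
lemma IsConvexDensity.functional_mildMap_le_of_le {Θ : ℝ → En n → ℝ} (hΘ : IsConvexDensity Θ)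
    (hτ : 0 < τ) (hδ : 0 ≤ δ) {f₀ : En n × En n → ℝ} {g : ℝ → En n × En n → ℝ}
    (hf₀m : Measurable f₀) (hf₀ : ∀ p, 0 ≤ f₀ p)
    (hgm : Measurable (Function.uncurry g)) (hg : ∀ s p, 0 ≤ g s p) {t : ℝ} (ht : 0 ≤ t)
    (h : ∀ᵐ s, s ∈ Set.Ioc 0 t → functional Θ (g s) ≤ functional Θ f₀) :
    functional Θ (mildMap τ δ f₀ g t) ≤ functional Θ f₀ := by
  refine (hΘ.functional_mildMap_le hτ hδ hf₀m hf₀ hgm hg ht).trans ?_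
  calc _ ≤ ENNReal.ofReal (exp (-t / τ)) * functional Θ f₀ +
      ∫⁻ s in Set.Ioc 0 t, ENNReal.ofReal (1 / τ * exp (-(t - s) / τ)) * functional Θ f₀ := by
        gcongr 1
        refine setLIntegral_mono_ae (by fun_prop) ?_
        filter_upwards [h] with s hs hs'
        gcongr
        exact hs hs'
    _ = functional Θ f₀ := by
        rw [lintegral_mul_const _ (by fun_prop), ← add_mul, lintegral_exp_weight hτ ht, one_mul]

/-! ### Approximate solutions with delay -/

/-- The field of local Maxwellians of `f`. -/
def maxwField (γ κ : ℝ) (f : ℝ → En n × En n → ℝ) (t : ℝ) (p : En n × En n) : ℝ :=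
  MaxwOf n γ κ (fun w => f t (p.1, w)) p.2

lemma maxwField_nonneg (hn : 1 ≤ n) (hγ1 : 1 < γ) (hγ2 : γ < ((n : ℝ) + 2) / n) (hκ : 0 < κ)
    (f : ℝ → En n × En n → ℝ) (t : ℝ) (p : En n × En n) : 0 ≤ maxwField γ κ f t p :=
  Maxw_nonneg hn hγ1 hγ2 hκ _ _ _

/-- Density and momentum of `f`. -/
def momField (f : ℝ → En n × En n → ℝ) (q : ℝ × En n) : ℝ × En n :=
  (∫ w, f q.1 (q.2, w), ∫ w, f q.1 (q.2, w) • w)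

lemma maxwField_eq (f : ℝ → En n × En n → ℝ) (t : ℝ) (p : En n × En n) :
    maxwField γ κ f t p = maxwMom n γ κ (momField f (t, p.1)) p.2 :=
  MaxwOf_eq_maxwMom _ _

lemma measurable_momField {f : ℝ → En n × En n → ℝ} (hf : Measurable (Function.uncurry f)) :
    Measurable (momField f) := by
  have h1 : Measurable fun q : (ℝ × En n) × En n => f q.1.1 (q.1.2, q.2) :=
    hf.comp (f := fun q : (ℝ × En n) × En n => (q.1.1, (q.1.2, q.2))) (by fun_prop)
  have h2 : Measurable fun q : (ℝ × En n) × En n => f q.1.1 (q.1.2, q.2) • q.2 := by fun_prop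
  exact (h1.stronglyMeasurable.integral_prod_right' (ν := volume)).measurable.prodMk
    (h2.stronglyMeasurable.integral_prod_right' (ν := volume)).measurable

lemma measurable_maxwField {f : ℝ → En n × En n → ℝ} (hf : Measurable (Function.uncurry f)) :
    Measurable (Function.uncurry (maxwField γ κ f)) := by
  have h := measurable_momField hf
  have : Function.uncurry (maxwField γ κ f) =
      fun q => maxwMom n γ κ (momField f (q.1, q.2.1)) q.2.2 := by
    funext q; exact maxwField_eq _ _ _
  rw [this]
  exact measurable_maxwMom.comp (f := fun q : ℝ × En n × En n => (momField f (q.1, q.2.1), q.2.2))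
    (by fun_prop)

/-- Convex functionals which do not increase under relaxation to the local Maxwellian. -/
def DecreasesUnderMaxw (γ κ : ℝ) (Θ : ℝ → En n → ℝ) : Prop :=
  ∀ f : En n → ℝ, Measurable f → (∀ v, 0 ≤ f v) →
    ∫⁻ v, ENNReal.ofReal (Θ (MaxwOf n γ κ f v) v) ≤ ∫⁻ v, ENNReal.ofReal (Θ (f v) v)

lemma functional_maxwField_le {Θ : ℝ → En n → ℝ} (hΘ : IsConvexDensity Θ)
    (hΘM : DecreasesUnderMaxw γ κ Θ) {f : ℝ → En n × En n → ℝ}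
    (hf : Measurable (Function.uncurry f)) (hf0 : ∀ t p, 0 ≤ f t p) (t : ℝ) :
    functional Θ (maxwField γ κ f t) ≤ functional Θ (f t) := by
  have hm : ∀ g : ℝ → En n × En n → ℝ, Measurable (Function.uncurry g) →
      Measurable fun p : En n × En n => ENNReal.ofReal (Θ (g t p) p.2) := fun g hg =>
    (hΘ.measurable.comp (f := fun p : En n × En n => (g t p, p.2))
      ((hg.comp (f := fun p => (t, p)) (by fun_prop)).prodMk measurable_snd)).ennreal_ofReal
  unfold functional
  rw [Measure.volume_eq_prod, lintegral_prod _ (hm _ (measurable_maxwField hf)).aemeasurable,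
    lintegral_prod _ (hm _ hf).aemeasurable]
  refine lintegral_mono fun x => ?_
  have hfx : Measurable fun w => f t (x, w) :=
    hf.comp (f := fun w => (t, (x, w))) (by fun_prop)
  have := hΘM (fun w => f t (x, w)) hfx fun w => hf0 _ _
  simp only [maxwField]
  exact this

/-- Picard iterates of the delayed problem. -/
def delayIter (γ κ τ δ : ℝ) (f₀ : En n × En n → ℝ) : ℕ → ℝ → En n × En n → ℝ
  | 0 => fun _ _ => 0
  | j + 1 => mildMap τ δ f₀ (maxwField γ κ (delayIter γ κ τ δ f₀ j))

lemma mildMap_congr {f₀ : En n × En n → ℝ} {g g' : ℝ → En n × En n → ℝ} {t : ℝ}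
    (h : ∀ s, 0 < s → s ≤ t - δ → g s = g' s) : mildMap τ δ f₀ g t = mildMap τ δ f₀ g' t := by
  funext p
  unfold mildMap
  congr 2
  refine setIntegral_congr_fun measurableSet_Ioc fun s hs => ?_
  rw [h s hs.1 hs.2]

lemma maxwField_congr {f f' : ℝ → En n × En n → ℝ} {s : ℝ} (h : f s = f' s) :
    maxwField γ κ f s = maxwField γ κ f' s := by
  funext p
  rw [maxwField, maxwField, h]

lemma delayIter_eq {f₀ : En n × En n → ℝ} (hδ : 0 < δ) (j : ℕ) : ∀ m, j + 1 ≤ m →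
    ∀ t, t ≤ j * δ → delayIter γ κ τ δ f₀ m t = delayIter γ κ τ δ f₀ (j + 1) t := by
  induction j with
  | zero =>
    intro m hm t ht
    obtain ⟨m', rfl⟩ : ∃ m', m = m' + 1 := ⟨m - 1, by omega⟩
    refine mildMap_congr fun s hs hs' => ?_
    push_cast at ht
    linarith
  | succ j ih =>
    intro m hm t ht
    obtain ⟨m', rfl⟩ : ∃ m', m = m' + 1 := ⟨m - 1, by omega⟩
    refine mildMap_congr fun s hs hs' => maxwField_congr ?_
    push_cast at ht
    exact ih m' (by omega) s (by linarith)

lemma measurable_delayIter {f₀ : En n × En n → ℝ} (hf₀ : Measurable f₀) (j : ℕ) :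
    Measurable (Function.uncurry (delayIter γ κ τ δ f₀ j)) := by
  induction j with
  | zero => exact measurable_const
  | succ j ih => exact measurable_mildMap hf₀ (measurable_maxwField ih)

lemma delayIter_nonneg (hn : 1 ≤ n) (hγ1 : 1 < γ) (hγ2 : γ < ((n : ℝ) + 2) / n) (hκ : 0 < κ)
    (hτ : 0 < τ) {f₀ : En n × En n → ℝ} (hf₀ : ∀ p, 0 ≤ f₀ p) (j : ℕ) (t : ℝ)
    (p : En n × En n) : 0 ≤ delayIter γ κ τ δ f₀ j t p := by
  cases j with
  | zero => exact le_rfl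
  | succ j => exact mildMap_nonneg hτ hf₀ (maxwField_nonneg hn hγ1 hγ2 hκ _) t p

lemma functional_delayIter_le (hn : 1 ≤ n) (hγ1 : 1 < γ) (hγ2 : γ < ((n : ℝ) + 2) / n)
    (hκ : 0 < κ) (hτ : 0 < τ) (hδ : 0 ≤ δ) {f₀ : En n × En n → ℝ} (hf₀m : Measurable f₀)
    (hf₀ : ∀ p, 0 ≤ f₀ p) {Θ : ℝ → En n → ℝ} (hΘ : IsConvexDensity Θ)
    (hΘM : DecreasesUnderMaxw γ κ Θ) (j : ℕ) {t : ℝ} (ht : 0 ≤ t) :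
    functional Θ (delayIter γ κ τ δ f₀ j t) ≤ functional Θ f₀ := by
  induction j generalizing t with
  | zero => simp [functional, delayIter, hΘ.zero]
  | succ j ih =>
    refine hΘ.functional_mildMap_le_of_le hτ hδ hf₀m hf₀
      (measurable_maxwField (measurable_delayIter hf₀m j)) (maxwField_nonneg hn hγ1 hγ2 hκ _) ht
      (Filter.Eventually.of_forall fun s hs => ?_)
    exact (functional_maxwField_le hΘ hΘM (measurable_delayIter hf₀m j)
      (delayIter_nonneg hn hγ1 hγ2 hκ hτ hf₀ j) s).trans (ih hs.1.le)

lemma exists_delayed_solution (hn : 1 ≤ n) (hγ1 : 1 < γ) (hγ2 : γ < ((n : ℝ) + 2) / n)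
    (hκ : 0 < κ) (hτ : 0 < τ) (hδ : 0 < δ) {f₀ : En n × En n → ℝ} (hf₀m : Measurable f₀)
    (hf₀ : ∀ p, 0 ≤ f₀ p) :
    ∃ f : ℝ → En n × En n → ℝ, Measurable (Function.uncurry f) ∧ (∀ t p, 0 ≤ f t p) ∧
      (∀ t, f t = mildMap τ δ f₀ (maxwField γ κ f) t) ∧
      ∀ Θ : ℝ → En n → ℝ, IsConvexDensity Θ → DecreasesUnderMaxw γ κ Θ →
        ∀ t, 0 ≤ t → functional Θ (f t) ≤ functional Θ f₀ := by
  refine ⟨fun t => delayIter γ κ τ δ f₀ (⌈t / δ⌉₊ + 1) t, ?_,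
    fun t p => delayIter_nonneg hn hγ1 hγ2 hκ hτ hf₀ _ t p, fun t => ?_,
    fun Θ hΘ hΘM t ht => functional_delayIter_le hn hγ1 hγ2 hκ hτ hδ.le hf₀m hf₀ hΘ hΘM _ ht⟩
  · have h : Measurable fun q : ℕ × (ℝ × En n × En n) =>
        Function.uncurry (delayIter γ κ τ δ f₀ q.1) q.2 :=
      measurable_from_prod_countable_right fun j => measurable_delayIter hf₀m j
    exact h.comp (f := fun q : ℝ × En n × En n => (⌈q.1 / δ⌉₊ + 1, q)) (by fun_prop)
  · refine mildMap_congr fun s hs hs' => maxwField_congr ?_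
    refine delayIter_eq hδ ⌈s / δ⌉₊ _ ?_ s ?_
    · have : s / δ + 1 ≤ t / δ := by
        rw [← sub_nonneg]
        have : t / δ - (s / δ + 1) = (t - δ - s) / δ := by field_simp; ring
        rw [this]
        exact div_nonneg (by linarith) hδ.le
      rw [← Nat.ceil_add_one (by positivity)]
      exact Nat.ceil_mono this
    · exact (div_le_iff₀ hδ).1 (Nat.le_ceil _)

end

section

variable {n : ℕ} {γ κ : ℝ}

/-! ### Moments along rays -/

lemma enorm_integral_sub_integral_le {α F : Type*} [MeasurableSpace α] {μ : Measure α}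
    [NormedAddCommGroup F] [NormedSpace ℝ F] {f g : α → F}
    (h : AEStronglyMeasurable (fun a => f a - g a) μ) :
    ‖∫ a, f a ∂μ - ∫ a, g a ∂μ‖ₑ ≤ ∫⁻ a, ‖f a - g a‖ₑ ∂μ := by
  by_cases hfin : ∫⁻ a, ‖f a - g a‖ₑ ∂μ = ⊤
  · rw [hfin]; exact le_top
  have hi : Integrable (fun a => f a - g a) μ := ⟨h, lt_top_iff_ne_top.2 hfin⟩
  by_cases hf : Integrable f μ
  · have hg : Integrable g μ := by
      have := hf.sub hi
      refine this.congr (Filter.Eventually.of_forall fun a => ?_)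
      simp
    rw [← integral_sub hf hg]
    exact enorm_integral_le_lintegral_enorm _
  · have hg : ¬ Integrable g μ := fun hg => hf <| by
      refine (hg.add hi).congr (Filter.Eventually.of_forall fun a => ?_)
      simp
    rw [integral_undef hf, integral_undef hg]
    simp

lemma lintegral_ball_ray_le {r N R σ : ℝ} (hσ : 0 ≤ σ) (hσN : σ ≤ N) (hR : 1 ≤ R)
    {G : En n × En n → ENNReal} (hG : Measurable G) :
    ∫⁻ x in Metric.closedBall (0 : En n) r, ∫⁻ v, ENNReal.ofReal (1 + ‖v‖) * G (x - σ • v, v) ≤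
      ENNReal.ofReal (1 + R) *
        (∫⁻ y in Metric.closedBall (0 : En n) (r + N * R), ∫⁻ v, G (y, v)) +
      ENNReal.ofReal (2 / R) * ∫⁻ p : En n × En n, ENNReal.ofReal (1 + ‖p.2‖ ^ 2) * G p := by
  set H : En n × En n → ENNReal := fun p =>
    ENNReal.ofReal (1 + R) * (Metric.closedBall (0 : En n) (r + N * R)).indicator
      (fun y => G (y, p.2)) p.1 + ENNReal.ofReal (2 / R) * (ENNReal.ofReal (1 + ‖p.2‖ ^ 2) * G p)
    with hH
  have hind : Measurable fun p : En n × En n =>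
      (Metric.closedBall (0 : En n) (r + N * R)).indicator (fun y => G (y, p.2)) p.1 := by
    have : Measurable ((Prod.fst ⁻¹' Metric.closedBall (0 : En n) (r + N * R)).indicator G) :=
      hG.indicator (measurable_fst measurableSet_closedBall)
    exact this
  have hHm : Measurable H := by fun_prop
  have h1 : ∫⁻ p, H p = ENNReal.ofReal (1 + R) *
        (∫⁻ y in Metric.closedBall (0 : En n) (r + N * R), ∫⁻ v, G (y, v)) +
      ENNReal.ofReal (2 / R) * ∫⁻ p : En n × En n, ENNReal.ofReal (1 + ‖p.2‖ ^ 2) * G p := by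
    rw [hH, lintegral_add_left (by fun_prop), lintegral_const_mul _ hind,
      lintegral_const_mul _ (by fun_prop)]
    congr 2
    rw [Measure.volume_eq_prod, lintegral_prod _ hind.aemeasurable,
      ← lintegral_indicator measurableSet_closedBall]
    refine lintegral_congr fun y => ?_
    by_cases hy : y ∈ Metric.closedBall (0 : En n) (r + N * R)
    · simp only [Set.indicator_of_mem hy]
    · simp only [Set.indicator_of_notMem hy, lintegral_zero]
  rw [← h1, ← lintegral_shear σ hHm, Measure.volume_eq_prod,
    lintegral_prod _ (by fun_prop), ← lintegral_indicator measurableSet_closedBall]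
  refine lintegral_mono fun x => ?_
  by_cases hx : x ∈ Metric.closedBall (0 : En n) r
  swap
  · simp [Set.indicator_of_notMem hx]
  rw [Set.indicator_of_mem hx]
  refine lintegral_mono fun v => ?_
  rw [mem_closedBall_zero_iff] at hx
  rcases le_or_gt ‖v‖ R with hv | hv
  · refine le_trans ?_ le_self_add
    have : x - σ • v ∈ Metric.closedBall (0 : En n) (r + N * R) := by
      rw [mem_closedBall_zero_iff]
      refine (norm_sub_le _ _).trans ?_
      rw [norm_smul, Real.norm_of_nonneg hσ]
      gcongr
      linarith
    simp only [Set.indicator_of_mem this]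
    gcongr
  · refine le_trans ?_ le_add_self
    rw [← mul_assoc, ← ENNReal.ofReal_mul (by positivity)]
    gcongr
    rw [div_mul_eq_mul_div, le_div_iff₀ (by linarith)]
    nlinarith [norm_nonneg v]

/-- Density and momentum seen at `x` after free transport over a time `σ`. -/
def rayMom (σ : ℝ) (g : En n × En n → ℝ) (x : En n) : ℝ × En n :=
  ∫ v, g (x - σ • v, v) • ((1 : ℝ), v)

lemma enorm_one_prod_le (v : En n) : ‖((1 : ℝ), v)‖ₑ ≤ ENNReal.ofReal (1 + ‖v‖) := by
  rw [← ofReal_norm, Prod.norm_def]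
  refine ENNReal.ofReal_le_ofReal (max_le ?_ ?_)
  · simp
  · simp

lemma rayMom_sub {σ : ℝ} (hσ : 0 < σ) (g : En n × En n → ℝ) (x z : En n) :
    rayMom σ g (x - z) =
      ∫ v, g (x - σ • v, v - σ⁻¹ • z) • ((1 : ℝ), v - σ⁻¹ • z) := by
  rw [rayMom, ← integral_sub_right_eq_self _ (σ⁻¹ • z)]
  congr 1
  funext v
  rw [smul_sub, smul_inv_smul₀ hσ.ne']
  congr 3
  abel

lemma lintegral_weight_translate_le {g : En n × En n → ENNReal} (hg : Measurable g) {w : En n}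
    (hw : ‖w‖ ≤ 1) :
    ∫⁻ p : En n × En n, ENNReal.ofReal (1 + ‖p.2‖ ^ 2) * g (p.1, p.2 - w) ≤
      3 * ∫⁻ p : En n × En n, ENNReal.ofReal (1 + ‖p.2‖ ^ 2) * g p := by
  have h3 : Measurable fun p : En n × En n => ENNReal.ofReal (1 + ‖p.2‖ ^ 2) * g p := by fun_prop
  rw [← lintegral_const_mul _ h3, Measure.volume_eq_prod, lintegral_prod _ (by fun_prop),
    lintegral_prod _ (by fun_prop)]
  refine lintegral_mono fun x => ?_
  have := lintegral_sub_right_eq_self (μ := (volume : Measure (En n)))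
    (fun v => ENNReal.ofReal (1 + ‖v + w‖ ^ 2) * g (x, v)) w
  simp only [sub_add_cancel] at this
  simp only [this]
  refine lintegral_mono fun v => ?_
  rw [← mul_assoc, show (3 : ENNReal) = ENNReal.ofReal 3 by simp, ← ENNReal.ofReal_mul (by norm_num)]
  gcongr
  have h1 := norm_add_le v w
  nlinarith [norm_nonneg v, norm_nonneg w, norm_nonneg (v + w), sq_nonneg (‖v‖ - ‖w‖)]

lemma exists_rayMom_translate_le (hn : 1 ≤ n) (hγ1 : 1 < γ) (hγ2 : γ < ((n : ℝ) + 2) / n)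
    (hκ : 0 < κ) {δ N ε C : ℝ} (hδ : 0 < δ) (hε : 0 < ε) (hC : 0 ≤ C) :
    ∃ η > 0, ∀ m : En n → ℝ × En n, Measurable m → (∀ y, 0 ≤ (m y).1) →
      (∫⁻ p : En n × En n, ENNReal.ofReal (1 + ‖p.2‖ ^ 2) *
        ENNReal.ofReal (maxwMom n γ κ (m p.1) p.2) ≤ ENNReal.ofReal C) →
      ∀ σ, δ ≤ σ → σ ≤ N → ∀ z : En n, ‖z‖ ≤ η →
      ∫⁻ x in Metric.closedBall (0 : En n) N,
        ‖rayMom σ (fun p => maxwMom n γ κ (m p.1) p.2) (x - z) -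
          rayMom σ (fun p => maxwMom n γ κ (m p.1) p.2) x‖ₑ ≤ ENNReal.ofReal ε := by
  set R := 1 + 28 * C / ε with hR
  have hR1 : 1 ≤ R := by rw [hR]; have : 0 ≤ 28 * C / ε := by positivity
                         linarith
  set V := (volume (Metric.closedBall (0 : En n) (N + N * R))).toReal with hV
  have hV0 : 0 ≤ V := ENNReal.toReal_nonneg
  set a := ε / (8 * (1 + R) * (V + 1)) with ha
  set e := min 1 (ε / (8 * (1 + R) * (C + 1))) with he
  have he1 : e ≤ 1 := min_le_left _ _
  have ha0 : 0 < a := by positivity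
  have he0 : 0 < e := by positivity
  obtain ⟨η, hη, h⟩ := exists_lintegral_Maxw_translate_le hn hγ1 hγ2 hκ ha0 he0
  refine ⟨δ * min η (min e 1), by positivity, fun m hm hm0 hmC σ hσ hσN z hz => ?_⟩
  have hσ0 : 0 < σ := by linarith
  set w := σ⁻¹ • z with hw
  have hwn : ‖w‖ ≤ min η (min e 1) := by
    rw [hw, norm_smul, norm_inv, Real.norm_of_nonneg hσ0.le, ← div_eq_inv_mul, div_le_iff₀ hσ0]
    refine hz.trans ?_
    rw [mul_comm]
    gcongr
  have hwη : ‖w‖ ≤ η := hwn.trans (min_le_left _ _)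
  have hwe : ‖w‖ ≤ e := hwn.trans ((min_le_right _ _).trans (min_le_left _ _))
  have hw1 : ‖w‖ ≤ 1 := hwn.trans ((min_le_right _ _).trans (min_le_right _ _))
  set g : En n × En n → ℝ := fun p => maxwMom n γ κ (m p.1) p.2 with hg
  have hgm : Measurable g := measurable_maxwMom.comp
    (f := fun p : En n × En n => (m p.1, p.2)) (by fun_prop)
  have hg0 : ∀ p, 0 ≤ g p := fun p => maxwMom_nonneg hn hγ1 hγ2 hκ _ _
  set G : En n × En n → ENNReal := fun p =>
    ‖g (p.1, p.2 - w) - g p‖ₑ + ENNReal.ofReal e * ENNReal.ofReal (g (p.1, p.2 - w)) with hG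
  have hGm : Measurable G := by fun_prop
  have hmass : ∫⁻ p, ENNReal.ofReal (g p) ≤ ENNReal.ofReal C := by
    refine le_trans (lintegral_mono fun p => ?_) hmC
    refine le_mul_of_one_le_left (zero_le) ?_
    rw [← ENNReal.ofReal_one]
    exact ENNReal.ofReal_le_ofReal (by nlinarith [norm_nonneg p.2])
  have hmass' : ∫⁻ y, ∫⁻ v, ENNReal.ofReal (g (y, v)) ≤ ENNReal.ofReal C := by
    refine le_trans (le_of_eq ?_) hmass
    rw [Measure.volume_eq_prod, lintegral_prod _ (by fun_prop)]
  calc ∫⁻ x in Metric.closedBall (0 : En n) N, ‖rayMom σ g (x - z) - rayMom σ g x‖ₑ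
      ≤ ∫⁻ x in Metric.closedBall (0 : En n) N,
          ∫⁻ v, ENNReal.ofReal (1 + ‖v‖) * G (x - σ • v, v) := by
        refine lintegral_mono fun x => ?_
        simp only
        rw [rayMom_sub hσ0, rayMom, ← hw]
        refine (enorm_integral_sub_integral_le ?_).trans (lintegral_mono fun v => ?_)
        · exact (by fun_prop : Measurable _).aestronglyMeasurable
        · have e1 : g (x - σ • v, v - w) • ((1 : ℝ), v - w) - g (x - σ • v, v) • ((1 : ℝ), v) =
              (g (x - σ • v, v - w) - g (x - σ • v, v)) • ((1 : ℝ), v) -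
                g (x - σ • v, v - w) • ((0 : ℝ), w) := by
            have : ((1 : ℝ), v - w) = ((1 : ℝ), v) - ((0 : ℝ), w) := by simp
            rw [this, smul_sub, sub_smul]
            abel
          rw [e1]
          refine enorm_sub_le.trans ?_
          rw [hG, mul_add, enorm_smul, enorm_smul, mul_comm]
          refine add_le_add (by gcongr; exact enorm_one_prod_le v) ?_
          rw [Real.enorm_of_nonneg (hg0 _), mul_comm]
          refine le_trans ?_ (le_mul_of_one_le_left (zero_le) ?_)
          · gcongr
            rw [← ofReal_norm, Prod.norm_def]
            exact ENNReal.ofReal_le_ofReal (max_le (by simpa using he0.le) hwe)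
          · rw [← ENNReal.ofReal_one]
            exact ENNReal.ofReal_le_ofReal (by linarith [norm_nonneg v])
    _ ≤ _ := lintegral_ball_ray_le hσ0.le hσN hR1 hGm
    _ ≤ ENNReal.ofReal (1 + R) * (ENNReal.ofReal (a * V + e * C) + ENNReal.ofReal (e * C)) +
          ENNReal.ofReal (2 / R) * ENNReal.ofReal (7 * C) := by
        gcongr
        · rw [hG]
          simp only
          have hm1 : Measurable fun y => ∫⁻ v, ‖g (y, v - w) - g (y, v)‖ₑ :=
            Measurable.lintegral_prod_right' (f := fun p : En n × En n =>
              ‖g (p.1, p.2 - w) - g (p.1, p.2)‖ₑ) (by fun_prop)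
          have hs : ∀ y, ∫⁻ v, (‖g (y, v - w) - g (y, v)‖ₑ +
              ENNReal.ofReal e * ENNReal.ofReal (g (y, v - w))) =
              (∫⁻ v, ‖g (y, v - w) - g (y, v)‖ₑ) +
              ENNReal.ofReal e * ∫⁻ v, ENNReal.ofReal (g (y, v)) := by
            intro y
            rw [lintegral_add_left (by fun_prop), lintegral_const_mul _ (by fun_prop),
              lintegral_sub_right_eq_self (fun v => ENNReal.ofReal (g (y, v))) w]
          simp_rw [hs]
          rw [lintegral_add_left hm1]
          have hρ : ∀ y, ENNReal.ofReal (m y).1 = ∫⁻ v, ENNReal.ofReal (g (y, v)) := fun y =>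
            (lintegral_maxwMom hn hγ1 hγ2 hκ (hm0 y)).symm
          have hρC : ∫⁻ y in Metric.closedBall (0 : En n) (N + N * R),
              ENNReal.ofReal (m y).1 ≤ ENNReal.ofReal C := by
            simp_rw [hρ]
            exact (setLIntegral_le_lintegral _ _).trans hmass'
          refine add_le_add ?_ ?_
          · calc ∫⁻ y in Metric.closedBall (0 : En n) (N + N * R),
                  ∫⁻ v, ‖g (y, v - w) - g (y, v)‖ₑ
                ≤ ∫⁻ y in Metric.closedBall (0 : En n) (N + N * R),
                    (ENNReal.ofReal a + ENNReal.ofReal e * ENNReal.ofReal (m y).1) := by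
                  refine lintegral_mono fun y => ?_
                  have h0 := hm0 y
                  refine (h (m y).1 ((m y).1⁻¹ • (m y).2) w h0 hwη).trans (le_of_eq ?_)
                  rw [ENNReal.ofReal_add ha0.le (by positivity), ENNReal.ofReal_mul he0.le]
              _ ≤ ENNReal.ofReal (a * V) + ENNReal.ofReal (e * C) := by
                  rw [lintegral_add_left (by fun_prop), lintegral_const_mul _ (by fun_prop),
                    lintegral_const, Measure.restrict_apply_univ, ENNReal.ofReal_mul he0.le,
                    ENNReal.ofReal_mul ha0.le, hV,
                    ENNReal.ofReal_toReal measure_closedBall_lt_top.ne]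
                  gcongr
              _ = _ := by rw [ENNReal.ofReal_add (by positivity) (by positivity)]
          · rw [lintegral_const_mul _ (Measurable.lintegral_prod_right'
              (f := fun p : En n × En n => ENNReal.ofReal (g p)) (by fun_prop)),
              ENNReal.ofReal_mul he0.le]
            gcongr
            exact (setLIntegral_le_lintegral _ _).trans hmass'
        · have hb : ∀ p : En n × En n, ENNReal.ofReal (1 + ‖p.2‖ ^ 2) * G p ≤
              2 * (ENNReal.ofReal (1 + ‖p.2‖ ^ 2) * ENNReal.ofReal (g (p.1, p.2 - w))) +
              ENNReal.ofReal (1 + ‖p.2‖ ^ 2) * ENNReal.ofReal (g p) := by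
            intro p
            have : G p ≤ 2 * ENNReal.ofReal (g (p.1, p.2 - w)) + ENNReal.ofReal (g p) := by
              rw [hG]
              simp only
              have hh1 : ‖g (p.1, p.2 - w) - g p‖ₑ ≤
                  ENNReal.ofReal (g (p.1, p.2 - w)) + ENNReal.ofReal (g p) := by
                refine enorm_sub_le.trans ?_
                rw [Real.enorm_of_nonneg (hg0 _), Real.enorm_of_nonneg (hg0 _)]
              have hh2 : ENNReal.ofReal e * ENNReal.ofReal (g (p.1, p.2 - w)) ≤
                  ENNReal.ofReal (g (p.1, p.2 - w)) :=
                mul_le_of_le_one_left (zero_le) (by simpa using he1)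
              refine (add_le_add hh1 hh2).trans (le_of_eq ?_)
              ring
            refine (mul_le_mul_right this _).trans (le_of_eq ?_)
            ring
          refine (lintegral_mono hb).trans ?_
          rw [lintegral_add_left (by fun_prop), lintegral_const_mul _ (by fun_prop)]
          have := lintegral_weight_translate_le (g := fun p => ENNReal.ofReal (g p))
            (by fun_prop) hw1
          calc _ ≤ 2 * (3 * ENNReal.ofReal C) + ENNReal.ofReal C := by
                gcongr
                exact this.trans (by gcongr)
            _ = ENNReal.ofReal (7 * C) := by
                rw [ENNReal.ofReal_mul (by norm_num), ENNReal.ofReal_ofNat]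
                ring
    _ ≤ ENNReal.ofReal ε := by
        rw [← ENNReal.ofReal_add (by positivity) (by positivity),
          ← ENNReal.ofReal_mul (by positivity), ← ENNReal.ofReal_mul (by positivity),
          ← ENNReal.ofReal_add (by positivity) (by positivity)]
        refine ENNReal.ofReal_le_ofReal ?_
        have h1 : (1 + R) * (a * V) ≤ ε / 8 := by
          rw [ha]
          have : (1 + R) * (ε / (8 * (1 + R) * (V + 1)) * V) = ε / 8 * (V / (V + 1)) := by
            field_simp
          rw [this]
          exact mul_le_of_le_one_right (by positivity) ((div_le_one (by positivity)).2 (by linarith))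
        have h2 : (1 + R) * (e * C) ≤ ε / 8 := by
          have h4 : e ≤ ε / (8 * (1 + R) * (C + 1)) := min_le_right _ _
          refine (show (1 + R) * (e * C) ≤ (1 + R) * (ε / (8 * (1 + R) * (C + 1)) * C) by
            gcongr).trans ?_
          have : (1 + R) * (ε / (8 * (1 + R) * (C + 1)) * C) = ε / 8 * (C / (C + 1)) := by
            field_simp
          rw [this]
          exact mul_le_of_le_one_right (by positivity) ((div_le_one (by positivity)).2 (by linarith))
        have h3 : 2 / R * (7 * C) ≤ ε / 2 := by
          rw [div_mul_eq_mul_div, div_le_iff₀ (by positivity), hR]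
          have : ε / 2 * (1 + 28 * C / ε) = ε / 2 + 14 * C := by field_simp; ring
          rw [this]
          linarith
        nlinarith

end

section

/-! ### Local `L¹` compactness -/

open Filter Topology

variable {Z F : Type*}

lemma exists_subseq_tendsto_of_lipschitz [PseudoMetricSpace Z]
    [TopologicalSpace.SeparableSpace Z] [Nonempty Z] [NormedAddCommGroup F] [ProperSpace F]
    {a : ℕ → ℕ → Z → F} {L B : ℕ → ℝ}
    (hL : ∀ m k z z', ‖a m k z - a m k z'‖ ≤ L m * dist z z') (hB : ∀ m k z, ‖a m k z‖ ≤ B m) :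
    ∃ φ : ℕ → ℕ, StrictMono φ ∧ ∀ m z, ∃ l, Tendsto (fun k => a m (φ k) z) atTop (𝓝 l) := by
  set u := TopologicalSpace.denseSeq Z with hu
  set X : ℕ → ℕ × ℕ → F := fun k q => a q.1 k (u q.2) with hX
  have hK : IsCompact (Set.univ.pi fun q : ℕ × ℕ => Metric.closedBall (0 : F) (B q.1)) :=
    isCompact_univ_pi fun q => isCompact_closedBall _ _
  obtain ⟨l, -, φ, hφ, hl⟩ := hK.tendsto_subseq (x := X) fun k q _ => by
    simpa [hX] using hB q.1 k (u q.2)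
  rw [tendsto_pi_nhds] at hl
  refine ⟨φ, hφ, fun m z => cauchySeq_tendsto_of_complete (Metric.cauchySeq_iff'.2 fun ε hε => ?_)⟩
  obtain ⟨j, hj⟩ : ∃ j, dist z (u j) < ε / (4 * (|L m| + 1)) := by
    exact (TopologicalSpace.denseRange_denseSeq Z).exists_dist_lt z
      (by positivity)
  have hd : ∀ k, ‖a m k z - a m k (u j)‖ ≤ ε / 4 := fun k => by
    refine (hL m k z _).trans ?_
    calc L m * dist z (u j) ≤ (|L m| + 1) * (ε / (4 * (|L m| + 1))) := by
          have := le_abs_self (L m)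
          gcongr
          linarith
      _ = ε / 4 := by field_simp
  obtain ⟨K, hK⟩ := Metric.cauchySeq_iff'.1 (hl (m, j)).cauchySeq (ε / 2) (by positivity)
  refine ⟨K, fun k hk => ?_⟩
  have h1 := hK k hk
  simp only [hX, Function.comp, dist_eq_norm] at h1 ⊢
  have h2 := hd (φ k)
  have h3 := hd (φ K)
  rw [norm_sub_rev] at h3
  have : a m (φ k) z - a m (φ K) z = (a m (φ k) z - a m (φ k) (u j)) +
      (a m (φ k) (u j) - a m (φ K) (u j)) + (a m (φ K) (u j) - a m (φ K) z) := by abel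
  rw [this]
  refine (norm_add₃_le).trans_lt ?_
  linarith

variable [MeasurableSpace Z] {μ : Measure Z} [NormedAddCommGroup F] [MeasurableSpace F]
  [BorelSpace F] [SecondCountableTopology F]

lemma exists_lintegral_sub_le_of_tendsto {D : Set Z} (hD : μ D ≠ ⊤) {a : ℕ → Z → F} {l : Z → F}
    {B : ℝ} (ha : ∀ k, Measurable (a k)) (hB : ∀ k z, ‖a k z‖ ≤ B)
    (hl : ∀ z, Tendsto (fun k => a k z) atTop (𝓝 (l z))) {ε : ENNReal} (hε : 0 < ε) :
    ∃ K, ∀ k ≥ K, ∫⁻ z in D, ‖a k z - l z‖ₑ ∂μ ≤ ε := by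
  have hlm : Measurable l := measurable_of_tendsto_metrizable ha (tendsto_pi_nhds.2 hl)
  have hlB : ∀ z, ‖l z‖ ≤ B := fun z => le_of_tendsto (hl z).norm (.of_forall fun k => hB k z)
  have h := tendsto_lintegral_of_dominated_convergence (μ := μ.restrict D)
    (F := fun k z => ‖a k z - l z‖ₑ) (f := fun _ => 0) (fun _ => ENNReal.ofReal (B + B))
    (fun k => ((ha k).sub hlm).enorm) (fun k => .of_forall fun z => ?_)
    (by rw [lintegral_const, Measure.restrict_apply_univ]
        exact ENNReal.mul_ne_top ENNReal.ofReal_ne_top hD)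
    (.of_forall fun z => ?_)
  · rw [lintegral_zero] at h
    obtain ⟨K, hK⟩ := eventually_atTop.1 (h.eventually_lt_const hε)
    exact ⟨K, fun k hk => (hK k hk).le⟩
  · simp only
    rw [← ofReal_norm]
    exact ENNReal.ofReal_le_ofReal ((norm_sub_le _ _).trans (add_le_add (hB k z) (hlB z)))
  · have := ((hl z).sub_const (l z)).enorm
    simpa using this

lemma exists_locally_integral_limit [CompleteSpace F] {D : ℕ → Set Z}
    (hDm : ∀ N, MeasurableSet (D N)) (hD : Monotone D) {h : ℕ → Z → F}
    (hm : ∀ k, Measurable (h k))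
    (hc : ∀ N, ∀ ε : ENNReal, 0 < ε → ∃ K, ∀ j ≥ K, ∀ k ≥ K,
      ∫⁻ z in D N, ‖h j z - h k z‖ₑ ∂μ ≤ ε) :
    ∃ (φ : ℕ → ℕ) (g : Z → F), StrictMono φ ∧ Measurable g ∧
      (∀ᵐ z ∂μ.restrict (⋃ N, D N), Tendsto (fun k => h (φ k) z) atTop (𝓝 (g z))) ∧
      ∀ N, Tendsto (fun k => ∫⁻ z in D N, ‖h (φ k) z - g z‖ₑ ∂μ) atTop (𝓝 0) := by
  choose K hK using fun N => hc N (2⁻¹ ^ N) (ENNReal.pow_pos (by simp) N)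
  obtain ⟨φ, hφ, hφK⟩ : ∃ φ : ℕ → ℕ, StrictMono φ ∧ ∀ i, K i ≤ φ i := by
    obtain ⟨φ, hφ, h⟩ := Filter.extraction_forall_of_eventually' (P := fun i k => K i ≤ k)
      fun i => ⟨K i, fun k hk => hk⟩
    exact ⟨φ, hφ, h⟩
  have hstep : ∀ i, ∫⁻ z in D i, ‖h (φ i) z - h (φ (i + 1)) z‖ₑ ∂μ ≤ 2⁻¹ ^ i := fun i =>
    hK i _ (hφK i) _ ((hφK i).trans (hφ (Nat.lt_succ_self i)).le)
  have hS : ∀ᵐ z ∂μ, ∑' i, (D i).indicator (fun z => ‖h (φ i) z - h (φ (i + 1)) z‖ₑ) z < ⊤ := by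
    have hmi : ∀ i, Measurable ((D i).indicator fun z => ‖h (φ i) z - h (φ (i + 1)) z‖ₑ) :=
      fun i => ((hm _).sub (hm _)).enorm.indicator (hDm i)
    refine ae_lt_top (Measurable.tsum hmi) (ne_top_of_le_ne_top ?_
      (le_of_eq (lintegral_tsum fun i => (hmi i).aemeasurable)))
    refine ne_top_of_le_ne_top (b := ∑' i : ℕ, (2⁻¹ : ENNReal) ^ i) ?_
      (ENNReal.tsum_le_tsum fun i => ?_)
    · rw [ENNReal.tsum_geometric]
      simp
    · rw [lintegral_indicator (hDm i)]
      exact hstep i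
  have hex : ∀ᵐ z ∂μ.restrict (⋃ N, D N), ∃ l, Tendsto (fun k => h (φ k) z) atTop (𝓝 l) := by
    rw [ae_restrict_iff' (MeasurableSet.iUnion hDm)]
    filter_upwards [hS] with z hz hzD
    obtain ⟨N, hN⟩ := Set.mem_iUnion.1 hzD
    have hcau : CauchySeq fun k => h (φ (k + N)) z := by
      refine cauchySeq_of_edist_le_of_tsum_ne_top
        (fun i => (D (i + N)).indicator (fun z => ‖h (φ (i + N)) z - h (φ (i + N + 1)) z‖ₑ) z)
        (fun i => ?_) (ne_top_of_le_ne_top hz.ne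
          (ENNReal.tsum_comp_le_tsum_of_injective (add_left_injective N) _))
      rw [Set.indicator_of_mem (hD (Nat.le_add_left N i) hN), edist_eq_enorm_sub,
        Nat.succ_eq_add_one, Nat.add_right_comm]
    obtain ⟨l, hl⟩ := cauchySeq_tendsto_of_complete hcau
    exact ⟨l, (tendsto_add_atTop_iff_nat N).1 hl⟩
  obtain ⟨g, hg, hlim⟩ := measurable_limit_of_tendsto_metrizable_ae
    (fun k => (hm (φ k)).aemeasurable) hex
  refine ⟨φ, g, hφ, hg, hlim, fun N => ENNReal.tendsto_nhds_zero.2 fun ε hε => ?_⟩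
  obtain ⟨K', hK'⟩ := hc N ε hε
  filter_upwards [eventually_ge_atTop K'] with k hk
  have hlim' : ∀ᵐ z ∂μ.restrict (D N), Tendsto (fun k => h (φ k) z) atTop (𝓝 (g z)) :=
    ae_restrict_of_ae_restrict_of_subset (Set.subset_iUnion D N) hlim
  calc ∫⁻ z in D N, ‖h (φ k) z - g z‖ₑ ∂μ
      = ∫⁻ z in D N, liminf (fun j => ‖h (φ k) z - h (φ j) z‖ₑ) atTop ∂μ := by
        refine lintegral_congr_ae ?_
        filter_upwards [hlim'] with z hz
        exact ((tendsto_const_nhds.sub hz).enorm.liminf_eq).symm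
    _ ≤ liminf (fun j => ∫⁻ z in D N, ‖h (φ k) z - h (φ j) z‖ₑ ∂μ) atTop :=
        lintegral_liminf_le fun j => ((hm _).sub (hm _)).enorm
    _ ≤ ε := by
        refine liminf_le_of_frequently_le' (Eventually.frequently ?_)
        filter_upwards [eventually_ge_atTop K'] with j hj
        exact hK' _ (hk.trans (hφ.id_le k)) _ (hj.trans (hφ.id_le j))

/-- A sequence which is locally approximated in `L¹` by equi-Lipschitz bounded sequences is
relatively compact in the local `L¹` topology. -/
lemma exists_subseq_of_lipschitz_approx [PseudoMetricSpace Z] [OpensMeasurableSpace Z]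
    [TopologicalSpace.SeparableSpace Z] [Nonempty Z] [ProperSpace F] {D : ℕ → Set Z}
    (hDm : ∀ N, MeasurableSet (D N)) (hD : Monotone D) (hDμ : ∀ N, μ (D N) ≠ ⊤)
    {h : ℕ → Z → F} (hm : ∀ k, Measurable (h k))
    (happ : ∀ N, ∀ ε : ℝ, 0 < ε → ∃ (a : ℕ → Z → F) (L B : ℝ),
      (∀ k z z', ‖a k z - a k z'‖ ≤ L * dist z z') ∧ (∀ k z, ‖a k z‖ ≤ B) ∧
      ∀ᶠ k in atTop, ∫⁻ z in D N, ‖h k z - a k z‖ₑ ∂μ ≤ ENNReal.ofReal ε) :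
    ∃ (φ : ℕ → ℕ) (g : Z → F), StrictMono φ ∧ Measurable g ∧
      (∀ᵐ z ∂μ.restrict (⋃ N, D N), Tendsto (fun k => h (φ k) z) atTop (𝓝 (g z))) ∧
      ∀ N, Tendsto (fun k => ∫⁻ z in D N, ‖h (φ k) z - g z‖ₑ ∂μ) atTop (𝓝 0) := by
  choose a L B hL hB hclose using fun m : ℕ => happ m (1 / ((m : ℝ) + 1)) (by positivity)
  have ham : ∀ m k, Measurable (a m k) := fun m k => by
    have : LipschitzWith (L m).toNNReal (a m k) := LipschitzWith.of_dist_le_mul fun z z' => by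
      rw [dist_eq_norm]
      exact (hL m k z z').trans (by gcongr; exact Real.le_coe_toNNReal _)
    exact this.continuous.measurable
  obtain ⟨φ, hφ, hl⟩ := exists_subseq_tendsto_of_lipschitz hL hB
  choose l hl using hl
  have hcau : ∀ N, ∀ ε : ENNReal, 0 < ε → ∃ K, ∀ j ≥ K, ∀ k ≥ K,
      ∫⁻ z in D N, ‖h (φ j) z - h (φ k) z‖ₑ ∂μ ≤ ε := by
    intro N ε hε
    have hε4 : 0 < ε / 2 / 2 := ENNReal.half_pos (ENNReal.half_pos hε.ne').ne'
    obtain ⟨m, hNm, hm4⟩ : ∃ m ≥ N, ENNReal.ofReal (1 / ((m : ℝ) + 1)) ≤ ε / 2 / 2 := by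
      have h0 : Tendsto (fun m : ℕ => ENNReal.ofReal (1 / ((m : ℝ) + 1))) atTop (𝓝 0) := by
        have := ENNReal.tendsto_ofReal (tendsto_one_div_add_atTop_nhds_zero_nat (𝕜 := ℝ))
        rwa [ENNReal.ofReal_zero] at this
      obtain ⟨m, hm, h⟩ := ((eventually_ge_atTop N).and (h0.eventually_lt_const hε4)).exists
      exact ⟨m, hm, h.le⟩
    obtain ⟨K₁, hK₁⟩ := exists_lintegral_sub_le_of_tendsto (hDμ m) (fun k => ham m (φ k))
      (fun k => hB m (φ k)) (hl m) hε4
    obtain ⟨K₂, hK₂⟩ := eventually_atTop.1 (hφ.tendsto_atTop.eventually (hclose m))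
    have hlm : Measurable (l m) :=
      measurable_of_tendsto_metrizable (fun k => ham m (φ k)) (tendsto_pi_nhds.2 (hl m))
    have hone : ∀ j ≥ max K₁ K₂, ∫⁻ z in D m, ‖h (φ j) z - l m z‖ₑ ∂μ ≤ ε / 2 / 2 + ε / 2 / 2 := by
      intro j hj
      calc ∫⁻ z in D m, ‖h (φ j) z - l m z‖ₑ ∂μ
          ≤ ∫⁻ z in D m, (‖h (φ j) z - a m (φ j) z‖ₑ + ‖a m (φ j) z - l m z‖ₑ) ∂μ :=
            lintegral_mono fun z => by
              have := enorm_add_le (h (φ j) z - a m (φ j) z) (a m (φ j) z - l m z)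
              rwa [sub_add_sub_cancel] at this
        _ = _ := lintegral_add_left ((hm _).sub (ham _ _)).enorm _
        _ ≤ ε / 2 / 2 + ε / 2 / 2 := add_le_add ((hK₂ j ((le_max_right _ _).trans hj)).trans hm4)
            (hK₁ j ((le_max_left _ _).trans hj))
    refine ⟨max K₁ K₂, fun j hj k hk => ?_⟩
    calc ∫⁻ z in D N, ‖h (φ j) z - h (φ k) z‖ₑ ∂μ
        ≤ ∫⁻ z in D m, ‖h (φ j) z - h (φ k) z‖ₑ ∂μ := lintegral_mono_set (hD hNm)
      _ ≤ ∫⁻ z in D m, (‖h (φ j) z - l m z‖ₑ + ‖h (φ k) z - l m z‖ₑ) ∂μ :=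
          lintegral_mono fun z => by
            have := enorm_sub_le (a := h (φ j) z - l m z) (b := h (φ k) z - l m z)
            rwa [sub_sub_sub_cancel_right] at this
      _ = _ := lintegral_add_left ((hm _).sub hlm).enorm _
      _ ≤ (ε / 2 / 2 + ε / 2 / 2) + (ε / 2 / 2 + ε / 2 / 2) := add_le_add (hone j hj) (hone k hk)
      _ = ε := by rw [ENNReal.add_halves, ENNReal.add_halves]
  obtain ⟨ψ, g, hψ, hg, h1, h2⟩ := exists_locally_integral_limit hDm hD (fun k => hm (φ k)) hcau
  exact ⟨φ ∘ ψ, g, hφ.comp hψ, hg, h1, h2⟩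

end

section

variable {n : ℕ} {γ κ τ δ : ℝ}

/-! ### Velocity averages of the delayed equation -/

lemma integral_shear {F : Type*} [NormedAddCommGroup F] [NormedSpace ℝ F] (σ : ℝ)
    {f : En n × En n → F} (hf : StronglyMeasurable f) :
    ∫ p : En n × En n, f (p.1 - σ • p.2, p.2) = ∫ p, f p := by
  have hφ : Measurable fun p : En n × En n => (p.1 - σ • p.2, p.2) := by fun_prop
  have hmap : Measure.map (fun p : En n × En n => (p.1 - σ • p.2, p.2)) volume = volume := by
    refine Measure.ext fun s hs => ?_
    rw [Measure.map_apply hφ hs, ← lintegral_indicator_one hs,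
      ← lintegral_indicator_one (hφ hs),
      ← lintegral_shear σ (F := s.indicator 1) (measurable_one.indicator hs)]
    rfl
  conv_rhs => rw [← hmap]
  rw [integral_map hφ.aemeasurable hf.aestronglyMeasurable]

lemma lintegral_one_add_norm_le {G : En n × En n → ENNReal} {C : ℝ}
    (hG : ∫⁻ p : En n × En n, ENNReal.ofReal (1 + ‖p.2‖ ^ 2) * G p ≤ ENNReal.ofReal C) :
    ∫⁻ p : En n × En n, ENNReal.ofReal (1 + ‖p.2‖) * G p ≤ ENNReal.ofReal (2 * C) := by
  calc ∫⁻ p : En n × En n, ENNReal.ofReal (1 + ‖p.2‖) * G p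
      ≤ ∫⁻ p : En n × En n, ENNReal.ofReal 2 * (ENNReal.ofReal (1 + ‖p.2‖ ^ 2) * G p) := by
        refine lintegral_mono fun p => ?_
        rw [← mul_assoc, ← ENNReal.ofReal_mul (by norm_num)]
        gcongr
        nlinarith [sq_nonneg (‖p.2‖ - 1), norm_nonneg p.2]
    _ = ENNReal.ofReal 2 * ∫⁻ p : En n × En n, ENNReal.ofReal (1 + ‖p.2‖ ^ 2) * G p :=
        lintegral_const_mul' _ _ ENNReal.ofReal_ne_top
    _ ≤ ENNReal.ofReal 2 * ENNReal.ofReal C := by gcongr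
    _ = _ := (ENNReal.ofReal_mul (by norm_num)).symm

lemma lintegral_lintegral_ray (σ : ℝ) {G : En n × En n → ENNReal} (hG : Measurable G) :
    ∫⁻ x, ∫⁻ v, ENNReal.ofReal (1 + ‖v‖) * G (x - σ • v, v) =
      ∫⁻ p : En n × En n, ENNReal.ofReal (1 + ‖p.2‖) * G p := by
  rw [← lintegral_shear σ (by fun_prop : Measurable fun p : En n × En n =>
    ENNReal.ofReal (1 + ‖p.2‖) * G p), Measure.volume_eq_prod, lintegral_prod _ (by fun_prop)]

lemma enorm_smul_one_prod_le {a : ℝ} (ha : 0 ≤ a) (v : En n) :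
    ‖a • ((1 : ℝ), v)‖ₑ ≤ ENNReal.ofReal (1 + ‖v‖) * ENNReal.ofReal a := by
  rw [enorm_smul, Real.enorm_of_nonneg ha, mul_comm]
  gcongr
  exact enorm_one_prod_le v

/-- The mollification by `m` of `rayMom σ g`. -/
def mollRayMom (m : En n → ℝ) (σ : ℝ) (g : En n × En n → ℝ) (x : En n) : ℝ × En n :=
  ∫ p : En n × En n, (m (x - p.1 - σ • p.2) * g p) • ((1 : ℝ), p.2)

lemma mollRayMom_eq {m : En n → ℝ} (hm : Continuous m) {M : ℝ} (hM : ∀ x, ‖m x‖ ≤ M) {σ : ℝ}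
    {g : En n × En n → ℝ} (hg : Measurable g) (hg0 : ∀ p, 0 ≤ g p) {C : ℝ}
    (hC : ∫⁻ p : En n × En n, ENNReal.ofReal (1 + ‖p.2‖ ^ 2) * ENNReal.ofReal (g p) ≤
      ENNReal.ofReal C) (x : En n) :
    mollRayMom m σ g x = ∫ z, m z • rayMom σ g (x - z) := by
  have hmm := hm.measurable
  have hgi : Integrable fun p : En n × En n => g p • ((1 : ℝ), p.2) := by
    refine ⟨(by fun_prop : Measurable _).aestronglyMeasurable, ?_⟩
    refine lt_of_le_of_lt (lintegral_mono fun p => ?_)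
      ((lintegral_one_add_norm_le hC).trans_lt ENNReal.ofReal_lt_top)
    exact enorm_smul_one_prod_le (hg0 p) p.2
  have hint : Integrable fun p : En n × En n =>
      (m (x - p.1 - σ • p.2) * g p) • ((1 : ℝ), p.2) := by
    simp_rw [mul_smul]
    refine hgi.bdd_smul M
      (by fun_prop : Measurable fun p : En n × En n =>
        m (x - p.1 - σ • p.2)).aestronglyMeasurable (.of_forall fun p => hM _)
  have hmeas : Measurable fun p : En n × En n =>
      (m (x - p.1 - σ • p.2) * g p) • ((1 : ℝ), p.2) := by fun_prop
  have hint' : Integrable fun p : En n × En n =>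
      (m (x - p.1) * g (p.1 - σ • p.2, p.2)) • ((1 : ℝ), p.2) := by
    refine ⟨(by fun_prop : Measurable _).aestronglyMeasurable, ?_⟩
    have h := hint.2
    rw [HasFiniteIntegral, ← lintegral_shear σ hmeas.enorm] at h
    simp only [sub_sub, sub_add_cancel] at h
    exact h
  rw [mollRayMom, ← integral_shear σ hmeas.stronglyMeasurable]
  simp only [sub_sub, sub_add_cancel]
  rw [Measure.volume_eq_prod] at hint' ⊢
  rw [integral_prod _ hint', ← integral_sub_left_eq_self _ volume x]
  refine integral_congr_ae (.of_forall fun z => ?_)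
  simp only [sub_sub_cancel, mul_smul]
  rw [integral_smul, rayMom]

lemma lintegral_mollRayMom_sub_le {m : En n → ℝ} (hm : Continuous m) {M : ℝ}
    (hM : ∀ x, ‖m x‖ ≤ M) (hm0 : ∀ x, 0 ≤ m x) (hm1 : ∫ x, m x = 1) {η : ℝ}
    (hmη : ∀ x, m x ≠ 0 → ‖x‖ ≤ η) {σ : ℝ}
    {g : En n × En n → ℝ} (hg : Measurable g) (hg0 : ∀ p, 0 ≤ g p) {C : ℝ}
    (hC : ∫⁻ p : En n × En n, ENNReal.ofReal (1 + ‖p.2‖ ^ 2) * ENNReal.ofReal (g p) ≤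
      ENNReal.ofReal C) {B : Set (En n)} {ε : ENNReal}
    (hε : ∀ z, ‖z‖ ≤ η → ∫⁻ x in B, ‖rayMom σ g (x - z) - rayMom σ g x‖ₑ ≤ ε) :
    ∫⁻ x in B, ‖mollRayMom m σ g x - rayMom σ g x‖ₑ ≤ ε := by
  have hmm := hm.measurable
  have hr : Measurable (rayMom σ g) := by
    have : Measurable fun q : En n × En n => g (q.1 - σ • q.2, q.2) • ((1 : ℝ), q.2) := by fun_prop
    exact (this.stronglyMeasurable.integral_prod_right' (ν := volume)).measurable
  have hmi : Integrable m := not_imp_comm.1 integral_undef (by rw [hm1]; exact one_ne_zero)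
  have hml : ∫⁻ z, ‖m z‖ₑ = 1 := by
    rw [← ENNReal.ofReal_one, ← hm1, ofReal_integral_eq_lintegral_ofReal hmi (.of_forall hm0)]
    exact lintegral_congr fun z => Real.enorm_of_nonneg (hm0 z)
  calc ∫⁻ x in B, ‖mollRayMom m σ g x - rayMom σ g x‖ₑ
      ≤ ∫⁻ x in B, ∫⁻ z, ‖m z‖ₑ * ‖rayMom σ g (x - z) - rayMom σ g x‖ₑ := by
        refine lintegral_mono fun x => ?_
        have h1 : rayMom σ g x = ∫ z, m z • rayMom σ g x := by
          rw [integral_smul_const, hm1, one_smul]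
        simp only
        conv_lhs => rw [mollRayMom_eq hm hM hg hg0 hC, h1]
        refine (enorm_integral_sub_integral_le
          (by fun_prop : Measurable _).aestronglyMeasurable).trans (le_of_eq ?_)
        refine lintegral_congr fun z => ?_
        rw [← smul_sub, enorm_smul]
    _ = ∫⁻ z, ∫⁻ x in B, ‖m z‖ₑ * ‖rayMom σ g (x - z) - rayMom σ g x‖ₑ :=
        lintegral_lintegral_swap (by fun_prop)
    _ ≤ ∫⁻ z, ‖m z‖ₑ * ε := by
        refine lintegral_mono fun z => ?_
        rw [lintegral_const_mul' _ _ enorm_ne_top]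
        by_cases hz : m z = 0
        · simp [hz]
        · gcongr
          exact hε z (hmη z hz)
    _ = ε := by rw [lintegral_mul_const _ (by fun_prop), hml, one_mul]

lemma momField_eq_integral {f : ℝ → En n × En n → ℝ} {t : ℝ} {x : En n}
    (h : Integrable fun v => f t (x, v) • ((1 : ℝ), v)) :
    momField f (t, x) = ∫ v, f t (x, v) • ((1 : ℝ), v) := by
  have h1 := h.fst
  have h2 := h.snd
  simp only [Prod.smul_mk, smul_eq_mul, mul_one] at h1 h2
  simp only [Prod.smul_mk, smul_eq_mul, mul_one]
  rw [integral_pair h1 h2, momField]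

/-- The velocity moments of the Duhamel term. -/
lemma momField_mildMap_zero (hτ : 0 < τ) (hδ : 0 ≤ δ) {g : ℝ → En n × En n → ℝ}
    (hg : Measurable (Function.uncurry g)) (hg0 : ∀ s p, 0 ≤ g s p) {C : ℝ}
    (hC : ∀ s, 0 < s → ∫⁻ p : En n × En n, ENNReal.ofReal (1 + ‖p.2‖ ^ 2) *
      ENNReal.ofReal (g s p) ≤ ENNReal.ofReal C) (t : ℝ) :
    ∀ᵐ x : En n, Integrable (fun v => mildMap τ δ 0 g t (x, v) • ((1 : ℝ), v)) ∧
      momField (mildMap τ δ 0 g) (t, x) =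
        (1 / τ) • ∫ s in Set.Ioc 0 (t - δ), exp (-(t - s) / τ) • rayMom (t - s) (g s) x := by
  have hgc : Measurable fun q : ℝ × En n × En n => g q.1 q.2 := hg
  set ν : Measure ℝ := volume.restrict (Set.Ioc 0 (t - δ)) with hν
  have hJ : ∀ᵐ x : En n, ∫⁻ v, ∫⁻ s, ENNReal.ofReal (1 + ‖v‖) *
      ENNReal.ofReal (g s (x - (t - s) • v, v)) ∂ν < ⊤ := by
    have hm1 : Measurable fun q : (En n × En n) × ℝ => ENNReal.ofReal (1 + ‖q.1.2‖) *
        ENNReal.ofReal (g q.2 (q.1.1 - (t - q.2) • q.1.2, q.1.2)) := by fun_prop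
    have hm2 : Measurable fun q : En n × En n => ∫⁻ s, ENNReal.ofReal (1 + ‖q.2‖) *
        ENNReal.ofReal (g s (q.1 - (t - s) • q.2, q.2)) ∂ν := hm1.lintegral_prod_right'
    refine ae_lt_top hm2.lintegral_prod_right' (ne_of_lt ?_)
    have e1 : ∫⁻ x, ∫⁻ v, ∫⁻ s, ENNReal.ofReal (1 + ‖v‖) *
        ENNReal.ofReal (g s (x - (t - s) • v, v)) ∂ν =
        ∫⁻ s, (∫⁻ p : En n × En n, ENNReal.ofReal (1 + ‖p.2‖) *
          ENNReal.ofReal (g s p)) ∂ν := by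
      rw [← lintegral_prod _ hm2.aemeasurable, lintegral_lintegral_swap hm1.aemeasurable]
      refine lintegral_congr fun s => ?_
      rw [← Measure.volume_eq_prod, lintegral_shear (t - s) (F := fun p =>
        ENNReal.ofReal (1 + ‖p.2‖) * ENNReal.ofReal (g s p)) (by fun_prop)]
    rw [e1]
    calc _ ≤ ∫⁻ s, ENNReal.ofReal (2 * C) ∂ν := by
          rw [hν]
          refine setLIntegral_mono measurable_const fun s hs => ?_
          exact lintegral_one_add_norm_le (hC s hs.1)
      _ < ⊤ := by
          rw [lintegral_const, hν, Measure.restrict_apply_univ]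
          exact ENNReal.mul_lt_top ENNReal.ofReal_lt_top (by simp)
  filter_upwards [hJ] with x hx
  have hint : Integrable (fun q : En n × ℝ =>
      (exp (-(t - q.2) / τ) * g q.2 (x - (t - q.2) • q.1, q.1)) • ((1 : ℝ), q.1))
      (volume.prod ν) := by
    refine ⟨(by fun_prop : Measurable _).aestronglyMeasurable, ?_⟩
    rw [HasFiniteIntegral, lintegral_prod _ (by fun_prop)]
    refine lt_of_le_of_lt (lintegral_mono fun v => ?_) hx
    rw [hν]
    refine setLIntegral_mono (by fun_prop) fun s hs => ?_
    refine (enorm_smul_one_prod_le (mul_nonneg (exp_pos _).le (hg0 _ _)) v).trans ?_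
    gcongr
    refine mul_le_of_le_one_left (hg0 _ _) (exp_le_one_iff.2 ?_)
    have : 0 ≤ (t - s) / τ := div_nonneg (by linarith [hs.2]) hτ.le
    rw [neg_div]
    linarith
  have hA : ∀ v, mildMap τ δ 0 g t (x, v) • ((1 : ℝ), v) =
      (1 / τ) • ∫ s, (exp (-(t - s) / τ) * g s (x - (t - s) • v, v)) • ((1 : ℝ), v) ∂ν := by
    intro v
    rw [integral_smul_const, mildMap, smul_smul]
    simp [hν]
  have hA' : Integrable (fun v => mildMap τ δ 0 g t (x, v) • ((1 : ℝ), v)) := by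
    simp_rw [hA]
    exact hint.integral_prod_left.smul (1 / τ)
  refine ⟨hA', ?_⟩
  rw [momField_eq_integral hA']
  simp_rw [hA]
  rw [integral_smul, integral_integral_swap hint]
  congr 1
  refine integral_congr_ae (.of_forall fun s => ?_)
  simp only [mul_smul]
  rw [integral_smul, rayMom]

end

section

variable {n : ℕ} {γ κ τ δ : ℝ}

lemma exists_time_cutoff (τ : ℝ) {b N : ℝ} (hb : 0 < b) (hbN : 2 * b < N) :
    ∃ χ : ℝ → ℝ, (∃ L : NNReal, LipschitzWith L χ) ∧ (∀ σ, 0 ≤ χ σ) ∧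
      (∀ σ, χ σ ≤ exp (-σ / τ)) ∧ (∀ σ, σ ≤ b → χ σ = 0) ∧
      ∀ σ, 2 * b ≤ σ → σ ≤ N → χ σ = exp (-σ / τ) := by
  let β : ContDiffBump ((2 * b + N) / 2 : ℝ) :=
    ⟨(2 * b + N) / 2 - 2 * b, (2 * b + N) / 2 - b, by linarith, by linarith⟩
  refine ⟨fun σ => β σ * exp (-σ / τ), ?_, fun σ => by have := β.nonneg (x := σ); positivity,
    fun σ => mul_le_of_le_one_left (exp_pos _).le β.le_one, fun σ hσ => ?_, fun σ h1 h2 => ?_⟩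
  · refine ContDiff.lipschitzWith_of_hasCompactSupport (𝕂 := ℝ) (n := 1)
      (β.hasCompactSupport.mul_right) ?_ one_ne_zero
    exact (β.contDiff).mul (by fun_prop)
  · simp only
    rw [β.zero_of_le_dist, zero_mul]
    change (2 * b + N) / 2 - b ≤ _
    rw [Real.dist_eq]
    exact le_trans (by linarith) (neg_le_abs _)
  · simp only
    rw [β.one_of_mem_closedBall, one_mul]
    change dist _ _ ≤ (2 * b + N) / 2 - 2 * b
    rw [Real.dist_eq, abs_le]
    constructor <;> linarith

lemma exists_mollifier (n : ℕ) {η : ℝ} (hη : 0 < η) :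
    ∃ m : En n → ℝ, (∃ L : NNReal, LipschitzWith L m) ∧ (∃ M, ∀ x, ‖m x‖ ≤ M) ∧ (∀ x, 0 ≤ m x) ∧
      ∫ x, m x = 1 ∧ ∀ x, m x ≠ 0 → ‖x‖ ≤ η := by
  let β : ContDiffBump (0 : En n) := ⟨η / 2, η, by linarith, by linarith⟩
  refine ⟨β.normed volume, ?_, ?_, β.nonneg_normed, β.integral_normed, fun x hx => ?_⟩
  · exact ContDiff.lipschitzWith_of_hasCompactSupport (𝕂 := ℝ) (n := 1)
      β.hasCompactSupport_normed β.contDiff_normed one_ne_zero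
  · exact β.hasCompactSupport_normed.exists_bound_of_continuous β.continuous_normed
  · have : x ∈ Function.support (β.normed volume) := hx
    rw [β.support_normed_eq, mem_ball_zero_iff] at this
    exact this.le

lemma measurable_rayMom {g : ℝ → En n × En n → ℝ} (hg : Measurable (Function.uncurry g)) :
    Measurable fun q : (ℝ × ℝ) × En n => rayMom q.1.1 (g q.1.2) q.2 := by
  have hgc : Measurable fun q : ℝ × En n × En n => g q.1 q.2 := hg
  have : Measurable fun q : ((ℝ × ℝ) × En n) × En n =>
      g q.1.1.2 (q.1.2 - q.1.1.1 • q.2, q.2) • ((1 : ℝ), q.2) := by fun_prop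
  exact (this.stronglyMeasurable.integral_prod_right' (ν := volume)).measurable

lemma measurable_mollRayMom {m : En n → ℝ} (hm : Measurable m) {g : ℝ → En n × En n → ℝ}
    (hg : Measurable (Function.uncurry g)) :
    Measurable fun q : (ℝ × ℝ) × En n => mollRayMom m q.1.1 (g q.1.2) q.2 := by
  have hgc : Measurable fun q : ℝ × En n × En n => g q.1 q.2 := hg
  have : Measurable fun q : ((ℝ × ℝ) × En n) × En n × En n =>
      (m (q.1.2 - q.2.1 - q.1.1.1 • q.2.2) * g q.1.1.2 q.2) • ((1 : ℝ), q.2.2) := by fun_prop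
  exact (this.stronglyMeasurable.integral_prod_right' (ν := volume)).measurable

lemma lintegral_duhamel_sub_le (hτ : 0 < τ) {b N C : ℝ} (hδb : δ ≤ b) (hδ : 0 ≤ δ)
    {χ : ℝ → ℝ} (hχm : Measurable χ) (hχ0 : ∀ σ, 0 ≤ χ σ) (hχe : ∀ σ, χ σ ≤ exp (-σ / τ))
    (hχb : ∀ σ, σ ≤ b → χ σ = 0) (hχ1 : ∀ σ, 2 * b ≤ σ → σ ≤ N → χ σ = exp (-σ / τ))
    {m : En n → ℝ} (hm : Measurable m) {g : ℝ → En n × En n → ℝ}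
    (hg : Measurable (Function.uncurry g)) (hg0 : ∀ s p, 0 ≤ g s p)
    (hC : ∀ s, 0 < s → ∫⁻ p : En n × En n, ENNReal.ofReal (1 + ‖p.2‖ ^ 2) *
      ENNReal.ofReal (g s p) ≤ ENNReal.ofReal C) {B : Set (En n)} {ε : ENNReal} {t : ℝ}
    (htN : t ≤ N)
    (hε : ∀ s, 0 < s → ∀ σ, b ≤ σ → σ ≤ N →
      ∫⁻ x in B, ‖mollRayMom m σ (g s) x - rayMom σ (g s) x‖ₑ ≤ ε) :
    ∫⁻ x in B, ‖(1 / τ) • (∫ s in Set.Ioc 0 (t - δ),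
        exp (-(t - s) / τ) • rayMom (t - s) (g s) x) -
        (1 / τ) • ∫ s in Set.Ioc 0 N, χ (t - s) • mollRayMom m (t - s) (g s) x‖ₑ ≤
      ENNReal.ofReal (1 / τ) *
        (ε * ENNReal.ofReal N + ENNReal.ofReal (2 * C) * ENNReal.ofReal (2 * b)) := by
  have hgc : Measurable fun q : ℝ × En n × En n => g q.1 q.2 := hg
  have hU : Measurable fun q : En n × ℝ => rayMom (t - q.2) (g q.2) q.1 :=
    (measurable_rayMom hg).comp (f := fun q : En n × ℝ => ((t - q.2, q.2), q.1)) (by fun_prop)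
  have hV : Measurable fun q : En n × ℝ => mollRayMom m (t - q.2) (g q.2) q.1 :=
    (measurable_mollRayMom hm hg).comp (f := fun q : En n × ℝ => ((t - q.2, q.2), q.1))
      (by fun_prop)
  set I₁ := Set.Iic (t - b) with hI₁
  set I₂ := Set.Icc (t - 2 * b) t with hI₂
  have hb : 0 ≤ b := hδ.trans hδb
  set P : En n × ℝ → ENNReal := fun q =>
    I₁.indicator (fun s => ‖mollRayMom m (t - s) (g s) q.1 - rayMom (t - s) (g s) q.1‖ₑ) q.2
    with hP
  set Q : En n × ℝ → ENNReal := fun q =>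
    I₂.indicator (fun s => ‖rayMom (t - s) (g s) q.1‖ₑ) q.2 with hQ
  have hPm : Measurable P := by
    have : Measurable ((Prod.snd ⁻¹' I₁).indicator fun q : En n × ℝ =>
      ‖mollRayMom m (t - q.2) (g q.2) q.1 - rayMom (t - q.2) (g q.2) q.1‖ₑ) :=
      (hV.sub hU).enorm.indicator (measurable_snd measurableSet_Iic)
    exact this
  have hQm : Measurable Q := by
    have : Measurable ((Prod.snd ⁻¹' I₂).indicator fun q : En n × ℝ =>
      ‖rayMom (t - q.2) (g q.2) q.1‖ₑ) :=
      hU.enorm.indicator (measurable_snd measurableSet_Icc)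
    exact this
  have hexp : ∀ {σ : ℝ}, 0 ≤ σ → exp (-σ / τ) ≤ 1 := fun {σ} hσ => by
    rw [exp_le_one_iff, neg_div]
    have := div_nonneg hσ hτ.le
    linarith
  have hpt : ∀ x, ‖(1 / τ) • (∫ s in Set.Ioc 0 (t - δ),
        exp (-(t - s) / τ) • rayMom (t - s) (g s) x) -
        (1 / τ) • ∫ s in Set.Ioc 0 N, χ (t - s) • mollRayMom m (t - s) (g s) x‖ₑ ≤
      ENNReal.ofReal (1 / τ) * ∫⁻ s in Set.Ioc 0 N, (P (x, s) + Q (x, s)) := by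
    intro x
    have hUx : Measurable fun s => rayMom (t - s) (g s) x :=
      hU.comp (f := fun s => (x, s)) (by fun_prop)
    have hVx : Measurable fun s => mollRayMom m (t - s) (g s) x :=
      hV.comp (f := fun s => (x, s)) (by fun_prop)
    rw [← smul_sub, enorm_smul, Real.enorm_of_nonneg (by positivity)]
    gcongr
    have e1 : ∫ s in Set.Ioc 0 (t - δ), exp (-(t - s) / τ) • rayMom (t - s) (g s) x =
        ∫ s in Set.Ioc 0 N, (Set.Iic (t - δ)).indicator
          (fun s => exp (-(t - s) / τ) • rayMom (t - s) (g s) x) s := by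
      rw [setIntegral_indicator measurableSet_Iic]
      congr 2
      ext s
      simp only [Set.mem_Ioc, Set.mem_inter_iff, Set.mem_Iic]
      constructor
      · rintro ⟨h1, h2⟩; exact ⟨⟨h1, by linarith⟩, h2⟩
      · rintro ⟨⟨h1, -⟩, h2⟩; exact ⟨h1, h2⟩
    rw [e1]
    refine (enorm_integral_sub_integral_le ?_).trans ?_
    · refine Measurable.aestronglyMeasurable ?_
      refine Measurable.sub (Measurable.indicator (by fun_prop) measurableSet_Iic) (by fun_prop)
    refine setLIntegral_mono ((hPm.add hQm).comp (f := fun s => (x, s)) (by fun_prop))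
      fun s hs => ?_
    have hsplit : ∀ c : ℝ, c • rayMom (t - s) (g s) x - χ (t - s) • mollRayMom m (t - s) (g s) x =
        (c - χ (t - s)) • rayMom (t - s) (g s) x -
          χ (t - s) • (mollRayMom m (t - s) (g s) x - rayMom (t - s) (g s) x) := by
      intro c
      rw [smul_sub, sub_smul]
      abel
    by_cases h1 : s ∈ Set.Iic (t - δ)
    · rw [Set.indicator_of_mem h1, hsplit]
      rw [Set.mem_Iic] at h1
      refine enorm_sub_le.trans ?_
      rw [add_comm]
      refine add_le_add ?_ ?_
      · by_cases h2 : s ∈ I₁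
        · simp only [hP]
          rw [Set.indicator_of_mem h2, enorm_smul, Real.enorm_of_nonneg (hχ0 _)]
          refine mul_le_of_le_one_left zero_le ?_
          rw [← ENNReal.ofReal_one]
          exact ENNReal.ofReal_le_ofReal ((hχe _).trans (hexp (by linarith)))
        · rw [hχb _ (by rw [hI₁, Set.mem_Iic, not_le] at h2; linarith)]
          simp
      · by_cases h2 : s ∈ I₂
        · simp only [hQ]
          rw [Set.indicator_of_mem h2, enorm_smul,
            Real.enorm_of_nonneg (by linarith [hχe (t - s)])]
          refine mul_le_of_le_one_left zero_le ?_
          rw [← ENNReal.ofReal_one]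
          refine ENNReal.ofReal_le_ofReal ?_
          linarith [hχ0 (t - s), hexp (show 0 ≤ t - s by linarith)]
        · rw [hχ1 (t - s), sub_self]
          · simp
          · by_contra h3
            exact h2 ⟨by linarith, by linarith⟩
          · linarith [hs.1]
    · rw [Set.indicator_of_notMem h1]
      rw [Set.mem_Iic, not_le] at h1
      rw [hχb _ (by linarith)]
      simp
  calc _ ≤ ∫⁻ x in B, ENNReal.ofReal (1 / τ) * ∫⁻ s in Set.Ioc 0 N, (P (x, s) + Q (x, s)) :=
        lintegral_mono hpt
    _ = ENNReal.ofReal (1 / τ) *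
        ∫⁻ s in Set.Ioc 0 N, ∫⁻ x in B, (P (x, s) + Q (x, s)) := by
        rw [lintegral_const_mul' _ _ ENNReal.ofReal_ne_top,
          lintegral_lintegral_swap (hPm.add hQm).aemeasurable]
    _ ≤ ENNReal.ofReal (1 / τ) * ∫⁻ s in Set.Ioc 0 N,
        (ε + I₂.indicator (fun _ => ENNReal.ofReal (2 * C)) s) := by
        gcongr 1
        refine setLIntegral_mono ((measurable_const.indicator measurableSet_Icc).const_add _)
          fun s hs => ?_
        have hPs : Measurable fun x => P (x, s) := hPm.comp (f := fun x => (x, s)) (by fun_prop)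
        rw [lintegral_add_left hPs]
        refine add_le_add ?_ ?_
        · by_cases h1 : s ∈ I₁
          · simp only [hP, Set.indicator_of_mem h1]
            rw [hI₁, Set.mem_Iic] at h1
            exact hε s hs.1 _ (by linarith) (by linarith [hs.1])
          · simp [hP, Set.indicator_of_notMem h1]
        · by_cases h1 : s ∈ I₂
          · simp only [hQ, Set.indicator_of_mem h1]
            refine (setLIntegral_le_lintegral _ _).trans ?_
            refine le_trans ?_ (lintegral_one_add_norm_le (hC s hs.1))
            rw [← lintegral_lintegral_ray (t - s) (by fun_prop)]
            refine lintegral_mono fun x => ?_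
            rw [rayMom]
            exact (enorm_integral_le_lintegral_enorm _).trans
              (lintegral_mono fun v => enorm_smul_one_prod_le (hg0 _ _) v)
          · simp [hQ, Set.indicator_of_notMem h1]
    _ ≤ _ := by
        gcongr 1
        rw [lintegral_add_left measurable_const, lintegral_const, Measure.restrict_apply_univ,
          Real.volume_Ioc, sub_zero, lintegral_indicator measurableSet_Icc, lintegral_const,
          Measure.restrict_apply_univ]
        gcongr
        refine (Measure.restrict_apply_le _ _).trans ?_
        rw [Real.volume_Icc]
        exact ENNReal.ofReal_le_ofReal (by linarith)

lemma integral_lipschitz_bounded {Z α F : Type*} [PseudoMetricSpace Z] [MeasurableSpace α]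
    {ν : Measure α} [NormedAddCommGroup F] [NormedSpace ℝ F] {Ψ : Z → α → F} {W : α → ENNReal}
    {A L M : ℝ} (hA : 0 ≤ A) (hL : 0 ≤ L) (hM : 0 ≤ M)
    (hΨm : ∀ z, AEStronglyMeasurable (Ψ z) ν) (hW : ∫⁻ a, W a ∂ν ≤ ENNReal.ofReal A)
    (hΨL : ∀ z z', ∀ᵐ a ∂ν, ‖Ψ z a - Ψ z' a‖ₑ ≤ ENNReal.ofReal (L * dist z z') * W a)
    (hΨM : ∀ z, ∀ᵐ a ∂ν, ‖Ψ z a‖ₑ ≤ ENNReal.ofReal M * W a) :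
    (∀ z z', ‖∫ a, Ψ z a ∂ν - ∫ a, Ψ z' a ∂ν‖ ≤ L * A * dist z z') ∧
      ∀ z, ‖∫ a, Ψ z a ∂ν‖ ≤ M * A := by
  have key : ∀ (f : F) (c : ℝ), 0 ≤ c → ‖f‖ₑ ≤ ENNReal.ofReal c → ‖f‖ ≤ c := fun f c hc h => by
    rwa [← ofReal_norm, ENNReal.ofReal_le_ofReal_iff hc] at h
  constructor
  · intro z z'
    refine key _ _ (by positivity) ((enorm_integral_sub_integral_le
      ((hΨm z).sub (hΨm z'))).trans ((lintegral_mono_ae (hΨL z z')).trans ?_))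
    rw [lintegral_const_mul' _ _ ENNReal.ofReal_ne_top, mul_right_comm,
      ENNReal.ofReal_mul (p := L * dist z z') (by positivity)]
    gcongr
  · intro z
    refine key _ _ (by positivity) ((enorm_integral_le_lintegral_enorm _).trans
      ((lintegral_mono_ae (hΨM z)).trans ?_))
    rw [lintegral_const_mul' _ _ ENNReal.ofReal_ne_top, ENNReal.ofReal_mul hM]
    gcongr

/-- The mollified Duhamel averages are bounded and Lipschitz, uniformly over sources with a given
weighted mass. -/
lemma exists_mollified_duhamel_bound {N C : ℝ} (hN : 0 ≤ N) (hC0 : 0 ≤ C) {χ : ℝ → ℝ}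
    {Lχ : NNReal} (hχL : LipschitzWith Lχ χ) (hχ1 : ∀ σ, |χ σ| ≤ 1) {m : En n → ℝ} {Lm : NNReal}
    (hmL : LipschitzWith Lm m) {M : ℝ} (hM : ∀ x, ‖m x‖ ≤ M) :
    ∃ L B : ℝ, ∀ g : ℝ → En n × En n → ℝ, Measurable (Function.uncurry g) → (∀ s p, 0 ≤ g s p) →
      (∀ s, 0 < s → ∫⁻ p : En n × En n, ENNReal.ofReal (1 + ‖p.2‖ ^ 2) *
        ENNReal.ofReal (g s p) ≤ ENNReal.ofReal C) →
      (∀ z z' : ℝ × En n,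
        ‖(∫ s in Set.Ioc 0 N, χ (z.1 - s) • mollRayMom m (z.1 - s) (g s) z.2) -
          ∫ s in Set.Ioc 0 N, χ (z'.1 - s) • mollRayMom m (z'.1 - s) (g s) z'.2‖ ≤
          L * dist z z') ∧
      ∀ z : ℝ × En n,
        ‖∫ s in Set.Ioc 0 N, χ (z.1 - s) • mollRayMom m (z.1 - s) (g s) z.2‖ ≤ B := by
  have hM0 : 0 ≤ M := (norm_nonneg _).trans (hM 0)
  set A := 2 * C * N with hA
  set L : ℝ := 2 * (Lχ * M + Lm) with hL
  refine ⟨L * A, 2 * M * A, fun g hg hg0 hC => ?_⟩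
  have hgc : Measurable fun q : ℝ × En n × En n => g q.1 q.2 := hg
  have hχm := hχL.continuous.measurable
  have hmm := hmL.continuous.measurable
  set ν : Measure (ℝ × En n × En n) := (volume.restrict (Set.Ioc 0 N)).prod volume with hν
  set W : ℝ × En n × En n → ENNReal := fun a =>
    ENNReal.ofReal (1 + ‖a.2.2‖ ^ 2) * ENNReal.ofReal (g a.1 a.2) with hW
  set Ψ : ℝ × En n → ℝ × En n × En n → ℝ × En n := fun z a =>
    (χ (z.1 - a.1) * m (z.2 - a.2.1 - (z.1 - a.1) • a.2.2) * g a.1 a.2) • ((1 : ℝ), a.2.2) with hΨ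
  have hΨm : ∀ z, AEStronglyMeasurable (Ψ z) ν := fun z =>
    (by fun_prop : Measurable _).aestronglyMeasurable
  have hWA : ∫⁻ a, W a ∂ν ≤ ENNReal.ofReal A := by
    rw [hν, lintegral_prod _ (by fun_prop)]
    calc _ ≤ ∫⁻ s in Set.Ioc 0 N, ENNReal.ofReal (2 * C) := by
          refine setLIntegral_mono measurable_const fun s hs => (hC s hs.1).trans ?_
          exact ENNReal.ofReal_le_ofReal (by linarith)
      _ = ENNReal.ofReal A := by
          rw [lintegral_const, Measure.restrict_apply_univ, Real.volume_Ioc, sub_zero, hA,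
            ← ENNReal.ofReal_mul (by positivity)]
  have hbd : ∀ (c K : ℝ) (a : ℝ × En n × En n), |c| ≤ K * (1 + ‖a.2.2‖) →
      ‖(c * g a.1 a.2) • ((1 : ℝ), a.2.2)‖ₑ ≤ ENNReal.ofReal (2 * K) * W a := by
    intro c K a hc
    have hw := norm_nonneg a.2.2
    have hK : 0 ≤ K := by
      by_contra hK
      have := abs_nonneg c
      nlinarith
    simp only [hW]
    rw [← ofReal_norm, ← ENNReal.ofReal_mul (by positivity),
      ← ENNReal.ofReal_mul (by positivity)]
    refine ENNReal.ofReal_le_ofReal ?_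
    rw [norm_smul, norm_mul, Real.norm_eq_abs, Real.norm_of_nonneg (hg0 _ _)]
    have h1 : ‖((1 : ℝ), a.2.2)‖ ≤ 1 + ‖a.2.2‖ := by
      rw [Prod.norm_def]
      exact max_le (by simp) (by simp)
    have hg1 := hg0 a.1 a.2
    calc |c| * g a.1 a.2 * ‖((1 : ℝ), a.2.2)‖
        ≤ K * (1 + ‖a.2.2‖) * g a.1 a.2 * (1 + ‖a.2.2‖) := by gcongr
      _ = K * g a.1 a.2 * (1 + ‖a.2.2‖) ^ 2 := by ring
      _ ≤ K * g a.1 a.2 * (2 * (1 + ‖a.2.2‖ ^ 2)) := by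
          gcongr
          nlinarith [sq_nonneg (‖a.2.2‖ - 1)]
      _ = _ := by ring
  have hΨM : ∀ z a, ‖Ψ z a‖ₑ ≤ ENNReal.ofReal (2 * M) * W a := fun z a => by
    refine hbd _ M a ?_
    rw [abs_mul]
    have h1 := hχ1 (z.1 - a.1)
    have h2 := hM (z.2 - a.2.1 - (z.1 - a.1) • a.2.2)
    rw [Real.norm_eq_abs] at h2
    have h3 := norm_nonneg a.2.2
    calc _ ≤ 1 * M := by gcongr
      _ ≤ _ := by nlinarith
  have hΨL : ∀ z z' a, ‖Ψ z a - Ψ z' a‖ₑ ≤ ENNReal.ofReal (L * dist z z') * W a := by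
    intro z z' a
    simp only [hΨ]
    rw [← sub_smul, ← sub_mul, hL, mul_assoc]
    refine hbd _ ((Lχ * M + Lm) * dist z z') a ?_
    set X := z.2 - a.2.1 - (z.1 - a.1) • a.2.2 with hX
    set X' := z'.2 - a.2.1 - (z'.1 - a.1) • a.2.2 with hX'
    have h3 := norm_nonneg a.2.2
    have hd1 : |z.1 - z'.1| ≤ dist z z' := by
      rw [← Real.dist_eq, Prod.dist_eq]; exact le_max_left _ _
    have hd2 : ‖z.2 - z'.2‖ ≤ dist z z' := by
      rw [← dist_eq_norm, Prod.dist_eq]; exact le_max_right _ _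
    have hd0 : 0 ≤ dist z z' := dist_nonneg
    have h1 : |χ (z.1 - a.1) - χ (z'.1 - a.1)| ≤ Lχ * dist z z' := by
      have := hχL.dist_le_mul (z.1 - a.1) (z'.1 - a.1)
      rw [Real.dist_eq, Real.dist_eq, sub_sub_sub_cancel_right] at this
      exact this.trans (by gcongr)
    have h2 : |m X - m X'| ≤ Lm * (dist z z' * (1 + ‖a.2.2‖)) := by
      have := hmL.dist_le_mul X X'
      rw [Real.dist_eq, dist_eq_norm] at this
      refine this.trans ?_
      gcongr
      have : X - X' = (z.2 - z'.2) - (z.1 - z'.1) • a.2.2 := by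
        rw [hX, hX', sub_smul, sub_smul, sub_smul]
        abel
      rw [this]
      refine (norm_sub_le _ _).trans ?_
      rw [norm_smul, Real.norm_eq_abs]
      calc _ ≤ dist z z' + dist z z' * ‖a.2.2‖ := by gcongr
        _ = _ := by ring
    have h4 := hM X
    have h5 := hχ1 (z'.1 - a.1)
    rw [Real.norm_eq_abs] at h4
    have h6 : χ (z.1 - a.1) * m X - χ (z'.1 - a.1) * m X' =
        (χ (z.1 - a.1) - χ (z'.1 - a.1)) * m X + χ (z'.1 - a.1) * (m X - m X') := by ring
    rw [h6]
    refine (abs_add_le _ _).trans ?_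
    rw [abs_mul, abs_mul]
    calc _ ≤ Lχ * dist z z' * M + 1 * (Lm * (dist z z' * (1 + ‖a.2.2‖))) := by gcongr
      _ ≤ _ := by
          have : 0 ≤ (Lχ : ℝ) * dist z z' * M * ‖a.2.2‖ := by positivity
          nlinarith
  have heq : ∀ z : ℝ × En n,
      ∫ s in Set.Ioc 0 N, χ (z.1 - s) • mollRayMom m (z.1 - s) (g s) z.2 = ∫ a, Ψ z a ∂ν := by
    intro z
    have hi : Integrable (Ψ z) ν := by
      refine ⟨hΨm z, (lintegral_mono (hΨM z)).trans_lt ?_⟩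
      rw [lintegral_const_mul' _ _ ENNReal.ofReal_ne_top]
      exact ENNReal.mul_lt_top ENNReal.ofReal_lt_top (hWA.trans_lt ENNReal.ofReal_lt_top)
    rw [hν, integral_prod _ hi]
    refine integral_congr_ae (.of_forall fun s => ?_)
    simp only [mollRayMom]
    rw [← integral_smul]
    refine integral_congr_ae (.of_forall fun p => ?_)
    simp only [hΨ, smul_smul, mul_assoc]
  simp_rw [heq]
  exact integral_lipschitz_bounded (by positivity) (by positivity) (by positivity) hΨm hWA
    (fun z z' => .of_forall (hΨL z z')) (fun z => .of_forall (hΨM z))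

end

section

variable {n : ℕ} {γ κ τ : ℝ}

open Filter Topology

/-- The local Maxwellians with prescribed density and momentum. -/
def maxwLift (γ κ : ℝ) (m : ℝ × En n → ℝ × En n) (s : ℝ) (p : En n × En n) : ℝ :=
  maxwMom n γ κ (m (s, p.1)) p.2

lemma maxwField_eq_maxwLift (f : ℝ → En n × En n → ℝ) :
    maxwField γ κ f = maxwLift γ κ (momField f) := by
  ext t p
  exact maxwField_eq f t p

lemma measurable_maxwLift {m : ℝ × En n → ℝ × En n} (hm : Measurable m) :
    Measurable (Function.uncurry (maxwLift γ κ m)) := by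
  have : Measurable fun q : ℝ × En n × En n => maxwMom n γ κ (m (q.1, q.2.1)) q.2.2 := by
    fun_prop
  exact this

lemma maxwLift_nonneg (hn : 1 ≤ n) (hγ1 : 1 < γ) (hγ2 : γ < ((n : ℝ) + 2) / n) (hκ : 0 < κ)
    (m : ℝ × En n → ℝ × En n) (s : ℝ) (p : En n × En n) : 0 ≤ maxwLift γ κ m s p :=
  maxwMom_nonneg hn hγ1 hγ2 hκ _ _

/-- Velocity averaging: the moments generated by Maxwellian sources of bounded second moment are,
up to a small error in `L¹`, uniformly bounded and equi-Lipschitz. -/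
lemma exists_lipschitz_approx (hn : 1 ≤ n) (hγ1 : 1 < γ) (hγ2 : γ < ((n : ℝ) + 2) / n)
    (hκ : 0 < κ) (hτ : 0 < τ) {C : ℝ} (hC0 : 0 ≤ C) {δ : ℕ → ℝ} (hδ0 : ∀ k, 0 ≤ δ k)
    (hδ : Tendsto δ atTop (𝓝 0)) {m : ℕ → ℝ × En n → ℝ × En n} (hm : ∀ k, Measurable (m k))
    (hm0 : ∀ k q, 0 ≤ (m k q).1)
    (hC : ∀ k s, 0 < s → ∫⁻ p : En n × En n, ENNReal.ofReal (1 + ‖p.2‖ ^ 2) *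
      ENNReal.ofReal (maxwLift γ κ (m k) s p) ≤ ENNReal.ofReal C) (N : ℕ) {ε : ℝ} (hε : 0 < ε) :
    ∃ (a : ℕ → ℝ × En n → ℝ × En n) (L B : ℝ),
      (∀ k z z', ‖a k z - a k z'‖ ≤ L * dist z z') ∧ (∀ k z, ‖a k z‖ ≤ B) ∧
      ∀ᶠ k in atTop, ∫⁻ z in Set.Ioc 0 (N : ℝ) ×ˢ Metric.closedBall (0 : En n) N,
        ‖momField (mildMap τ (δ k) 0 (maxwLift γ κ (m k))) z - a k z‖ₑ ≤ ENNReal.ofReal ε := by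
  set T : ℝ := N + 1 with hT
  have hN0 : (0 : ℝ) ≤ N := N.cast_nonneg
  have hT1 : 1 ≤ T := by linarith
  set b : ℝ := min (1 / 4) (ε * τ / (8 * (C + 1) * T)) with hb
  have hb0 : 0 < b := lt_min (by norm_num) (by positivity)
  have hb1 : b ≤ 1 / 4 := min_le_left _ _
  have hb2 : b * (8 * (C + 1) * T) ≤ ε * τ := by
    rw [← le_div_iff₀ (by positivity)]
    exact min_le_right _ _
  have hbT : 2 * b < T := by linarith
  set e : ℝ := ε * τ / (2 * T ^ 2) with he
  have he0 : 0 < e := by positivity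
  obtain ⟨χ, ⟨Lχ, hχL⟩, hχ0, hχe, hχb, hχ1⟩ := exists_time_cutoff τ hb0 hbT
  have hχabs : ∀ σ, |χ σ| ≤ 1 := fun σ => by
    rw [abs_of_nonneg (hχ0 σ)]
    rcases le_total σ b with h | h
    · rw [hχb σ h]; exact zero_le_one
    · refine (hχe σ).trans (exp_le_one_iff.2 ?_)
      rw [neg_div, neg_nonpos]
      exact div_nonneg (hb0.le.trans h) hτ.le
  obtain ⟨η, hη, htr⟩ := exists_rayMom_translate_le hn hγ1 hγ2 hκ (N := T) hb0 he0 hC0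
  obtain ⟨ψ, ⟨Lψ, hψL⟩, ⟨M, hM⟩, hψ0, hψ1, hψη⟩ := exists_mollifier n hη
  obtain ⟨L, B, hLB⟩ := exists_mollified_duhamel_bound (N := T) (by linarith) hC0 hχL hχabs hψL hM
  have hg := fun k => measurable_maxwLift (γ := γ) (κ := κ) (hm k)
  have hg0 := fun k => maxwLift_nonneg hn hγ1 hγ2 hκ (m k)
  refine ⟨fun k z => (1 / τ) • ∫ s in Set.Ioc 0 T,
    χ (z.1 - s) • mollRayMom ψ (z.1 - s) (maxwLift γ κ (m k) s) z.2, 1 / τ * L, 1 / τ * B,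
    fun k z z' => ?_, fun k z => ?_, ?_⟩
  · rw [← smul_sub, norm_smul, Real.norm_of_nonneg (by positivity), mul_assoc]
    gcongr
    exact (hLB _ (hg k) (hg0 k) (hC k)).1 z z'
  · rw [norm_smul, Real.norm_of_nonneg (by positivity)]
    gcongr
    exact (hLB _ (hg k) (hg0 k) (hC k)).2 z
  filter_upwards [hδ.eventually_le_const hb0] with k hk
  set S : ℝ × En n → ℝ × En n := fun z => (1 / τ) • ∫ s in Set.Ioc 0 T,
    χ (z.1 - s) • mollRayMom ψ (z.1 - s) (maxwLift γ κ (m k) s) z.2 with hS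
  have hSm : Measurable S := by
    have h1 := measurable_mollRayMom hψL.continuous.measurable (hg k)
    have h2 : Measurable fun q : (ℝ × En n) × ℝ =>
        mollRayMom ψ (q.1.1 - q.2) (maxwLift γ κ (m k) q.2) q.1.2 :=
      h1.comp (f := fun q : (ℝ × En n) × ℝ => ((q.1.1 - q.2, q.2), q.1.2)) (by fun_prop)
    have hχm := hχL.continuous.measurable
    have h3 : Measurable fun q : (ℝ × En n) × ℝ =>
        χ (q.1.1 - q.2) • mollRayMom ψ (q.1.1 - q.2) (maxwLift γ κ (m k) q.2) q.1.2 := by fun_prop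
    exact Measurable.const_smul (h3.stronglyMeasurable.integral_prod_right'
      (ν := volume.restrict (Set.Ioc 0 T))).measurable (1 / τ)
  have hmf := measurable_momField (measurable_mildMap (τ := τ) (δ := δ k)
    (f₀ := (0 : En n × En n → ℝ)) measurable_const (hg k))
  have hdm : Measurable fun z => ‖momField (mildMap τ (δ k) 0 (maxwLift γ κ (m k))) z - S z‖ₑ :=
    (hmf.sub hSm).enorm
  change ∫⁻ z in _, ‖momField (mildMap τ (δ k) 0 (maxwLift γ κ (m k))) z - S z‖ₑ ≤ _
  rw [Measure.volume_eq_prod, ← Measure.prod_restrict, lintegral_prod _ hdm.aemeasurable]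
  have hball : Metric.closedBall (0 : En n) N ⊆ Metric.closedBall (0 : En n) T :=
    Metric.closedBall_subset_closedBall (by linarith)
  have key : ∀ t ∈ Set.Ioc 0 (N : ℝ), ∫⁻ x in Metric.closedBall (0 : En n) N,
      ‖momField (mildMap τ (δ k) 0 (maxwLift γ κ (m k))) (t, x) - S (t, x)‖ₑ ≤
      ENNReal.ofReal (1 / τ) * (ENNReal.ofReal e * ENNReal.ofReal T +
        ENNReal.ofReal (2 * C) * ENNReal.ofReal (2 * b)) := by
    intro t ht
    refine le_trans ?_ (lintegral_duhamel_sub_le (B := Metric.closedBall (0 : En n) N) (t := t)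
      (N := T) hτ hk (hδ0 k) hχL.continuous.measurable hχ0 hχe hχb hχ1
      hψL.continuous.measurable (hg k) (hg0 k) (hC k) (by linarith [ht.2]) ?_)
    · refine lintegral_mono_ae (ae_restrict_of_ae ?_)
      filter_upwards [momField_mildMap_zero hτ (hδ0 k) (hg k) (hg0 k) (hC k) t] with x hx
      rw [hx.2]
    · intro s hs σ h1 h2
      have hgs : Measurable (maxwLift γ κ (m k) s) :=
        (hg k).comp (f := fun p : En n × En n => (s, p)) (by fun_prop)
      refine lintegral_mollRayMom_sub_le hψL.continuous hM hψ0 hψ1 hψη hgs (hg0 k s) (hC k s hs)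
        fun z hz => ?_
      refine (lintegral_mono_set hball).trans ?_
      exact htr (fun y => m k (s, y)) ((hm k).comp (f := fun y => (s, y)) (by fun_prop))
        (fun y => hm0 k _) (hC k s hs) σ h1 h2 z hz
  refine (setLIntegral_mono measurable_const key).trans ?_
  rw [lintegral_const, Measure.restrict_apply_univ, Real.volume_Ioc, sub_zero,
    ← ENNReal.ofReal_mul he0.le, ← ENNReal.ofReal_mul (by positivity),
    ← ENNReal.ofReal_add (by positivity) (by positivity), ← ENNReal.ofReal_mul (by positivity),
    ← ENNReal.ofReal_mul (by positivity)]
  refine ENNReal.ofReal_le_ofReal ?_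
  have h1 : e * T = ε * τ / (2 * T) := by rw [he]; field_simp
  rw [h1, div_mul_eq_mul_div, one_mul, div_mul_eq_mul_div, div_le_iff₀ hτ]
  have h2 : ε * τ / (2 * T) * N ≤ ε * τ / 2 := by
    rw [div_mul_eq_mul_div, div_le_div_iff₀ (by positivity) (by norm_num)]
    have : 0 < ε * τ := by positivity
    nlinarith
  have h3 : 2 * C * (2 * b) * N ≤ ε * τ / 2 := by
    have : C * b * N ≤ (C + 1) * b * T := by gcongr <;> linarith
    nlinarith
  linarith [add_mul (ε * τ / (2 * T)) (2 * C * (2 * b)) (N : ℝ)]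

end

section

variable {n : ℕ} {γ κ τ δ : ℝ}

open Filter Topology

lemma exists_lintegral_weight_le (hn : 1 ≤ n) (hγ1 : 1 < γ) (hγ2 : γ < ((n : ℝ) + 2) / n)
    (hκ : 0 < κ) : ∃ K : ℝ, 0 < K ∧ ∀ f : En n × En n → ℝ, Measurable f → (∀ p, 0 ≤ f p) →
      ∫⁻ p : En n × En n, ENNReal.ofReal (1 + ‖p.2‖ ^ 2) * ENNReal.ofReal (f p) ≤
        functional (fun y _ => y) f + ENNReal.ofReal K * functional (kinEnt n γ κ) f := by
  obtain ⟨K, hK0, hK⟩ := exists_le_kinEnt hn hγ1 hγ2 hκ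
  refine ⟨K, hK0, fun f hf hf0 => ?_⟩
  have hm : Measurable fun p : En n × En n => kinEnt n γ κ (f p) p.2 := by fun_prop
  rw [functional, functional, ← lintegral_const_mul _ hm.ennreal_ofReal,
    ← lintegral_add_left hf.ennreal_ofReal]
  refine lintegral_mono fun p => ?_
  rw [← ENNReal.ofReal_mul (by positivity), ← ENNReal.ofReal_mul hK0.le,
    ← ENNReal.ofReal_add (hf0 p)
      (mul_nonneg hK0.le (kinEnt_nonneg hn hγ1 hγ2 hκ (hf0 p) _))]
  refine ENNReal.ofReal_le_ofReal ?_
  have := (hK (f p) p.2 (hf0 p)).2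
  linarith

lemma decreasesUnderMaxw_mass (hn : 1 ≤ n) (hγ1 : 1 < γ) (hγ2 : γ < ((n : ℝ) + 2) / n)
    (hκ : 0 < κ) : DecreasesUnderMaxw γ κ (fun (y : ℝ) (_ : En n) => y) :=
  fun _ _ hf0 => lintegral_MaxwOf_le hn hγ1 hγ2 hκ hf0

lemma decreasesUnderMaxw_kinEnt (hn : 1 ≤ n) (hγ1 : 1 < γ) (hγ2 : γ < ((n : ℝ) + 2) / n)
    (hκ : 0 < κ) : DecreasesUnderMaxw γ κ (kinEnt n γ κ) :=
  fun _ hf hf0 => lintegral_kinEnt_MaxwOf_le hn hγ1 hγ2 hκ hf hf0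

lemma ae_momField_mildMap (hτ : 0 < τ) (hδ : 0 ≤ δ) {f₀ : En n × En n → ℝ}
    (hf₀m : Measurable f₀) (hf₀ : ∀ p, 0 ≤ f₀ p) {g : ℝ → En n × En n → ℝ}
    (hg : Measurable (Function.uncurry g)) (hg0 : ∀ s p, 0 ≤ g s p) {C : ℝ}
    (hC₀ : ∫⁻ p : En n × En n, ENNReal.ofReal (1 + ‖p.2‖ ^ 2) * ENNReal.ofReal (f₀ p) ≤
      ENNReal.ofReal C)
    (hC : ∀ s, 0 < s → ∫⁻ p : En n × En n, ENNReal.ofReal (1 + ‖p.2‖ ^ 2) *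
      ENNReal.ofReal (g s p) ≤ ENNReal.ofReal C) :
    ∀ᵐ z : ℝ × En n, momField (mildMap τ δ f₀ g) z =
      momField (mildMap τ 0 f₀ 0) z + momField (mildMap τ δ 0 g) z := by
  have hm1 := measurable_momField (measurable_mildMap (τ := τ) (δ := δ) hf₀m hg)
  have hm2 := measurable_momField (measurable_mildMap (τ := τ) (δ := 0) hf₀m
    (g := (0 : ℝ → En n × En n → ℝ)) measurable_const)
  have hm3 := measurable_momField (measurable_mildMap (τ := τ) (δ := δ)
    (f₀ := (0 : En n × En n → ℝ)) measurable_const hg)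
  rw [Measure.volume_eq_prod]
  refine (Measure.ae_prod_iff_ae_ae (measurableSet_eq_fun hm1 (hm2.add hm3))).2
    (.of_forall fun t => ?_)
  have hJ : ∀ᵐ x : En n, ∫⁻ v, ENNReal.ofReal (1 + ‖v‖) *
      ENNReal.ofReal (f₀ (x - t • v, v)) < ⊤ := by
    have hm : Measurable fun q : En n × En n => ENNReal.ofReal (1 + ‖q.2‖) *
        ENNReal.ofReal (f₀ (q.1 - t • q.2, q.2)) := by fun_prop
    refine ae_lt_top hm.lintegral_prod_right' (ne_of_lt ?_)
    rw [lintegral_lintegral_ray t (G := fun p => ENNReal.ofReal (f₀ p)) (by fun_prop)]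
    exact (lintegral_one_add_norm_le hC₀).trans_lt ENNReal.ofReal_lt_top
  filter_upwards [hJ, momField_mildMap_zero hτ hδ hg hg0 hC t] with x hx hx'
  have h1 : Integrable fun v => mildMap τ 0 f₀ 0 t (x, v) • ((1 : ℝ), v) := by
    have he : ∀ v, mildMap τ 0 f₀ 0 t (x, v) • ((1 : ℝ), v) =
        exp (-t / τ) • (f₀ (x - t • v, v) • ((1 : ℝ), v)) := fun v => by
      simp [mildMap, mul_smul]
    simp_rw [he]
    refine Integrable.smul (exp (-t / τ))
      ⟨(by fun_prop : Measurable _).aestronglyMeasurable, ?_⟩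
    exact (lintegral_mono fun v => enorm_smul_one_prod_le (hf₀ _) v).trans_lt hx
  have h2 := hx'.1
  have he : ∀ v, mildMap τ δ f₀ g t (x, v) • ((1 : ℝ), v) =
      mildMap τ 0 f₀ 0 t (x, v) • ((1 : ℝ), v) + mildMap τ δ 0 g t (x, v) • ((1 : ℝ), v) :=
    fun v => by rw [← add_smul]; simp [mildMap]
  have h3 : Integrable fun v => mildMap τ δ f₀ g t (x, v) • ((1 : ℝ), v) := by
    simp_rw [he]; exact h1.add h2
  rw [Pi.add_apply, momField_eq_integral h1, momField_eq_integral h2, momField_eq_integral h3,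
    ← integral_add h1 h2]
  exact integral_congr_ae (.of_forall he)

/-- Space-time cylinders exhausting `(0, ∞) × ℝⁿ`. -/
def cyl (n N : ℕ) : Set (ℝ × En n) := Set.Ioc 0 (N : ℝ) ×ˢ Metric.closedBall (0 : En n) N

lemma measurableSet_cyl (N : ℕ) : MeasurableSet (cyl n N) :=
  measurableSet_Ioc.prod Metric.isClosed_closedBall.measurableSet

lemma monotone_cyl : Monotone (cyl n) := fun N M h => by
  have : (N : ℝ) ≤ M := by exact_mod_cast h
  exact Set.prod_mono (Set.Ioc_subset_Ioc_right this) (Metric.closedBall_subset_closedBall this)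

lemma volume_cyl_ne_top (N : ℕ) : volume (cyl n N) ≠ ⊤ := by
  rw [cyl, Measure.volume_eq_prod, Measure.prod_prod]
  exact ENNReal.mul_ne_top (by simp) measure_closedBall_lt_top.ne

lemma iUnion_cyl : ⋃ N, cyl n N = Set.Ioi 0 ×ˢ Set.univ := by
  ext ⟨t, x⟩
  simp only [cyl, Set.mem_iUnion, Set.mem_prod, Set.mem_Ioc, Metric.mem_closedBall,
    dist_zero_right, Set.mem_Ioi, Set.mem_univ, and_true]
  refine ⟨fun ⟨_, h, _⟩ => h.1, fun h => ?_⟩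
  obtain ⟨N, hN⟩ := exists_nat_ge (max t ‖x‖)
  exact ⟨N, ⟨h, (le_max_left _ _).trans hN⟩, (le_max_right _ _).trans hN⟩

/-- Solutions of the equations with vanishing delay whose moments converge locally in `L¹`. -/
lemma exists_delayed_sequence (hn : 1 ≤ n) (hγ1 : 1 < γ) (hγ2 : γ < ((n : ℝ) + 2) / n)
    (hκ : 0 < κ) (hτ : 0 < τ) {f₀ : En n × En n → ℝ} (hf₀m : Measurable f₀)
    (hf₀ : ∀ p, 0 ≤ f₀ p) {C : ℝ} (hC0 : 0 ≤ C)
    (hC₀ : ∫⁻ p : En n × En n, ENNReal.ofReal (1 + ‖p.2‖ ^ 2) * ENNReal.ofReal (f₀ p) ≤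
      ENNReal.ofReal C)
    (hC : ∀ f : En n × En n → ℝ, Measurable f → (∀ p, 0 ≤ f p) →
      (∀ Θ : ℝ → En n → ℝ, IsConvexDensity Θ → DecreasesUnderMaxw γ κ Θ →
        functional Θ f ≤ functional Θ f₀) →
      ∫⁻ p : En n × En n, ENNReal.ofReal (1 + ‖p.2‖ ^ 2) * ENNReal.ofReal (f p) ≤
        ENNReal.ofReal C) :
    ∃ (f : ℕ → ℝ → En n × En n → ℝ) (δ : ℕ → ℝ) (h : ℝ × En n → ℝ × En n),
      (∀ k, 0 ≤ δ k) ∧ Tendsto δ atTop (𝓝 0) ∧ (∀ k, Measurable (Function.uncurry (f k))) ∧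
      (∀ k t p, 0 ≤ f k t p) ∧ (∀ k t, f k t = mildMap τ (δ k) f₀ (maxwField γ κ (f k)) t) ∧
      (∀ Θ : ℝ → En n → ℝ, IsConvexDensity Θ → DecreasesUnderMaxw γ κ Θ →
        ∀ k t, 0 ≤ t → functional Θ (f k t) ≤ functional Θ f₀) ∧
      Measurable h ∧
      (∀ᵐ z ∂volume.restrict (Set.Ioi 0 ×ˢ Set.univ),
        Tendsto (fun k => momField (f k) z) atTop (𝓝 (h z))) ∧
      ∀ N, Tendsto (fun k => ∫⁻ z in cyl n N, ‖momField (f k) z - h z‖ₑ) atTop (𝓝 0) := by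
  choose f hfm hf0 hfe hfΘ using fun k : ℕ => exists_delayed_solution hn hγ1 hγ2 hκ hτ
    (δ := 1 / ((k : ℝ) + 1)) (by positivity) hf₀m hf₀
  have hδ := tendsto_one_div_add_atTop_nhds_zero_nat (𝕜 := ℝ)
  have hm := fun k => measurable_momField (hfm k)
  have hm0 : ∀ k z, 0 ≤ (momField (f k) z).1 := fun k z => integral_nonneg fun v => hf0 k _ _
  have hg := fun k => measurable_maxwLift (γ := γ) (κ := κ) (hm k)
  have hg0 := fun k => maxwLift_nonneg hn hγ1 hγ2 hκ (momField (f k))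
  have hgC : ∀ k s, 0 < s → ∫⁻ p : En n × En n, ENNReal.ofReal (1 + ‖p.2‖ ^ 2) *
      ENNReal.ofReal (maxwLift γ κ (momField (f k)) s p) ≤ ENNReal.ofReal C := by
    intro k s hs
    refine hC _ ((hg k).comp (f := fun p => (s, p)) (by fun_prop)) (hg0 k s)
      fun Θ hΘ hΘM => ?_
    rw [← maxwField_eq_maxwLift]
    exact (functional_maxwField_le hΘ hΘM (hfm k) (hf0 k) s).trans (hfΘ k Θ hΘ hΘM s hs.le)
  set D : ℕ → ℝ × En n → ℝ × En n := fun k =>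
    momField (mildMap τ (1 / ((k : ℝ) + 1)) 0 (maxwLift γ κ (momField (f k)))) with hD
  set T : ℝ × En n → ℝ × En n := momField (mildMap τ 0 f₀ 0) with hT
  have hTm : Measurable T := measurable_momField (measurable_mildMap hf₀m measurable_const)
  have hDm : ∀ k, Measurable (D k) := fun k =>
    measurable_momField (measurable_mildMap measurable_const (hg k))
  have hdec : ∀ᵐ z : ℝ × En n, ∀ k, momField (f k) z = T z + D k z := by
    refine ae_all_iff.2 fun k => ?_
    have he : f k = mildMap τ (1 / ((k : ℝ) + 1)) f₀ (maxwLift γ κ (momField (f k))) := by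
      rw [← maxwField_eq_maxwLift]
      exact funext (hfe k)
    have := ae_momField_mildMap hτ (δ := 1 / ((k : ℝ) + 1)) (by positivity) hf₀m hf₀ (hg k)
      (hg0 k) hC₀ (hgC k)
    rwa [← he] at this
  obtain ⟨φ, G, hφ, hGm, hae, hL1⟩ := exists_subseq_of_lipschitz_approx (μ := volume)
    (measurableSet_cyl (n := n)) monotone_cyl volume_cyl_ne_top hDm
    fun N ε hε => exists_lipschitz_approx hn hγ1 hγ2 hκ hτ hC0 (fun k => by positivity) hδ hm hm0
      hgC N hε
  refine ⟨fun k => f (φ k), fun k => 1 / ((φ k : ℝ) + 1), fun z => T z + G z,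
    fun k => by positivity, hδ.comp hφ.tendsto_atTop, fun k => hfm _, fun k => hf0 _,
    fun k => hfe _, fun Θ hΘ hΘM k => hfΘ _ Θ hΘ hΘM, hTm.add hGm, ?_, fun N => ?_⟩
  · rw [← iUnion_cyl]
    filter_upwards [hae, ae_restrict_of_ae hdec] with z hz hz'
    simp_rw [hz']
    exact hz.const_add _
  · refine (hL1 N).congr fun k => ?_
    refine lintegral_congr_ae (ae_restrict_of_ae ?_)
    filter_upwards [hdec] with z hz
    rw [hz, add_sub_add_left_eq_sub]

end

section

variable {n : ℕ} {γ κ τ δ : ℝ}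

open Filter Topology

/-- Scheffé's lemma. -/
lemma tendsto_lintegral_enorm_sub_of_ae_tendsto {α : Type*} [MeasurableSpace α] {μ : Measure α}
    {F : ℕ → α → ℝ} {f : α → ℝ} (hF : ∀ k, Measurable (F k)) (hf : Measurable f)
    (hF0 : ∀ k a, 0 ≤ F k a) (hf0 : ∀ a, 0 ≤ f a)
    (hlim : ∀ᵐ a ∂μ, Tendsto (fun k => F k a) atTop (𝓝 (f a)))
    (hfin : ∫⁻ a, ENNReal.ofReal (f a) ∂μ ≠ ⊤) {r : ℕ → ENNReal} (hr : Tendsto r atTop (𝓝 0))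
    (hle : ∀ k, ∫⁻ a, ENNReal.ofReal (F k a) ∂μ ≤ (∫⁻ a, ENNReal.ofReal (f a) ∂μ) + r k) :
    Tendsto (fun k => ∫⁻ a, ‖F k a - f a‖ₑ ∂μ) atTop (𝓝 0) := by
  have hP : Tendsto (fun k => ∫⁻ a, ENNReal.ofReal (f a - F k a) ∂μ) atTop (𝓝 0) := by
    have := tendsto_lintegral_of_dominated_convergence (μ := μ)
      (F := fun k a => ENNReal.ofReal (f a - F k a)) (f := fun _ => 0)
      (fun a => ENNReal.ofReal (f a)) (fun k => (hf.sub (hF k)).ennreal_ofReal)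
      (fun k => .of_forall fun a => ENNReal.ofReal_le_ofReal (by linarith [hF0 k a])) hfin ?_
    · simpa using this
    · filter_upwards [hlim] with a ha
      have h := ENNReal.tendsto_ofReal (ha.const_sub (f a))
      simpa using h
  have hs : Tendsto (fun k => 2 * (∫⁻ a, ENNReal.ofReal (f a - F k a) ∂μ) + r k) atTop (𝓝 0) := by
    have := (ENNReal.Tendsto.const_mul hP (.inr (by simp : (2 : ENNReal) ≠ ⊤))).add hr
    simpa using this
  refine tendsto_of_tendsto_of_tendsto_of_le_of_le tendsto_const_nhds hs (fun _ => zero_le) fun k => ?_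
  have hpt : ∀ a, ‖F k a - f a‖ₑ + ENNReal.ofReal (f a) =
      2 * ENNReal.ofReal (f a - F k a) + ENNReal.ofReal (F k a) := by
    intro a
    rw [← ofReal_norm, Real.norm_eq_abs]
    rcases le_total (f a) (F k a) with h | h
    · rw [ENNReal.ofReal_of_nonpos (by linarith : f a - F k a ≤ 0), mul_zero, zero_add,
        abs_of_nonneg (by linarith), ← ENNReal.ofReal_add (by linarith) (hf0 a), sub_add_cancel]
    · have h0 : 0 ≤ f a - F k a := sub_nonneg.2 h
      rw [abs_of_nonpos (by linarith), neg_sub, two_mul, add_assoc,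
        ← ENNReal.ofReal_add h0 (hF0 k a), sub_add_cancel]
  have hm1 : Measurable fun a => ENNReal.ofReal (f a) := hf.ennreal_ofReal
  have hm2 : Measurable fun a => ENNReal.ofReal (F k a) := (hF k).ennreal_ofReal
  have hm3 : Measurable fun a => ENNReal.ofReal (f a - F k a) := (hf.sub (hF k)).ennreal_ofReal
  have hI := lintegral_congr (μ := μ) hpt
  rw [lintegral_add_right _ hm1, lintegral_add_right _ hm2, lintegral_const_mul _ hm3] at hI
  refine (ENNReal.add_le_add_iff_right hfin).1 ?_
  rw [hI, add_assoc, add_comm (r k)]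
  gcongr
  exact hle k

lemma enorm_momField_sub_le {f f' : ℝ → En n × En n → ℝ} (hf : Measurable (Function.uncurry f))
    (hf' : Measurable (Function.uncurry f')) (t : ℝ) (x : En n) :
    ‖momField f (t, x) - momField f' (t, x)‖ₑ ≤
      ∫⁻ v, ENNReal.ofReal (1 + ‖v‖) * ‖f t (x, v) - f' t (x, v)‖ₑ := by
  have hm : Measurable fun v => f t (x, v) :=
    hf.comp (f := fun v => (t, (x, v))) (by fun_prop)
  have hm' : Measurable fun v => f' t (x, v) :=
    hf'.comp (f := fun v => (t, (x, v))) (by fun_prop)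
  simp only [momField, Prod.mk_sub_mk]
  rw [← ofReal_norm, Prod.norm_def, ENNReal.ofReal_max, ofReal_norm, ofReal_norm]
  refine max_le ?_ ?_
  · refine (enorm_integral_sub_integral_le (hm.sub hm').aestronglyMeasurable).trans
      (lintegral_mono fun v => le_mul_of_one_le_left zero_le ?_)
    rw [ENNReal.one_le_ofReal]
    linarith [norm_nonneg v]
  · refine (enorm_integral_sub_integral_le
      (by fun_prop : Measurable fun v => f t (x, v) • v - f' t (x, v) • v).aestronglyMeasurable).trans
      (lintegral_mono fun v => ?_)
    rw [← sub_smul, enorm_smul, mul_comm, ← ofReal_norm v]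
    gcongr
    linarith

lemma lintegral_momField_mildMap_sub_le (hτ : 0 < τ) (hδ : 0 ≤ δ) {f₀ : En n × En n → ℝ}
    (hf₀m : Measurable f₀) {g g' : ℝ → En n × En n → ℝ} (hg : Measurable (Function.uncurry g))
    (hg0 : ∀ s p, 0 ≤ g s p) (hg' : Measurable (Function.uncurry g')) (hg0' : ∀ s p, 0 ≤ g' s p)
    {C : ℝ}
    (hC : ∀ s, 0 < s → ∫⁻ p : En n × En n, ENNReal.ofReal (1 + ‖p.2‖ ^ 2) *
      ENNReal.ofReal (g s p) ≤ ENNReal.ofReal C)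
    (hC' : ∀ᵐ s, 0 < s → ∫⁻ p : En n × En n, ENNReal.ofReal (1 + ‖p.2‖ ^ 2) *
      ENNReal.ofReal (g' s p) ≤ ENNReal.ofReal C) {r N R t : ℝ} (hR : 1 ≤ R) (htN : t ≤ N) :
    ∫⁻ x in Metric.closedBall (0 : En n) r,
      ‖momField (mildMap τ δ f₀ g) (t, x) - momField (mildMap τ 0 f₀ g') (t, x)‖ₑ ≤
      ENNReal.ofReal (1 / τ) * (ENNReal.ofReal (1 + R) *
        (∫⁻ s in Set.Ioc 0 N, ∫⁻ y in Metric.closedBall (0 : En n) (r + N * R),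
          ∫⁻ v, ‖g s (y, v) - g' s (y, v)‖ₑ) +
        ENNReal.ofReal (2 / R) * (2 * ENNReal.ofReal C) * ENNReal.ofReal N +
        ENNReal.ofReal (2 * C) * ENNReal.ofReal δ) := by
  have hgc : Measurable fun q : ℝ × En n × En n => g q.1 q.2 := hg
  have hgc' : Measurable fun q : ℝ × En n × En n => g' q.1 q.2 := hg'
  set Q : ℝ → En n × En n → ENNReal := fun s p => ‖g s p - g' s p‖ₑ with hQ
  set P : ℝ → En n × En n → ENNReal := fun s p =>
    (Set.Ioi (t - δ)).indicator (fun s => ENNReal.ofReal (g s p)) s with hP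
  have hQm : Measurable fun q : ℝ × En n × En n => Q q.1 q.2 := by fun_prop
  have hPm : Measurable fun q : ℝ × En n × En n => P q.1 q.2 := by
    have : Measurable ((Prod.fst ⁻¹' Set.Ioi (t - δ)).indicator
        fun q : ℝ × En n × En n => ENNReal.ofReal (g q.1 q.2)) :=
      Measurable.indicator (by fun_prop) (measurable_fst measurableSet_Ioi)
    exact this
  have hpt : ∀ p : En n × En n, ‖mildMap τ δ f₀ g t p - mildMap τ 0 f₀ g' t p‖ₑ ≤
      ENNReal.ofReal (1 / τ) * ∫⁻ s in Set.Ioc 0 t, Q s (p.1 - (t - s) • p.2, p.2) +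
        P s (p.1 - (t - s) • p.2, p.2) := by
    intro p
    have he : ∫ s in Set.Ioc 0 (t - δ), exp (-(t - s) / τ) * g s (p.1 - (t - s) • p.2, p.2) =
        ∫ s in Set.Ioc 0 t, (Set.Iic (t - δ)).indicator
          (fun s => exp (-(t - s) / τ) * g s (p.1 - (t - s) • p.2, p.2)) s := by
      rw [setIntegral_indicator measurableSet_Iic, Set.Ioc_inter_Iic, min_eq_right (by linarith)]
    unfold mildMap
    rw [add_sub_add_left_eq_sub, ← mul_sub, enorm_mul, Real.enorm_of_nonneg (by positivity), he,
      sub_zero]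
    gcongr
    have hmi : Measurable ((Set.Iic (t - δ)).indicator
        (fun s => exp (-(t - s) / τ) * g s (p.1 - (t - s) • p.2, p.2))) :=
      Measurable.indicator (by fun_prop) measurableSet_Iic
    refine (enorm_integral_sub_integral_le
      (hmi.sub (by fun_prop)).aestronglyMeasurable).trans ?_
    refine setLIntegral_mono' measurableSet_Ioc fun s hs => ?_
    have hexp : exp (-(t - s) / τ) ≤ 1 := by
      refine exp_le_one_iff.2 ?_
      have : 0 ≤ (t - s) / τ := div_nonneg (by linarith [hs.2]) hτ.le
      rw [neg_div]
      linarith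
    have hexp' : ‖exp (-(t - s) / τ)‖ₑ ≤ 1 := by
      rw [Real.enorm_of_nonneg (exp_pos _).le]
      exact ENNReal.ofReal_le_one.2 hexp
    set q : En n × En n := (p.1 - (t - s) • p.2, p.2)
    by_cases hsd : s ≤ t - δ
    · rw [Set.indicator_of_mem (by exact hsd), ← mul_sub, enorm_mul]
      refine le_add_right ?_
      exact mul_le_of_le_one_left zero_le hexp'
    · have h1 : P s q = ENNReal.ofReal (g s q) := by
        simp only [hP]
        exact Set.indicator_of_mem (by simpa using hsd) _
      rw [Set.indicator_of_notMem (by simpa using hsd), zero_sub, enorm_neg, enorm_mul, h1,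
        ← Real.enorm_of_nonneg (hg0 s q)]
      refine (mul_le_of_le_one_left zero_le hexp').trans ?_
      calc ‖g' s q‖ₑ = ‖g s q - (g s q - g' s q)‖ₑ := by rw [sub_sub_cancel]
        _ ≤ ‖g s q‖ₑ + ‖g s q - g' s q‖ₑ := enorm_sub_le
        _ = _ := add_comm _ _
  have hmm := measurable_mildMap (τ := τ) (δ := δ) hf₀m hg
  have hmm' := measurable_mildMap (τ := τ) (δ := 0) hf₀m hg'
  have hm4 : Measurable fun q : (En n × ℝ) × En n => ENNReal.ofReal (1 + ‖q.2‖) *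
      (Q q.1.2 (q.1.1 - (t - q.1.2) • q.2, q.2) + P q.1.2 (q.1.1 - (t - q.1.2) • q.2, q.2)) := by
    fun_prop
  have hm5 : Measurable fun q : En n × ℝ => ∫⁻ v, ENNReal.ofReal (1 + ‖v‖) *
      (Q q.2 (q.1 - (t - q.2) • v, v) + P q.2 (q.1 - (t - q.2) • v, v)) :=
    hm4.lintegral_prod_right'
  calc _ ≤ ∫⁻ x in Metric.closedBall (0 : En n) r, ENNReal.ofReal (1 / τ) *
        ∫⁻ s in Set.Ioc 0 t, ∫⁻ v, ENNReal.ofReal (1 + ‖v‖) *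
          (Q s (x - (t - s) • v, v) + P s (x - (t - s) • v, v)) := by
        refine lintegral_mono fun x => (enorm_momField_sub_le hmm hmm' t x).trans ?_
        have hm6 : Measurable fun q : ℝ × En n => ENNReal.ofReal (1 + ‖q.2‖) *
            (Q q.1 (x - (t - q.1) • q.2, q.2) + P q.1 (x - (t - q.1) • q.2, q.2)) :=
          hm4.comp (f := fun q : ℝ × En n => ((x, q.1), q.2)) (by fun_prop)
        rw [lintegral_lintegral_swap hm6.aemeasurable, ← lintegral_const_mul' _ _ ENNReal.ofReal_ne_top]
        refine lintegral_mono fun v => ?_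
        rw [lintegral_const_mul' _ _ ENNReal.ofReal_ne_top, mul_left_comm]
        gcongr
        exact hpt (x, v)
    _ = ENNReal.ofReal (1 / τ) * ∫⁻ s in Set.Ioc 0 t, ∫⁻ x in Metric.closedBall (0 : En n) r,
        ∫⁻ v, ENNReal.ofReal (1 + ‖v‖) *
          (Q s (x - (t - s) • v, v) + P s (x - (t - s) • v, v)) := by
        rw [lintegral_const_mul' _ _ ENNReal.ofReal_ne_top,
          lintegral_lintegral_swap hm5.aemeasurable]
    _ ≤ ENNReal.ofReal (1 / τ) * ∫⁻ s in Set.Ioc 0 t, (ENNReal.ofReal (1 + R) *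
        (∫⁻ y in Metric.closedBall (0 : En n) (r + N * R), ∫⁻ v, Q s (y, v)) +
        ENNReal.ofReal (2 / R) * (2 * ENNReal.ofReal C)) +
        (Set.Ioi (t - δ)).indicator (fun _ => ENNReal.ofReal (2 * C)) s := by
        gcongr 1
        refine lintegral_mono_ae ((ae_restrict_iff' measurableSet_Ioc).2 ?_)
        filter_upwards [hC'] with s hs' hs
        have hgs : Measurable (g s) := hgc.comp (f := fun p => (s, p)) (by fun_prop)
        have hgs' : Measurable (g' s) := hgc'.comp (f := fun p => (s, p)) (by fun_prop)
        have hQs : Measurable (Q s) := hQm.comp (f := fun p => (s, p)) (by fun_prop)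
        have hPs : Measurable (P s) := hPm.comp (f := fun p => (s, p)) (by fun_prop)
        have hmQ : Measurable fun q : En n × En n => ENNReal.ofReal (1 + ‖q.2‖) *
          Q s (q.1 - (t - s) • q.2, q.2) := by fun_prop
        have hsplit : ∀ x, ∫⁻ v, ENNReal.ofReal (1 + ‖v‖) *
            (Q s (x - (t - s) • v, v) + P s (x - (t - s) • v, v)) =
            (∫⁻ v, ENNReal.ofReal (1 + ‖v‖) * Q s (x - (t - s) • v, v)) +
            ∫⁻ v, ENNReal.ofReal (1 + ‖v‖) * P s (x - (t - s) • v, v) := fun x => by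
          simp_rw [mul_add]
          exact lintegral_add_left (hmQ.comp (f := fun v => (x, v)) (by fun_prop)) _
        simp_rw [hsplit]
        rw [lintegral_add_left hmQ.lintegral_prod_right']
        gcongr ?_ + ?_
        · refine (lintegral_ball_ray_le (N := N) (by linarith [hs.2]) (by linarith [hs.1]) hR
            hQs).trans ?_
          gcongr
          calc ∫⁻ p : En n × En n, ENNReal.ofReal (1 + ‖p.2‖ ^ 2) * Q s p
              ≤ ∫⁻ p : En n × En n, ENNReal.ofReal (1 + ‖p.2‖ ^ 2) * ENNReal.ofReal (g s p) +
                ENNReal.ofReal (1 + ‖p.2‖ ^ 2) * ENNReal.ofReal (g' s p) := by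
                refine lintegral_mono fun p => ?_
                rw [← mul_add, ← Real.enorm_of_nonneg (hg0 s p),
                  ← Real.enorm_of_nonneg (hg0' s p)]
                gcongr
                exact enorm_sub_le
            _ ≤ ENNReal.ofReal C + ENNReal.ofReal C := by
                rw [lintegral_add_left (by fun_prop)]
                exact add_le_add (hC s hs.1) (hs' hs.1)
            _ = _ := (two_mul _).symm
        · refine (setLIntegral_le_lintegral _ _).trans ?_
          rw [lintegral_lintegral_ray (t - s) hPs]
          by_cases hsd : s ∈ Set.Ioi (t - δ)
          · simp only [hP, Set.indicator_of_mem hsd]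
            exact lintegral_one_add_norm_le (hC s hs.1)
          · simp only [hP, Set.indicator_of_notMem hsd]
            simp
    _ ≤ _ := by
        gcongr 1
        rw [lintegral_add_right _ (measurable_const.indicator measurableSet_Ioi)]
        gcongr ?_ + ?_
        · refine (lintegral_mono_set (Set.Ioc_subset_Ioc_right htN)).trans ?_
          rw [lintegral_add_right _ measurable_const, lintegral_const_mul' _ _ ENNReal.ofReal_ne_top,
            lintegral_const, Measure.restrict_apply_univ, Real.volume_Ioc, sub_zero]
        · rw [lintegral_indicator measurableSet_Ioi, Measure.restrict_restrict measurableSet_Ioi,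
            lintegral_const, Measure.restrict_apply_univ]
          gcongr
          calc volume (Set.Ioi (t - δ) ∩ Set.Ioc 0 t) ≤ volume (Set.Ioc (t - δ) t) :=
                measure_mono fun s hs => ⟨hs.1, hs.2.2⟩
            _ = ENNReal.ofReal δ := by rw [Real.volume_Ioc, sub_sub_cancel]

end

section

variable {n : ℕ} {γ κ τ δ : ℝ}

open Filter Topology

lemma IsConvexDensity.functional_le_of_tendsto {Θ : ℝ → En n → ℝ} (hΘ : IsConvexDensity Θ)
    {F : ℕ → En n × En n → ℝ} {f : En n × En n → ℝ} (hF : ∀ k, Measurable (F k))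
    (hlim : ∀ᵐ p, Tendsto (fun k => F k p) atTop (𝓝 (f p))) {c : ENNReal}
    (hc : ∀ k, functional Θ (F k) ≤ c) : functional Θ f ≤ c := by
  have hm : ∀ k, Measurable fun p : En n × En n => ENNReal.ofReal (Θ (F k p) p.2) := fun k =>
    (hΘ.measurable.comp (f := fun p => (F k p, p.2)) (by fun_prop)).ennreal_ofReal
  calc functional Θ f
      = ∫⁻ p, liminf (fun k => ENNReal.ofReal (Θ (F k p) p.2)) atTop := by
        refine lintegral_congr_ae ?_
        filter_upwards [hlim] with p hp
        exact (ENNReal.tendsto_ofReal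
          (((hΘ.continuous p.2).tendsto _).comp hp)).liminf_eq.symm
    _ ≤ liminf (fun k => functional Θ (F k)) atTop := lintegral_liminf_le hm
    _ ≤ c := by
        refine (liminf_le_liminf (.of_forall hc)).trans ?_
        simp

lemma ae_tendsto_maxwLift (hn : 1 ≤ n) (hγ1 : 1 < γ) (hγ2 : γ < ((n : ℝ) + 2) / n)
    (hκ : 0 < κ) {m : ℕ → ℝ × En n → ℝ × En n} {h : ℝ × En n → ℝ × En n}
    (hm0 : ∀ k z, 0 ≤ (m k z).1) (hh0 : ∀ z, 0 ≤ (h z).1)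
    (hlim : ∀ᵐ z ∂volume.restrict (Set.Ioi 0 ×ˢ Set.univ),
      Tendsto (fun k => m k z) atTop (𝓝 (h z))) :
    ∀ᵐ s, 0 < s → ∀ᵐ p : En n × En n,
      Tendsto (fun k => maxwLift γ κ (m k) s p) atTop (𝓝 (maxwLift γ κ h s p)) := by
  rw [ae_restrict_iff' (measurableSet_Ioi.prod .univ), Measure.volume_eq_prod] at hlim
  filter_upwards [Measure.ae_ae_of_ae_prod hlim] with s hs hs0
  have : ∀ᵐ y : En n, Tendsto (fun k => m k (s, y)) atTop (𝓝 (h (s, y))) := by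
    filter_upwards [hs] with y hy
    exact hy ⟨hs0, trivial⟩
  rw [Measure.volume_eq_prod]
  filter_upwards [Measure.quasiMeasurePreserving_fst.ae this] with p hp
  exact tendsto_maxwMom hn hγ1 hγ2 hκ (fun k => hm0 k _) hp (hh0 _) p.2

lemma tendsto_lintegral_maxwMom_sub (hn : 1 ≤ n) (hγ1 : 1 < γ) (hγ2 : γ < ((n : ℝ) + 2) / n)
    (hκ : 0 < κ) {α : Type*} [MeasurableSpace α] {μ : Measure α} [SFinite μ]
    {m : ℕ → α → ℝ × En n} {h : α → ℝ × En n}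
    (hm : ∀ k, Measurable (m k)) (hh : Measurable h) (hm0 : ∀ k z, 0 ≤ (m k z).1)
    (hh0 : ∀ z, 0 ≤ (h z).1) (hlim : ∀ᵐ z ∂μ, Tendsto (fun k => m k z) atTop (𝓝 (h z)))
    (hfin : ∫⁻ z, ENNReal.ofReal (h z).1 ∂μ ≠ ⊤)
    (hL1 : Tendsto (fun k => ∫⁻ z, ‖m k z - h z‖ₑ ∂μ) atTop (𝓝 0)) :
    Tendsto (fun k => ∫⁻ z, ∫⁻ v, ‖maxwMom n γ κ (m k z) v - maxwMom n γ κ (h z) v‖ₑ ∂volume ∂μ)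
      atTop (𝓝 0) := by
  have hM : ∀ k, Measurable fun q : α × En n => maxwMom n γ κ (m k q.1) q.2 := fun k => by
    fun_prop
  have hM' : Measurable fun q : α × En n => maxwMom n γ κ (h q.1) q.2 := by fun_prop
  have hI : ∀ k, ∫⁻ q, ENNReal.ofReal (maxwMom n γ κ (m k q.1) q.2) ∂(μ.prod volume) =
      ∫⁻ z, ENNReal.ofReal (m k z).1 ∂μ := fun k => by
    rw [lintegral_prod _ (hM k).ennreal_ofReal.aemeasurable]
    simp only [lintegral_maxwMom hn hγ1 hγ2 hκ (hm0 k _)]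
  have hI' : ∫⁻ q, ENNReal.ofReal (maxwMom n γ κ (h q.1) q.2) ∂(μ.prod volume) =
      ∫⁻ z, ENNReal.ofReal (h z).1 ∂μ := by
    rw [lintegral_prod _ hM'.ennreal_ofReal.aemeasurable]
    simp only [lintegral_maxwMom hn hγ1 hγ2 hκ (hh0 _)]
  have := tendsto_lintegral_enorm_sub_of_ae_tendsto (μ := μ.prod volume) hM hM'
    (fun k q => maxwMom_nonneg hn hγ1 hγ2 hκ _ _) (fun q => maxwMom_nonneg hn hγ1 hγ2 hκ _ _)
    ?_ (hI'.trans_ne hfin) hL1 fun k => ?_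
  · refine this.congr fun k => ?_
    exact lintegral_prod _ ((hM k).sub hM').enorm.aemeasurable
  · filter_upwards [Measure.quasiMeasurePreserving_fst.ae hlim] with q hq
    exact tendsto_maxwMom hn hγ1 hγ2 hκ (fun k => hm0 k _) hq (hh0 _) q.2
  · rw [hI, hI', ← lintegral_add_left (by fun_prop)]
    refine lintegral_mono fun z => ?_
    have h1 : ‖(m k z).1 - (h z).1‖ ≤ ‖m k z - h z‖ := norm_fst_le (m k z - h z)
    rw [← ofReal_norm, ← ENNReal.ofReal_add (hh0 z) (norm_nonneg _)]
    refine ENNReal.ofReal_le_ofReal ?_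
    have := (le_abs_self _).trans h1
    linarith

lemma ae_shear (σ : ℝ) {P : En n → Prop} (hP : ∀ᵐ y, P y) :
    ∀ᵐ p : En n × En n, P (p.1 - σ • p.2) := by
  have hs : MeasurableSet (toMeasurable volume {y | ¬ P y}) := measurableSet_toMeasurable _ _
  have h0 : volume (toMeasurable volume {y | ¬ P y}) = 0 := by
    rw [measure_toMeasurable]
    exact hP
  have h1 : ∫⁻ p : En n × En n,
      (toMeasurable volume {y | ¬ P y}).indicator 1 (p.1 - σ • p.2) = 0 := by
    have hm : Measurable fun y : En n =>
        (toMeasurable volume {y | ¬ P y}).indicator (1 : En n → ENNReal) y :=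
      measurable_one.indicator hs
    have hm' : Measurable fun p : En n × En n =>
        (toMeasurable volume {y | ¬ P y}).indicator (1 : En n → ENNReal) (p.1 - σ • p.2) := by
      fun_prop
    rw [Measure.volume_eq_prod, lintegral_prod_symm _ hm'.aemeasurable]
    simp only
    simp_rw [lintegral_sub_right_eq_self
      (fun y => (toMeasurable volume {y | ¬ P y}).indicator (1 : En n → ENNReal) y) _]
    rw [lintegral_indicator_one hs, h0]
    simp
  rw [lintegral_eq_zero_iff (by
    exact (measurable_one.indicator hs).comp (f := fun p : En n × En n => p.1 - σ • p.2)
      (by fun_prop))] at h1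
  filter_upwards [h1] with p hp
  by_contra hc
  have : p.1 - σ • p.2 ∈ toMeasurable volume {y | ¬ P y} := subset_toMeasurable _ _ hc
  simp [Set.indicator_of_mem this] at hp

end

section

variable {n : ℕ} {γ κ τ δ : ℝ}

open Filter Topology

lemma lintegral_cyl (N : ℕ) {F : ℝ × En n → ENNReal} (hF : Measurable F) :
    ∫⁻ z in cyl n N, F z =
      ∫⁻ s in Set.Ioc 0 (N : ℝ), ∫⁻ y in Metric.closedBall (0 : En n) N, F (s, y) := by
  rw [cyl, Measure.volume_eq_prod, ← Measure.prod_restrict, lintegral_prod _ hF.aemeasurable]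

lemma cyl_subset (N : ℕ) : cyl n N ⊆ Set.Ioi 0 ×ˢ Set.univ :=
  (Set.subset_iUnion (cyl n) N).trans iUnion_cyl.subset

lemma momField_mildMap_eq_of_tendsto (hτ : 0 < τ) {f₀ : En n × En n → ℝ}
    (hf₀m : Measurable f₀) {C : ℝ} {δ : ℕ → ℝ} (hδ0 : ∀ k, 0 ≤ δ k)
    (hδ : Tendsto δ atTop (𝓝 0)) {g : ℕ → ℝ → En n × En n → ℝ} {g' : ℝ → En n × En n → ℝ}
    (hg : ∀ k, Measurable (Function.uncurry (g k))) (hg0 : ∀ k s p, 0 ≤ g k s p)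
    (hg' : Measurable (Function.uncurry g')) (hg0' : ∀ s p, 0 ≤ g' s p)
    (hC : ∀ k s, 0 < s → ∫⁻ p : En n × En n, ENNReal.ofReal (1 + ‖p.2‖ ^ 2) *
      ENNReal.ofReal (g k s p) ≤ ENNReal.ofReal C)
    (hC' : ∀ᵐ s, 0 < s → ∫⁻ p : En n × En n, ENNReal.ofReal (1 + ‖p.2‖ ^ 2) *
      ENNReal.ofReal (g' s p) ≤ ENNReal.ofReal C)
    (hgl : ∀ N, Tendsto (fun k => ∫⁻ z in cyl n N, ∫⁻ v, ‖g k z.1 (z.2, v) - g' z.1 (z.2, v)‖ₑ)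
      atTop (𝓝 0))
    {h : ℝ × En n → ℝ × En n} (hh : Measurable h)
    (hL1 : ∀ N, Tendsto (fun k => ∫⁻ z in cyl n N,
      ‖momField (mildMap τ (δ k) f₀ (g k)) z - h z‖ₑ) atTop (𝓝 0)) :
    ∀ᵐ z ∂volume.restrict (Set.Ioi 0 ×ˢ Set.univ), momField (mildMap τ 0 f₀ g') z = h z := by
  set F := momField (mildMap τ 0 f₀ g') with hF
  have hFm : Measurable F := measurable_momField (measurable_mildMap hf₀m hg')
  rw [← iUnion_cyl, ae_restrict_iUnion_iff]
  intro N
  suffices hA : ∫⁻ z in cyl n N, ‖F z - h z‖ₑ = 0 by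
    have hm : Measurable fun z => ‖F z - h z‖ₑ := (hFm.sub hh).enorm
    filter_upwards [(lintegral_eq_zero_iff hm).1 hA] with z hz
    simpa [sub_eq_zero] using hz
  have hstep : ∀ j : ℕ, ∫⁻ z in cyl n N, ‖F z - h z‖ₑ ≤ ENNReal.ofReal N *
      (ENNReal.ofReal (1 / τ) * (ENNReal.ofReal (2 / ((j : ℝ) + 1)) * (2 * ENNReal.ofReal C) *
        ENNReal.ofReal N)) := by
    intro j
    set S : ℕ → ENNReal := fun k => ∫⁻ z in cyl n (N + N * (j + 1)),
      ∫⁻ v, ‖g k z.1 (z.2, v) - g' z.1 (z.2, v)‖ₑ with hS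
    have hle : ∀ k, ∫⁻ z in cyl n N, ‖F z - h z‖ₑ ≤ ENNReal.ofReal N *
        (ENNReal.ofReal (1 / τ) * (ENNReal.ofReal (1 + ((j : ℝ) + 1)) * S k +
          ENNReal.ofReal (2 / ((j : ℝ) + 1)) * (2 * ENNReal.ofReal C) * ENNReal.ofReal N +
          ENNReal.ofReal (2 * C) * ENNReal.ofReal (δ k))) +
        ∫⁻ z in cyl n N, ‖momField (mildMap τ (δ k) f₀ (g k)) z - h z‖ₑ := by
      intro k
      have hkm : Measurable (momField (mildMap τ (δ k) f₀ (g k))) :=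
        measurable_momField (measurable_mildMap hf₀m (hg k))
      have hm : Measurable fun z => ‖momField (mildMap τ (δ k) f₀ (g k)) z - F z‖ₑ :=
        (hkm.sub hFm).enorm
      calc _ ≤ ∫⁻ z in cyl n N, ‖momField (mildMap τ (δ k) f₀ (g k)) z - F z‖ₑ +
            ‖momField (mildMap τ (δ k) f₀ (g k)) z - h z‖ₑ := by
            refine lintegral_mono fun z => ?_
            calc _ = ‖(momField (mildMap τ (δ k) f₀ (g k)) z - h z) -
                  (momField (mildMap τ (δ k) f₀ (g k)) z - F z)‖ₑ := by
                  rw [sub_sub_sub_cancel_left]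
              _ ≤ _ := enorm_sub_le
              _ = _ := add_comm _ _
        _ = _ := lintegral_add_left hm _
        _ ≤ _ := by
            gcongr
            rw [lintegral_cyl N hm]
            have hSle : ∫⁻ s in Set.Ioc 0 (N : ℝ), ∫⁻ y in
                Metric.closedBall (0 : En n) ((N : ℝ) + N * ((j : ℝ) + 1)),
                ∫⁻ v, ‖g k s (y, v) - g' s (y, v)‖ₑ ≤ S k := by
              have hgk : Measurable fun q : ℝ × En n × En n => g k q.1 q.2 := hg k
              have hgc' : Measurable fun q : ℝ × En n × En n => g' q.1 q.2 := hg'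
              have hq : Measurable fun q : (ℝ × En n) × En n =>
                ‖g k q.1.1 (q.1.2, q.2) - g' q.1.1 (q.1.2, q.2)‖ₑ := by fun_prop
              rw [hS]
              simp only
              rw [lintegral_cyl _ hq.lintegral_prod_right']
              push_cast
              refine lintegral_mono_set (Set.Ioc_subset_Ioc_right ?_)
              have : (0 : ℝ) ≤ N * (j + 1) := by positivity
              linarith
            calc _ ≤ ∫⁻ t in Set.Ioc 0 (N : ℝ), (ENNReal.ofReal (1 / τ) *
                  (ENNReal.ofReal (1 + ((j : ℝ) + 1)) * S k +
                  ENNReal.ofReal (2 / ((j : ℝ) + 1)) * (2 * ENNReal.ofReal C) *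
                    ENNReal.ofReal N + ENNReal.ofReal (2 * C) * ENNReal.ofReal (δ k))) := by
                  refine setLIntegral_mono' measurableSet_Ioc fun t ht => ?_
                  refine (lintegral_momField_mildMap_sub_le hτ (hδ0 k) hf₀m (hg k) (hg0 k) hg'
                    hg0' (hC k) hC' (N := N) (R := (j : ℝ) + 1) (by
                      have : (0 : ℝ) ≤ j := by positivity
                      linarith) ht.2).trans ?_
                  gcongr
              _ = _ := by
                  rw [setLIntegral_const, Real.volume_Ioc, sub_zero, mul_comm]
    have h1 : Tendsto (fun k => ENNReal.ofReal (1 + ((j : ℝ) + 1)) * S k) atTop (𝓝 0) := by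
      simpa using ENNReal.Tendsto.const_mul (hgl (N + N * (j + 1)))
        (.inr ENNReal.ofReal_ne_top)
    have h2 : Tendsto (fun k => ENNReal.ofReal (2 * C) * ENNReal.ofReal (δ k)) atTop (𝓝 0) := by
      simpa only [ENNReal.ofReal_zero, mul_zero] using ENNReal.Tendsto.const_mul
        (ENNReal.tendsto_ofReal hδ) (.inr (ENNReal.ofReal_ne_top (r := 2 * C)))
    have h3 := (ENNReal.Tendsto.const_mul (ENNReal.Tendsto.const_mul
      ((h1.add_const (ENNReal.ofReal (2 / ((j : ℝ) + 1)) * (2 * ENNReal.ofReal C) *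
        ENNReal.ofReal N)).add h2) (.inr (ENNReal.ofReal_ne_top (r := 1 / τ))))
      (.inr (ENNReal.ofReal_ne_top (r := N)))).add (hL1 N)
    refine ge_of_tendsto' (x := atTop) ?_ hle
    simpa using h3
  have hR : Tendsto (fun j : ℕ => (2 : ℝ) / ((j : ℝ) + 1)) atTop (𝓝 0) := by
    simpa [div_eq_mul_inv] using
      (tendsto_one_div_add_atTop_nhds_zero_nat (𝕜 := ℝ)).const_mul 2
  have hlim : Tendsto (fun j : ℕ => ENNReal.ofReal N * (ENNReal.ofReal (1 / τ) *
      (ENNReal.ofReal (2 / ((j : ℝ) + 1)) * (2 * ENNReal.ofReal C) * ENNReal.ofReal N)))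
      atTop (𝓝 0) := by
    have h1 := ENNReal.Tendsto.mul_const (ENNReal.Tendsto.mul_const (ENNReal.tendsto_ofReal hR)
      (b := 2 * ENNReal.ofReal C) (.inr (ENNReal.mul_ne_top (by simp) ENNReal.ofReal_ne_top)))
      (b := ENNReal.ofReal N) (.inr ENNReal.ofReal_ne_top)
    have h2 := ENNReal.Tendsto.const_mul (ENNReal.Tendsto.const_mul h1
      (.inr (ENNReal.ofReal_ne_top (r := 1 / τ)))) (.inr (ENNReal.ofReal_ne_top (r := N)))
    simpa using h2
  exact le_antisymm (ge_of_tendsto' hlim hstep) zero_le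

lemma exists_mild_solution (hn : 1 ≤ n) (hγ1 : 1 < γ) (hγ2 : γ < ((n : ℝ) + 2) / n)
    (hκ : 0 < κ) (hτ : 0 < τ) {f₀ : En n × En n → ℝ} (hf₀m : Measurable f₀)
    (hf₀ : ∀ p, 0 ≤ f₀ p) {C : ℝ} (hC0 : 0 ≤ C)
    (hC₀ : ∫⁻ p : En n × En n, ENNReal.ofReal (1 + ‖p.2‖ ^ 2) * ENNReal.ofReal (f₀ p) ≤
      ENNReal.ofReal C)
    (hC : ∀ f : En n × En n → ℝ, Measurable f → (∀ p, 0 ≤ f p) →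
      (∀ Θ : ℝ → En n → ℝ, IsConvexDensity Θ → DecreasesUnderMaxw γ κ Θ →
        functional Θ f ≤ functional Θ f₀) →
      ∫⁻ p : En n × En n, ENNReal.ofReal (1 + ‖p.2‖ ^ 2) * ENNReal.ofReal (f p) ≤
        ENNReal.ofReal C) :
    ∃ h : ℝ × En n → ℝ × En n, Measurable h ∧ (∀ z, 0 ≤ (h z).1) ∧
      (∀ᵐ s, 0 < s → ∀ Θ : ℝ → En n → ℝ, IsConvexDensity Θ → DecreasesUnderMaxw γ κ Θ →
        functional Θ (maxwLift γ κ h s) ≤ functional Θ f₀) ∧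
      ∀ᵐ z ∂volume.restrict (Set.Ioi 0 ×ˢ Set.univ),
        momField (mildMap τ 0 f₀ (maxwLift γ κ h)) z = h z := by
  obtain ⟨f, δ, h₀, hδ0, hδ, hfm, hf0, hfe, hfΘ, hh₀m, hlim₀, hL1₀⟩ :=
    exists_delayed_sequence hn hγ1 hγ2 hκ hτ hf₀m hf₀ hC0 hC₀ hC
  have hm := fun k => measurable_momField (hfm k)
  have hm0 : ∀ k z, 0 ≤ (momField (f k) z).1 := fun k z => integral_nonneg fun v => hf0 k _ _
  set h : ℝ × En n → ℝ × En n := fun z => if 0 ≤ (h₀ z).1 then h₀ z else 0 with hh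
  have hhm : Measurable h :=
    Measurable.ite (measurableSet_le measurable_const hh₀m.fst) hh₀m measurable_const
  have hh0 : ∀ z, 0 ≤ (h z).1 := fun z => by
    simp only [hh]
    split_ifs with hz
    · exact hz
    · exact le_rfl
  have heq : ∀ᵐ z ∂volume.restrict (Set.Ioi 0 ×ˢ Set.univ), h₀ z = h z := by
    filter_upwards [hlim₀] with z hz
    have : 0 ≤ (h₀ z).1 :=
      ge_of_tendsto' ((continuous_fst.tendsto _).comp hz) fun k => hm0 k z
    simp [hh, this]
  have hlim : ∀ᵐ z ∂volume.restrict (Set.Ioi 0 ×ˢ Set.univ),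
      Tendsto (fun k => momField (f k) z) atTop (𝓝 (h z)) := by
    filter_upwards [hlim₀, heq] with z hz hz'
    rwa [← hz']
  have hL1 : ∀ N, Tendsto (fun k => ∫⁻ z in cyl n N, ‖momField (f k) z - h z‖ₑ)
      atTop (𝓝 0) := fun N => by
    refine (hL1₀ N).congr fun k => lintegral_congr_ae ?_
    filter_upwards [ae_restrict_of_ae_restrict_of_subset (cyl_subset N) heq] with z hz
    rw [hz]
  have hg := fun k => measurable_maxwLift (γ := γ) (κ := κ) (hm k)
  have hg0 := fun k => maxwLift_nonneg hn hγ1 hγ2 hκ (momField (f k))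
  have hg' := measurable_maxwLift (γ := γ) (κ := κ) hhm
  have hg0' := maxwLift_nonneg hn hγ1 hγ2 hκ h
  have hgs : ∀ k s, Measurable (maxwLift γ κ (momField (f k)) s) := fun k s =>
    (hg k).comp (f := fun p => (s, p)) (by fun_prop)
  have hgs' : ∀ s, Measurable (maxwLift γ κ h s) := fun s =>
    hg'.comp (f := fun p => (s, p)) (by fun_prop)
  have hgΘ : ∀ k s, 0 < s → ∀ Θ : ℝ → En n → ℝ, IsConvexDensity Θ → DecreasesUnderMaxw γ κ Θ →
      functional Θ (maxwLift γ κ (momField (f k)) s) ≤ functional Θ f₀ := by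
    intro k s hs Θ hΘ hΘM
    rw [← maxwField_eq_maxwLift]
    exact (functional_maxwField_le hΘ hΘM (hfm k) (hf0 k) s).trans (hfΘ Θ hΘ hΘM k s hs.le)
  have hgΘ' : ∀ᵐ s, 0 < s → ∀ Θ : ℝ → En n → ℝ, IsConvexDensity Θ → DecreasesUnderMaxw γ κ Θ →
      functional Θ (maxwLift γ κ h s) ≤ functional Θ f₀ := by
    filter_upwards [ae_tendsto_maxwLift hn hγ1 hγ2 hκ hm0 hh0 hlim] with s hs hs0 Θ hΘ hΘM
    exact hΘ.functional_le_of_tendsto (fun k => hgs k s) (hs hs0) fun k => hgΘ k s hs0 Θ hΘ hΘM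
  have hgC : ∀ k s, 0 < s → ∫⁻ p : En n × En n, ENNReal.ofReal (1 + ‖p.2‖ ^ 2) *
      ENNReal.ofReal (maxwLift γ κ (momField (f k)) s p) ≤ ENNReal.ofReal C :=
    fun k s hs => hC _ (hgs k s) (hg0 k s) (hgΘ k s hs)
  have hgC' : ∀ᵐ s, 0 < s → ∫⁻ p : En n × En n, ENNReal.ofReal (1 + ‖p.2‖ ^ 2) *
      ENNReal.ofReal (maxwLift γ κ h s p) ≤ ENNReal.ofReal C := by
    filter_upwards [hgΘ'] with s hs hs0
    exact hC _ (hgs' s) (hg0' s) (hs hs0)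
  have hfin : ∀ N, ∫⁻ z in cyl n N, ENNReal.ofReal (h z).1 ≠ ⊤ := by
    intro N
    refine ne_of_lt ?_
    calc ∫⁻ z in cyl n N, ENNReal.ofReal (h z).1
        = ∫⁻ s in Set.Ioc 0 (N : ℝ), ∫⁻ y in Metric.closedBall (0 : En n) N,
            ENNReal.ofReal (h (s, y)).1 := lintegral_cyl N (by fun_prop)
      _ ≤ ∫⁻ s in Set.Ioc 0 (N : ℝ), ENNReal.ofReal C := by
          refine lintegral_mono_ae ?_
          filter_upwards [ae_restrict_of_ae hgC', ae_restrict_mem measurableSet_Ioc] with s hs hsN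
          refine le_trans ?_ (hs hsN.1)
          calc _ ≤ ∫⁻ y, ENNReal.ofReal (h (s, y)).1 := setLIntegral_le_lintegral _ _
            _ = ∫⁻ y, ∫⁻ v, ENNReal.ofReal (maxwLift γ κ h s (y, v)) := by
                refine lintegral_congr fun y => ?_
                exact (lintegral_maxwMom hn hγ1 hγ2 hκ (hh0 (s, y))).symm
            _ = ∫⁻ p, ENNReal.ofReal (maxwLift γ κ h s p) := by
                rw [Measure.volume_eq_prod, lintegral_prod _
                  (hgs' s).ennreal_ofReal.aemeasurable]
            _ ≤ _ := lintegral_mono fun p => le_mul_of_one_le_left zero_le <| by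
                rw [ENNReal.one_le_ofReal]
                nlinarith [sq_nonneg ‖p.2‖]
      _ < ⊤ := by
          rw [setLIntegral_const]
          exact ENNReal.mul_lt_top ENNReal.ofReal_lt_top (by simp)
  refine ⟨h, hhm, hh0, hgΘ', ?_⟩
  refine momField_mildMap_eq_of_tendsto hτ hf₀m hδ0 hδ hg hg0 hg' hg0' hgC hgC' (fun N => ?_) hhm
    fun N => ?_
  · exact tendsto_lintegral_maxwMom_sub hn hγ1 hγ2 hκ hm hhm hm0 hh0
      (ae_restrict_of_ae_restrict_of_subset (cyl_subset N) hlim) (hfin N) (hL1 N)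
  · refine (hL1 N).congr fun k => ?_
    have he : f k = mildMap τ (δ k) f₀ (maxwLift γ κ (momField (f k))) := by
      rw [← maxwField_eq_maxwLift]
      exact funext (hfe k)
    rw [← he]

end

section

variable {n : ℕ} {γ κ τ δ : ℝ}

open Filter Topology

lemma lintegral_exp_decay (hτ : 0 < τ) {s t : ℝ} (hst : s ≤ t) :
    ENNReal.ofReal (exp (-(t - s) / τ)) +
      ENNReal.ofReal (1 / τ) * ∫⁻ r in Set.Ioc s t, ENNReal.ofReal (exp (-(r - s) / τ)) = 1 := by
  have hwi : IntegrableOn (fun r => exp (-(r - s) / τ)) (Set.Ioc s t) :=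
    (Continuous.integrableOn_Icc (by fun_prop)).mono_set Set.Ioc_subset_Icc_self
  have hI : ∫ r in Set.Ioc s t, exp (-(r - s) / τ) = τ - τ * exp (-(t - s) / τ) := by
    rw [← intervalIntegral.integral_of_le hst,
      intervalIntegral.integral_eq_sub_of_hasDerivAt (f := fun r => -τ * exp (-(r - s) / τ))]
    · simp
      ring
    · intro r _
      have h : HasDerivAt (fun r : ℝ => -(r - s) / τ) (-1 / τ) r := by
        have := (((hasDerivAt_id r).sub_const s).neg).div_const τ
        simpa using this
      have h2 := h.exp.const_mul (-τ)
      rwa [show -τ * (exp (-(r - s) / τ) * (-1 / τ)) = exp (-(r - s) / τ) by field_simp] at h2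
    · exact (Continuous.intervalIntegrable (by fun_prop) _ _)
  have he : exp (-(t - s) / τ) ≤ 1 := by
    rw [exp_le_one_iff]
    exact div_nonpos_of_nonpos_of_nonneg (by linarith) hτ.le
  rw [← ofReal_integral_eq_lintegral_ofReal hwi (.of_forall fun s => (exp_pos _).le), hI,
    ← ENNReal.ofReal_mul (by positivity), ← ENNReal.ofReal_add (exp_pos _).le
      (by have : 0 ≤ τ - τ * exp (-(t - s) / τ) := by nlinarith
          positivity)]
  rw [← ENNReal.ofReal_one]
  congr 1
  field_simp
  ring

lemma lintegral_Ioc_triangle_swap {w : ℝ → ℝ → ENNReal} (hw : Measurable (Function.uncurry w))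
    (t : ℝ) :
    ∫⁻ r in Set.Ioc 0 t, ∫⁻ s in Set.Ioc 0 r, w r s =
      ∫⁻ s in Set.Ioc 0 t, ∫⁻ r in Set.Ioc s t, w r s := by
  have hwc : Measurable fun q : ℝ × ℝ => w q.1 q.2 := hw
  have hset : MeasurableSet {q : ℝ × ℝ | q.2 < q.1} :=
    measurableSet_lt measurable_snd measurable_fst
  set I : ℝ → ℝ → ENNReal := fun r s => {q : ℝ × ℝ | q.2 < q.1}.indicator
    (fun q => w q.1 q.2) (r, s) with hI
  have hIm : Measurable (Function.uncurry I) := hwc.indicator hset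
  calc ∫⁻ r in Set.Ioc 0 t, ∫⁻ s in Set.Ioc 0 r, w r s
      = ∫⁻ r in Set.Ioc 0 t, ∫⁻ s in Set.Ioc 0 t, I r s := by
        refine setLIntegral_congr_fun measurableSet_Ioc fun r hr => ?_
        have : ∀ s, I r s = (Set.Iio r).indicator (w r) s := fun s => by
          simp [hI, Set.indicator_apply]
        simp_rw [this]
        rw [lintegral_indicator measurableSet_Iio, Measure.restrict_restrict measurableSet_Iio,
          show Set.Iio r ∩ Set.Ioc 0 t = Set.Ioo 0 r by
            ext s
            have := hr.2
            simp only [Set.mem_inter_iff, Set.mem_Iio, Set.mem_Ioc, Set.mem_Ioo]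
            grind, restrict_Ioo_eq_restrict_Ioc]
    _ = ∫⁻ s in Set.Ioc 0 t, ∫⁻ r in Set.Ioc 0 t, I r s :=
        lintegral_lintegral_swap hIm.aemeasurable
    _ = _ := by
        refine setLIntegral_congr_fun measurableSet_Ioc fun s hs => ?_
        have : ∀ r, I r s = (Set.Ioi s).indicator (fun r => w r s) r := fun r => by
          simp [hI, Set.indicator_apply]
        simp_rw [this]
        rw [lintegral_indicator measurableSet_Ioi, Measure.restrict_restrict measurableSet_Ioi,
          Set.inter_comm, Set.Ioc_inter_Ioi, max_eq_right hs.1.le]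

/-- The integrated form of the relaxation inequality `τ F' ≤ G - F`, `F 0 ≤ e`. -/
lemma add_lintegral_le_of_duhamel_le (hτ : 0 < τ) {F G : ℝ → ENNReal} (hG : Measurable G)
    {e : ENNReal} {t : ℝ} (ht : 0 ≤ t)
    (hF : ∀ r, 0 ≤ r → F r ≤ ENNReal.ofReal (exp (-r / τ)) * e +
      ∫⁻ s in Set.Ioc 0 r, ENNReal.ofReal (1 / τ * exp (-(r - s) / τ)) * G s) :
    F t + ENNReal.ofReal (1 / τ) * ∫⁻ s in Set.Ioc 0 t, F s ≤
      e + ENNReal.ofReal (1 / τ) * ∫⁻ s in Set.Ioc 0 t, G s := by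
  set w : ℝ → ℝ → ENNReal := fun r s => ENNReal.ofReal (1 / τ * exp (-(r - s) / τ)) * G s with hw
  have hwm : Measurable (Function.uncurry w) := by
    have : Measurable fun q : ℝ × ℝ => w q.1 q.2 := by fun_prop
    exact this
  have hws : ∀ r s, w r s = ENNReal.ofReal (1 / τ) * (ENNReal.ofReal (exp (-(r - s) / τ)) * G s) :=
    fun r s => by
      simp only [hw]
      rw [ENNReal.ofReal_mul (by positivity), mul_assoc]
  have hint : ∫⁻ s in Set.Ioc 0 t, F s ≤
      (∫⁻ r in Set.Ioc 0 t, ENNReal.ofReal (exp (-(r - 0) / τ))) * e +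
        ∫⁻ s in Set.Ioc 0 t, ∫⁻ r in Set.Ioc s t, w r s := by
    rw [← lintegral_Ioc_triangle_swap hwm, ← lintegral_mul_const _ (by fun_prop),
      ← lintegral_add_left (by fun_prop)]
    refine setLIntegral_mono' measurableSet_Ioc fun r hr => ?_
    simpa only [sub_zero] using hF r hr.1.le
  have hGs : ∀ s ∈ Set.Ioc 0 t, w t s + ENNReal.ofReal (1 / τ) * ∫⁻ r in Set.Ioc s t, w r s =
      ENNReal.ofReal (1 / τ) * G s := fun s hs => by
    simp_rw [hws]
    rw [lintegral_const_mul _ (by fun_prop), lintegral_mul_const _ (by fun_prop), ← mul_add,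
      ← mul_assoc (ENNReal.ofReal (1 / τ)) _ (G s), ← add_mul,
      lintegral_exp_decay hτ hs.2, one_mul]
  have hwt : Measurable (w t) := by fun_prop
  calc F t + ENNReal.ofReal (1 / τ) * ∫⁻ s in Set.Ioc 0 t, F s
      ≤ (ENNReal.ofReal (exp (-(t - 0) / τ)) * e + ∫⁻ s in Set.Ioc 0 t, w t s) +
        ENNReal.ofReal (1 / τ) *
          ((∫⁻ r in Set.Ioc 0 t, ENNReal.ofReal (exp (-(r - 0) / τ))) * e +
            ∫⁻ s in Set.Ioc 0 t, ∫⁻ r in Set.Ioc s t, w r s) := by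
        gcongr
        simpa only [sub_zero] using hF t ht
    _ = (ENNReal.ofReal (exp (-(t - 0) / τ)) + ENNReal.ofReal (1 / τ) *
          ∫⁻ r in Set.Ioc 0 t, ENNReal.ofReal (exp (-(r - 0) / τ))) * e +
        ((∫⁻ s in Set.Ioc 0 t, w t s) +
          ENNReal.ofReal (1 / τ) * ∫⁻ s in Set.Ioc 0 t, ∫⁻ r in Set.Ioc s t, w r s) := by ring
    _ = _ := by
        rw [lintegral_exp_decay hτ ht, one_mul, ← lintegral_const_mul' _ _ ENNReal.ofReal_ne_top,
          ← lintegral_add_left hwt, setLIntegral_congr_fun measurableSet_Ioc hGs,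
          lintegral_const_mul _ hG]

lemma ae_ray_of_ae_Ioi {P : ℝ × En n → Prop} (hP : MeasurableSet {z | P z})
    (h : ∀ᵐ z ∂volume.restrict (Set.Ioi 0 ×ˢ Set.univ), P z) (t : ℝ) :
    ∀ᵐ p : En n × En n, ∀ᵐ s ∂volume.restrict (Set.Ioc 0 t), P (s, p.1 - (t - s) • p.2) := by
  rw [ae_restrict_iff' (measurableSet_Ioi.prod .univ), Measure.volume_eq_prod] at h
  have hm : MeasurableSet {q : ℝ × En n × En n | P (q.1, q.2.1 - (t - q.1) • q.2.2)} :=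
    hP.preimage (f := fun q : ℝ × En n × En n => (q.1, q.2.1 - (t - q.1) • q.2.2)) (by fun_prop)
  refine (Measure.ae_ae_comm (p := fun s (p : En n × En n) => P (s, p.1 - (t - s) • p.2)) hm).1 ?_
  filter_upwards [ae_restrict_of_ae (Measure.ae_ae_of_ae_prod h),
    ae_restrict_mem measurableSet_Ioc] with s hs hst
  refine ae_shear (t - s) (P := fun y => P (s, y)) ?_
  filter_upwards [hs] with y hy
  exact hy ⟨hst.1, trivial⟩

lemma measurable_functional {Θ : ℝ → En n → ℝ} (hΘ : IsConvexDensity Θ)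
    {f : ℝ → En n × En n → ℝ} (hf : Measurable (Function.uncurry f)) :
    Measurable fun s => functional Θ (f s) := by
  have hf' : Measurable fun q : ℝ × En n × En n => f q.1 q.2 := hf
  have : Measurable fun q : ℝ × En n × En n => ENNReal.ofReal (Θ (f q.1 q.2) q.2.2) :=
    (hΘ.measurable.comp (f := fun q : ℝ × En n × En n => (f q.1 q.2, q.2.2))
      (by fun_prop)).ennreal_ofReal
  exact this.lintegral_prod_right'

end

section

variable {n : ℕ} {γ κ τ δ : ℝ}

open Filter Topology

lemma integrable_and_integral_le {α : Type*} [MeasurableSpace α] {μ : Measure α} {F : α → ℝ}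
    (hF : Measurable F) (hF0 : ∀ a, 0 ≤ F a) {C : ℝ} (hC0 : 0 ≤ C)
    (h : ∫⁻ a, ENNReal.ofReal (F a) ∂μ ≤ ENNReal.ofReal C) :
    Integrable F μ ∧ ∫ a, F a ∂μ ≤ C := by
  refine ⟨(lintegral_ofReal_ne_top_iff_integrable hF.aestronglyMeasurable
    (.of_forall hF0)).1 (h.trans_lt ENNReal.ofReal_lt_top).ne, ?_⟩
  rw [integral_eq_lintegral_of_nonneg_ae (.of_forall hF0) hF.aestronglyMeasurable]
  exact ENNReal.toReal_le_of_le_ofReal hC0 h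

lemma functional_kinEnt_ne_top (hn : 1 ≤ n) (hγ1 : 1 < γ) (hγ2 : γ < ((n : ℝ) + 2) / n)
    (hκ : 0 < κ) {f₀ : En n × En n → ℝ} (hf₀m : Measurable f₀) (hf₀ : ∀ p, 0 ≤ f₀ p)
    (hint : Integrable (fun p : En n × En n => (1 + ‖p.2‖ ^ 2) * f₀ p))
    (hent : Integrable (fun p : En n × En n => f₀ p ^ (1 + 2 / dof n γ))) :
    functional (kinEnt n γ κ) f₀ ≠ ⊤ := by
  have hm : Measurable fun p : En n × En n => kinEnt n γ κ (f₀ p) p.2 :=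
    measurable_kinEnt.comp (f := fun p : En n × En n => (f₀ p, p.2)) (by fun_prop)
  refine (lintegral_ofReal_ne_top_iff_integrable hm.aestronglyMeasurable
    (.of_forall fun p => kinEnt_nonneg hn hγ1 hγ2 hκ (hf₀ p) _)).2 ?_
  have h2 : Integrable fun p : En n × En n => ‖p.2‖ ^ 2 * f₀ p := by
    refine hint.mono' (by fun_prop : Measurable _).aestronglyMeasurable (.of_forall fun p => ?_)
    rw [Real.norm_of_nonneg (mul_nonneg (by positivity) (hf₀ p))]
    nlinarith [hf₀ p]
  exact (h2.div_const 2).add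
    ((hent.const_mul (1 / (2 * cc2 n γ κ ^ (2 / dof n γ)))).div_const (1 + 2 / dof n γ))

lemma functional_mass_ne_top {f₀ : En n × En n → ℝ} (hf₀m : Measurable f₀) (hf₀ : ∀ p, 0 ≤ f₀ p)
    (hint : Integrable (fun p : En n × En n => (1 + ‖p.2‖ ^ 2) * f₀ p)) :
    functional (fun y (_ : En n) => y) f₀ ≠ ⊤ := by
  refine (lintegral_ofReal_ne_top_iff_integrable hf₀m.aestronglyMeasurable
    (.of_forall hf₀)).2 (hint.mono' hf₀m.aestronglyMeasurable (.of_forall fun p => ?_))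
  rw [Real.norm_of_nonneg (hf₀ p)]
  nlinarith [mul_nonneg (sq_nonneg ‖p.2‖) (hf₀ p)]

/-- The kinetic entropy inequality for solutions with finite entropy. -/
lemma entropy_inequality (hn : 1 ≤ n) (hγ1 : 1 < γ) (hγ2 : γ < ((n : ℝ) + 2) / n)
    (hκ : 0 < κ) (hτ : 0 < τ) {f₀ : En n × En n → ℝ} (hf₀m : Measurable f₀)
    (hf₀ : ∀ p, 0 ≤ f₀ p) (hfin : functional (kinEnt n γ κ) f₀ ≠ ⊤)
    {f g : ℝ → En n × En n → ℝ} (hf : Measurable (Function.uncurry f)) (hf0 : ∀ s p, 0 ≤ f s p)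
    (hg : Measurable (Function.uncurry g)) (hg0 : ∀ s p, 0 ≤ g s p)
    (hfe : ∀ t, 0 ≤ t → functional (kinEnt n γ κ) (f t) ≤
      ENNReal.ofReal (exp (-t / τ)) * functional (kinEnt n γ κ) f₀ +
      ∫⁻ s in Set.Ioc 0 t, ENNReal.ofReal (1 / τ * exp (-(t - s) / τ)) *
        functional (kinEnt n γ κ) (g s))
    (hfE : ∀ t, 0 ≤ t → functional (kinEnt n γ κ) (f t) ≤ functional (kinEnt n γ κ) f₀)
    (hgE : ∀ᵐ s, 0 < s → functional (kinEnt n γ κ) (g s) ≤ functional (kinEnt n γ κ) f₀)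
    {t : ℝ} (ht : 0 ≤ t) :
    (∫ p : En n × En n, kinEnt n γ κ (f t p) p.2) +
      (1 / τ) * ∫ s in (0 : ℝ)..t, ∫ p : En n × En n,
        (kinEnt n γ κ (f s p) p.2 - kinEnt n γ κ (g s p) p.2) ≤
      ∫ p : En n × En n, kinEnt n γ κ (f₀ p) p.2 := by
  have hH := isConvexDensity_kinEnt hn hγ1 hγ2 hκ
  have hm : ∀ u : En n × En n → ℝ, Measurable u →
      Measurable fun p : En n × En n => kinEnt n γ κ (u p) p.2 := fun u hu =>
    measurable_kinEnt.comp (f := fun p : En n × En n => (u p, p.2)) (by fun_prop)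
  have heq : ∀ u : En n × En n → ℝ, Measurable u → (∀ p, 0 ≤ u p) →
      ∫ p, kinEnt n γ κ (u p) p.2 = (functional (kinEnt n γ κ) u).toReal := fun u hu hu0 =>
    integral_eq_lintegral_of_nonneg_ae
      (.of_forall fun p => kinEnt_nonneg hn hγ1 hγ2 hκ (hu0 p) _) (hm u hu).aestronglyMeasurable
  have hint : ∀ u : En n × En n → ℝ, Measurable u → (∀ p, 0 ≤ u p) →
      functional (kinEnt n γ κ) u ≠ ⊤ → Integrable fun p => kinEnt n γ κ (u p) p.2 :=
    fun u hu hu0 => (lintegral_ofReal_ne_top_iff_integrable (hm u hu).aestronglyMeasurable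
      (.of_forall fun p => kinEnt_nonneg hn hγ1 hγ2 hκ (hu0 p) _)).1
  have hfs : ∀ s, Measurable (f s) := fun s => hf.comp (f := fun p => (s, p)) (by fun_prop)
  have hgs : ∀ s, Measurable (g s) := fun s => hg.comp (f := fun p => (s, p)) (by fun_prop)
  have hFm := measurable_functional hH hf
  have hGm := measurable_functional hH hg
  have hbd : ∀ F : ℝ → ENNReal, Measurable F →
      (∀ᵐ s ∂volume.restrict (Set.Ioc 0 t), F s ≤ functional (kinEnt n γ κ) f₀) →
      ∫⁻ s in Set.Ioc 0 t, F s ≠ ⊤ := fun F hF hle => by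
    refine ((lintegral_mono_ae hle).trans_lt ?_).ne
    rw [setLIntegral_const]
    exact ENNReal.mul_lt_top hfin.lt_top (by simp)
  have hF1 : ∀ᵐ s ∂volume.restrict (Set.Ioc 0 t),
      functional (kinEnt n γ κ) (f s) ≤ functional (kinEnt n γ κ) f₀ := by
    filter_upwards [ae_restrict_mem measurableSet_Ioc] with s hs
    exact hfE s hs.1.le
  have hG1 : ∀ᵐ s ∂volume.restrict (Set.Ioc 0 t),
      functional (kinEnt n γ κ) (g s) ≤ functional (kinEnt n γ κ) f₀ := by
    filter_upwards [ae_restrict_mem measurableSet_Ioc, ae_restrict_of_ae hgE] with s hs hs'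
    exact hs' hs.1
  have hF2 := hbd _ hFm hF1
  have hG2 := hbd _ hGm hG1
  have hinner : ∫ s in (0 : ℝ)..t, ∫ p : En n × En n,
        (kinEnt n γ κ (f s p) p.2 - kinEnt n γ κ (g s p) p.2) =
      (∫⁻ s in Set.Ioc 0 t, functional (kinEnt n γ κ) (f s)).toReal -
        (∫⁻ s in Set.Ioc 0 t, functional (kinEnt n γ κ) (g s)).toReal := by
    rw [intervalIntegral.integral_of_le ht,
      ← integral_toReal hFm.aemeasurable (hF1.mono fun s hs => hs.trans_lt hfin.lt_top),
      ← integral_toReal hGm.aemeasurable (hG1.mono fun s hs => hs.trans_lt hfin.lt_top),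
      ← integral_sub (integrable_toReal_of_lintegral_ne_top hFm.aemeasurable hF2)
        (integrable_toReal_of_lintegral_ne_top hGm.aemeasurable hG2)]
    refine integral_congr_ae ?_
    filter_upwards [hF1, hG1] with s hs hs'
    rw [integral_sub (hint _ (hfs s) (hf0 s) (hs.trans_lt hfin.lt_top).ne)
      (hint _ (hgs s) (hg0 s) (hs'.trans_lt hfin.lt_top).ne), heq _ (hfs s) (hf0 s),
      heq _ (hgs s) (hg0 s)]
  have hkey := add_lintegral_le_of_duhamel_le hτ hGm ht hfe
  rw [hinner, heq _ (hfs t) (hf0 t), heq _ hf₀m hf₀]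
  have hft : functional (kinEnt n γ κ) (f t) ≠ ⊤ := ((hfE t ht).trans_lt hfin.lt_top).ne
  have hr := ENNReal.toReal_mono (ENNReal.add_ne_top.2
    ⟨hfin, ENNReal.mul_ne_top ENNReal.ofReal_ne_top hG2⟩) hkey
  rw [ENNReal.toReal_add hft (ENNReal.mul_ne_top ENNReal.ofReal_ne_top hF2),
    ENNReal.toReal_add hfin (ENNReal.mul_ne_top ENNReal.ofReal_ne_top hG2), ENNReal.toReal_mul,
    ENNReal.toReal_mul, ENNReal.toReal_ofReal (by positivity)] at hr
  linarith

end

/-- Global existence of mild entropy solutions to the BGK model for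
`γ ∈ (1, (n+2)/n)` with finite kinetic entropy initial data. -/
theorem stmt0 (n : ℕ) (hn : 1 ≤ n) (γ κ τ : ℝ)
    (hγ1 : 1 < γ) (hγ2 : γ < ((n : ℝ) + 2) / n) (hκ : 0 < κ) (hτ : 0 < τ)
    (f₀ : En n × En n → ℝ) (hf₀meas : Measurable f₀) (hf₀nonneg : ∀ p, 0 ≤ f₀ p)
    (hf₀int : Integrable (fun p : En n × En n => (1 + ‖p.2‖ ^ 2) * f₀ p))
    (hf₀ent : Integrable (fun p : En n × En n => f₀ p ^ (1 + 2 / dof n γ))) :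
    ∃ f : ℝ → En n × En n → ℝ,
      Measurable (Function.uncurry f) ∧
      (∀ t p, 0 ≤ f t p) ∧
      (∃ C : ℝ, ∀ t : ℝ, 0 ≤ t →
        Integrable (fun p : En n × En n => (1 + ‖p.2‖ ^ 2) * f t p) ∧
        (∫ p : En n × En n, (1 + ‖p.2‖ ^ 2) * f t p) ≤ C ∧
        Integrable (fun p : En n × En n => f t p ^ (1 + 2 / dof n γ)) ∧
        (∫ p : En n × En n, f t p ^ (1 + 2 / dof n γ)) ≤ C) ∧
      -- (i) mild form
      (∀ t : ℝ, 0 ≤ t → ∀ᵐ p : En n × En n,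
        f t p = Real.exp (-t / τ) * f₀ (p.1 - t • p.2, p.2) +
          (1 / τ) * ∫ s in (0:ℝ)..t,
            Real.exp (-(t - s) / τ) *
              MaxwOf n γ κ (fun w => f s (p.1 - (t - s) • p.2, w)) p.2) ∧
      -- (ii) kinetic entropy inequality
      (∀ t : ℝ, 0 ≤ t →
        (∫ p : En n × En n, kinEnt n γ κ (f t p) p.2) +
          (1 / τ) * ∫ s in (0:ℝ)..t, ∫ p : En n × En n,
            (kinEnt n γ κ (f s p) p.2 -
              kinEnt n γ κ (MaxwOf n γ κ (fun w => f s (p.1, w)) p.2) p.2)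
        ≤ ∫ p : En n × En n, kinEnt n γ κ (f₀ p) p.2) := by
  obtain ⟨K, hK0, hK⟩ := exists_lintegral_weight_le hn hγ1 hγ2 hκ
  obtain ⟨K', hK0', hK'⟩ := exists_le_kinEnt hn hγ1 hγ2 hκ
  have hE := functional_kinEnt_ne_top hn hγ1 hγ2 hκ hf₀meas hf₀nonneg hf₀int hf₀ent
  have hM := functional_mass_ne_top hf₀meas hf₀nonneg hf₀int
  have hH := isConvexDensity_kinEnt hn hγ1 hγ2 hκ
  have hHM := decreasesUnderMaxw_kinEnt hn hγ1 hγ2 hκ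
  set B := functional (fun y (_ : En n) => y) f₀ +
    ENNReal.ofReal K * functional (kinEnt n γ κ) f₀ with hBdef
  have hB : B ≠ ⊤ := ENNReal.add_ne_top.2 ⟨hM, ENNReal.mul_ne_top ENNReal.ofReal_ne_top hE⟩
  have hw : ∀ f : En n × En n → ℝ, Measurable f → (∀ p, 0 ≤ f p) →
      (∀ Θ : ℝ → En n → ℝ, IsConvexDensity Θ → DecreasesUnderMaxw γ κ Θ →
        functional Θ f ≤ functional Θ f₀) →
      ∫⁻ p : En n × En n, ENNReal.ofReal (1 + ‖p.2‖ ^ 2) * ENNReal.ofReal (f p) ≤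
        ENNReal.ofReal B.toReal := by
    intro f hf hf0 hfΘ
    rw [ENNReal.ofReal_toReal hB]
    refine (hK f hf hf0).trans ?_
    have h1 := hfΘ _ isConvexDensity_mass (decreasesUnderMaxw_mass hn hγ1 hγ2 hκ)
    exact add_le_add h1 (mul_le_mul_right (hfΘ _ hH hHM) _)
  obtain ⟨h, hhm, hh0, hgΘ, hmom⟩ := exists_mild_solution hn hγ1 hγ2 hκ hτ hf₀meas hf₀nonneg
    ENNReal.toReal_nonneg (hw f₀ hf₀meas hf₀nonneg fun _ _ _ => le_rfl) hw
  set g := maxwLift γ κ h with hg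
  have hgm : Measurable (Function.uncurry g) := measurable_maxwLift hhm
  have hg0 : ∀ s p, 0 ≤ g s p := maxwLift_nonneg hn hγ1 hγ2 hκ h
  set f := mildMap τ 0 f₀ g with hf
  have hfm : Measurable (Function.uncurry f) := measurable_mildMap hf₀meas hgm
  have hf0 : ∀ s p, 0 ≤ f s p := mildMap_nonneg hτ hf₀nonneg hg0
  have hfs : ∀ s, Measurable (f s) := fun s => hfm.comp (f := fun p => (s, p)) (by fun_prop)
  have hfΘ : ∀ t, 0 ≤ t → ∀ Θ : ℝ → En n → ℝ, IsConvexDensity Θ → DecreasesUnderMaxw γ κ Θ →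
      functional Θ (f t) ≤ functional Θ f₀ := fun t ht Θ hΘ hΘM =>
    hΘ.functional_mildMap_le_of_le hτ le_rfl hf₀meas hf₀nonneg hgm hg0 ht
      (hgΘ.mono fun s hs hst => hs hst.1 Θ hΘ hΘM)
  refine ⟨f, hfm, hf0, ⟨max B.toReal (K' * (functional (kinEnt n γ κ) f₀).toReal),
    fun t ht => ?_⟩, fun t ht => ?_, fun t ht => ?_⟩
  · have h1 := integrable_and_integral_le (μ := volume)
      (F := fun p : En n × En n => (1 + ‖p.2‖ ^ 2) * f t p) (by fun_prop)
      (fun p => mul_nonneg (by positivity) (hf0 t p)) ENNReal.toReal_nonneg (by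
        refine le_trans (le_of_eq ?_) (hw (f t) (hfs t) (hf0 t) (hfΘ t ht))
        exact lintegral_congr fun p => ENNReal.ofReal_mul (by positivity))
    have h2 := integrable_and_integral_le (μ := volume)
      (F := fun p : En n × En n => f t p ^ (1 + 2 / dof n γ)) (by fun_prop)
      (fun p => rpow_nonneg (hf0 t p) _)
      (C := K' * (functional (kinEnt n γ κ) f₀).toReal) (by positivity) (by
        rw [ENNReal.ofReal_mul hK0'.le, ENNReal.ofReal_toReal hE]
        refine le_trans ?_ (mul_le_mul_right (hfΘ t ht _ hH hHM) _)
        rw [functional, ← lintegral_const_mul' _ _ ENNReal.ofReal_ne_top]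
        refine lintegral_mono fun p => ?_
        rw [← ENNReal.ofReal_mul hK0'.le]
        exact ENNReal.ofReal_le_ofReal (hK' _ _ (hf0 t p)).1)
    exact ⟨h1.1, h1.2.trans (le_max_left _ _), h2.1, h2.2.trans (le_max_right _ _)⟩
  · filter_upwards [ae_ray_of_ae_Ioi (P := fun z => momField f z = h z)
      (measurableSet_eq_fun (measurable_momField hfm) hhm) hmom t] with p hp
    rw [hf, mildMap, sub_zero, ← hf, intervalIntegral.integral_of_le ht]
    congr 2
    refine integral_congr_ae ?_
    filter_upwards [hp] with s hs
    rw [MaxwOf_eq_maxwMom]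
    congr 2
    rw [hg, maxwLift]
    simp only
    rw [← hs]
    rfl
  · have hmax : ∀ᵐ s, 0 < s → ∀ᵐ p, maxwField γ κ f s p = g s p := by
      rw [ae_restrict_iff' (measurableSet_Ioi.prod .univ), Measure.volume_eq_prod] at hmom
      filter_upwards [Measure.ae_ae_of_ae_prod hmom] with s hs hs0
      rw [Measure.volume_eq_prod]
      filter_upwards [Measure.quasiMeasurePreserving_fst.ae hs] with p hp
      rw [maxwField_eq, hp ⟨hs0, trivial⟩, hg, maxwLift]
    have he : ∫ s in (0 : ℝ)..t, ∫ p : En n × En n, (kinEnt n γ κ (f s p) p.2 -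
          kinEnt n γ κ (MaxwOf n γ κ (fun w => f s (p.1, w)) p.2) p.2) =
        ∫ s in (0 : ℝ)..t, ∫ p : En n × En n,
          (kinEnt n γ κ (f s p) p.2 - kinEnt n γ κ (g s p) p.2) := by
      rw [intervalIntegral.integral_of_le ht, intervalIntegral.integral_of_le ht]
      refine integral_congr_ae ?_
      filter_upwards [ae_restrict_of_ae hmax, ae_restrict_mem measurableSet_Ioc] with s hs hst
      refine integral_congr_ae ?_
      filter_upwards [hs hst.1] with p hp
      rw [← hp, maxwField]
    rw [he]
    exact entropy_inequality hn hγ1 hγ2 hκ hτ hf₀meas hf₀nonneg hE hfm hf0 hgm hg0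
      (fun t ht => hH.functional_mildMap_le hτ le_rfl hf₀meas hf₀nonneg hgm hg0 ht)
      (fun t ht => hfΘ t ht _ hH hHM) (hgΘ.mono fun s hs hs0 => hs hs0 _ hH hHM) ht
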